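/- arXiv:1505.06748 — 3 statements merged into one kernel-verified Lean document; each statement's English description precedes it below -/
import Mathlib

section
/- Let φ : ∂𝔻 → ℝ be continuous. Then the following are equivalent: (a) there exist a smooth convex function f : ℝ² → ℝ with ‖∇f(p)‖ < 1 for all p ∈ ℝ² and a constant d > 0 such that D²f(p)(v,v) ≥ d·√(1−‖∇f(p)‖²)·(‖v‖² − ⟨∇f(p),v⟩²) for all p, v ∈ ℝ² (i.e. the graph of f is a spacelike entire graph whose principal curvatures are bounded from below by the positive constant d), and lim_{r→+∞}(r − f(rz)) = φ(z) for every z ∈ ∂𝔻; (b) φ is in the Zygmund class. -/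
open Metric Filter
open scoped RealInnerProductSpace Topology

noncomputable section

/-- The plane `ℝ²`, as a Euclidean space. -/
abbrev E2 : Type := EuclideanSpace ℝ (Fin 2)

/-- The Hessian of `f : ℝ² → ℝ` at `p`, evaluated as a bilinear form on `(v, w)`. -/
def hess (f : E2 → ℝ) (p v w : E2) : ℝ := fderiv ℝ (fderiv ℝ f) p v w

/-- The determinant of the Hessian of `f : ℝ² → ℝ` at `p`. -/
def detHess (f : E2 → ℝ) (p : E2) : ℝ :=
  hess f p (EuclideanSpace.single 0 1) (EuclideanSpace.single 0 1) *
    hess f p (EuclideanSpace.single 1 1) (EuclideanSpace.single 1 1) -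
  hess f p (EuclideanSpace.single 0 1) (EuclideanSpace.single 1 1) *
    hess f p (EuclideanSpace.single 1 1) (EuclideanSpace.single 0 1)
/-- The point `(cos θ, sin θ)` of the unit circle `∂𝔻 ⊆ ℝ²`. -/
def circ (θ : ℝ) : E2 :=
  EuclideanSpace.single 0 (Real.cos θ) + EuclideanSpace.single 1 (Real.sin θ)

/-- `φ : ∂𝔻 → ℝ` is in the Zygmund class:
`|φ(e^{i(θ+h)}) + φ(e^{i(θ−h)}) − 2φ(e^{iθ})| ≤ C|h|` for all `θ, h`. -/
def ZygmundClass (φ : E2 → ℝ) : Prop :=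
  ∃ C : ℝ, ∀ θ h : ℝ,
    |φ (circ (θ + h)) + φ (circ (θ - h)) - 2 * φ (circ θ)| ≤ C * |h|

/-! ### Legendre transform -/

lemma line_hasDerivAt (x w : E2) (t : ℝ) : HasDerivAt (fun t : ℝ => x + t • w) w t := by
  simpa using ((hasDerivAt_id t).smul_const w).const_add x

lemma gradient_inner (g : E2 → ℝ) (x w : E2) : ⟪gradient g x, w⟫ = fderiv ℝ g x w :=
  inner_gradient_left

lemma gradient_contDiffAt {g : E2 → ℝ} {x : E2} (hg : ContDiffAt ℝ (⊤ : ℕ∞) g x) :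
    ContDiffAt ℝ (⊤ : ℕ∞) (gradient g) x := by
  have h1 : ContDiffAt ℝ (⊤ : ℕ∞) (fderiv ℝ g) x := hg.fderiv_right (by simp)
  exact (InnerProductSpace.toDual ℝ E2).symm.toContinuousLinearEquiv.contDiff.contDiffAt.comp x h1

lemma fderiv_gradient_inner {g : E2 → ℝ} {x : E2} (hg : ContDiffAt ℝ (⊤ : ℕ∞) g x) (w v : E2) :
    ⟪fderiv ℝ (gradient g) x w, v⟫ = hess g x w v := by
  have h1 : ContDiffAt ℝ (⊤ : ℕ∞) (fderiv ℝ g) x := hg.fderiv_right (by simp)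
  have h2 : HasFDerivAt (fderiv ℝ g) (fderiv ℝ (fderiv ℝ g) x) x :=
    (h1.differentiableAt (by simp)).hasFDerivAt
  have h3 := ((gradient_contDiffAt hg).differentiableAt (by simp)).hasFDerivAt
  have h4 : HasFDerivAt (fun x => ⟪gradient g x, v⟫)
      ((innerSL ℝ v).comp (fderiv ℝ (gradient g) x)) x := by
    have := (innerSL ℝ v).hasFDerivAt.comp x h3
    refine this.congr_of_eventuallyEq (Eventually.of_forall fun y => ?_)
    simp [real_inner_comm]
  have h5 : HasFDerivAt (fun x => ⟪gradient g x, v⟫)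
      ((ContinuousLinearMap.apply ℝ ℝ v).comp (fderiv ℝ (fderiv ℝ g) x)) x := by
    have := (ContinuousLinearMap.apply ℝ ℝ v).hasFDerivAt.comp x h2
    refine this.congr_of_eventuallyEq (Eventually.of_forall fun y => ?_)
    simp [gradient_inner]
  have h6 := congrArg (fun L : E2 →L[ℝ] ℝ => L w) (h4.unique h5)
  simp only [ContinuousLinearMap.comp_apply, innerSL_apply_apply,
    ContinuousLinearMap.apply_apply] at h6
  rw [real_inner_comm, h6, hess]

lemma line_deriv1 {g : E2 → ℝ} {x w : E2} {t : ℝ} (hg : ContDiffAt ℝ (⊤ : ℕ∞) g (x + t • w)) :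
    HasDerivAt (fun t : ℝ => g (x + t • w)) (fderiv ℝ g (x + t • w) w) t := by
  have h := (hg.differentiableAt (by simp)).hasFDerivAt
  exact h.comp_hasDerivAt t (line_hasDerivAt x w t)

lemma line_deriv2 {g : E2 → ℝ} {x w v : E2} {t : ℝ} (hg : ContDiffAt ℝ (⊤ : ℕ∞) g (x + t • w)) :
    HasDerivAt (fun t : ℝ => fderiv ℝ g (x + t • w) v) (hess g (x + t • w) w v) t := by
  have h1 : ContDiffAt ℝ (⊤ : ℕ∞) (fderiv ℝ g) (x + t • w) := hg.fderiv_right (by simp)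
  have h := (h1.differentiableAt (by simp)).hasFDerivAt
  have h2 := h.comp_hasDerivAt t (line_hasDerivAt x w t)
  have h3 := (ContinuousLinearMap.apply ℝ ℝ v).hasFDerivAt.comp_hasDerivAt t h2
  exact h3

/-- Strict monotonicity of the gradient under a positive Hessian. -/
lemma grad_injOn {U : Set E2} (hU : IsOpen U) (hc : Convex ℝ U) {g : E2 → ℝ}
    (hg : ContDiffOn ℝ (⊤ : ℕ∞) g U) (hpos : ∀ x ∈ U, ∀ w : E2, w ≠ 0 → 0 < hess g x w w) :
    Set.InjOn (gradient g) U := by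
  intro a ha b hb hab
  by_contra hne
  have hw : b - a ≠ 0 := sub_ne_zero.mpr (Ne.symm hne)
  have hmem : ∀ t ∈ Set.Icc (0 : ℝ) 1, a + t • (b - a) ∈ U := by
    intro t ht
    exact hc.add_smul_sub_mem ha hb ht
  have hd : ∀ t ∈ Set.Icc (0 : ℝ) 1,
      HasDerivAt (fun t : ℝ => fderiv ℝ g (a + t • (b - a)) (b - a))
        (hess g (a + t • (b - a)) (b - a) (b - a)) t := fun t ht =>
    line_deriv2 (hg.contDiffAt (hU.mem_nhds (hmem t ht)))
  have hcont : ContinuousOn (fun t : ℝ => fderiv ℝ g (a + t • (b - a)) (b - a))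
      (Set.Icc (0 : ℝ) 1) := fun t ht => (hd t ht).continuousAt.continuousWithinAt
  obtain ⟨c, hc1, hc2⟩ := exists_hasDerivAt_eq_slope _ _ (zero_lt_one) hcont
    (fun t ht => hd t (Set.Ioo_subset_Icc_self ht))
  have hp := hpos _ (hmem c (Set.Ioo_subset_Icc_self hc1)) _ hw
  rw [hc2] at hp
  simp only [one_smul, zero_smul, add_zero, add_sub_cancel] at hp
  rw [← gradient_inner, ← gradient_inner, hab] at hp
  simp at hp

lemma legendre {U V : Set E2} (hU : IsOpen U) (hc : Convex ℝ U) {g : E2 → ℝ}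
    (hg : ContDiffOn ℝ (⊤ : ℕ∞) g U) (hpos : ∀ x ∈ U, ∀ w : E2, w ≠ 0 → 0 < hess g x w w)
    (hV : IsOpen V) {G : E2 → E2} (hGU : ∀ y ∈ V, G y ∈ U) (hG : ∀ y ∈ V, gradient g (G y) = y) :
    (∀ y ∈ V, ContDiffAt ℝ (⊤ : ℕ∞) G y) ∧
    (∀ y ∈ V, HasFDerivAt (fun y => ⟪y, G y⟫ - g (G y)) (innerSL ℝ (G y)) y) ∧
    (∀ y ∈ V, ∀ v w : E2, hess g (G y) (fderiv ℝ G y v) w = ⟪v, w⟫) := by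
  have hinj := grad_injOn hU hc hg hpos
  have h1 : ∀ y ∈ V, ContDiffAt ℝ (⊤ : ℕ∞) G y := by
    intro y hy
    have hx : ContDiffAt ℝ (⊤ : ℕ∞) g (G y) := hg.contDiffAt (hU.mem_nhds (hGU y hy))
    have hT := gradient_contDiffAt hx
    set L := fderiv ℝ (gradient g) (G y) with hL
    have hLinj : Function.Injective (L : E2 →ₗ[ℝ] E2) := by
      rw [← LinearMap.ker_eq_bot, LinearMap.ker_eq_bot']
      intro w hw
      by_contra hne
      have := hpos _ (hGU y hy) w hne
      rw [← fderiv_gradient_inner hx, ← hL] at this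
      have hw' : L w = 0 := hw
      rw [hw'] at this
      simp at this
    let e : E2 ≃L[ℝ] E2 := (LinearEquiv.ofInjectiveEndo (L : E2 →ₗ[ℝ] E2) hLinj).toContinuousLinearEquiv
    have he : (e : E2 →L[ℝ] E2) = L := by
      ext w
      rfl
    have hTd : HasFDerivAt (gradient g) (e : E2 →L[ℝ] E2) (G y) := by
      rw [he]; exact (hT.differentiableAt (by simp)).hasFDerivAt
    have hn : ((⊤ : ℕ∞) : WithTop ℕ∞) ≠ 0 := by simp
    have hk := hT.to_localInverse hTd hn
    have hk0 := hT.localInverse_apply_image hTd hn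
    have hr := (hT.hasStrictFDerivAt' hTd hn).eventually_right_inverse
    set k := hT.localInverse hTd hn with hkdef
    rw [hG y hy] at hk hk0 hr
    have hkU : ∀ᶠ z in 𝓝 y, k z ∈ U := by
      apply hk.continuousAt.eventually_mem
      rw [hk0]
      exact hU.mem_nhds (hGU y hy)
    refine hk.congr_of_eventuallyEq ?_
    filter_upwards [hkU, hr, hV.mem_nhds hy] with z hz1 hz2 hz3
    apply hinj (hGU z hz3) hz1
    rw [hG z hz3]
    exact hz2.symm
  refine ⟨h1, ?_, ?_⟩
  · intro y hy
    have hGd := ((h1 y hy).differentiableAt (by simp)).hasFDerivAt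
    have hx : ContDiffAt ℝ (⊤ : ℕ∞) g (G y) := hg.contDiffAt (hU.mem_nhds (hGU y hy))
    have hgd := (hx.differentiableAt (by simp)).hasFDerivAt
    have h2 := ((hasFDerivAt_id y).inner ℝ hGd).sub (hgd.comp y hGd)
    refine HasFDerivAt.congr_fderiv h2 ?_
    ext w
    simp only [ContinuousLinearMap.sub_apply, ContinuousLinearMap.comp_apply,
      innerSL_apply_apply, ContinuousLinearMap.prod_apply, fderivInnerCLM_apply]
    rw [← gradient_inner, hG y hy]
    simp [real_inner_comm]
  · intro y hy v w
    have hGd := ((h1 y hy).differentiableAt (by simp)).hasFDerivAt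
    have hx : ContDiffAt ℝ (⊤ : ℕ∞) g (G y) := hg.contDiffAt (hU.mem_nhds (hGU y hy))
    have hT := ((gradient_contDiffAt hx).differentiableAt (by simp)).hasFDerivAt
    have h2 := hT.comp y hGd
    have h3 : HasFDerivAt (gradient g ∘ G) (ContinuousLinearMap.id ℝ E2) y := by
      refine (hasFDerivAt_id y).congr_of_eventuallyEq ?_
      filter_upwards [hV.mem_nhds hy] with z hz
      exact hG z hz
    have h4 := congrArg (fun L : E2 →L[ℝ] E2 => L v) (h2.unique h3)
    simp only [ContinuousLinearMap.comp_apply, ContinuousLinearMap.id_apply] at h4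
    rw [← fderiv_gradient_inner hx, h4]

/-! ### Algebra in the plane -/

lemma inner_coord (x y : E2) : ⟪x, y⟫ = x 0 * y 0 + x 1 * y 1 := by
  simp [PiLp.inner_apply, Fin.sum_univ_two]; ring

lemma norm_sq_coord (x : E2) : ‖x‖ ^ 2 = x 0 ^ 2 + x 1 ^ 2 := by
  rw [EuclideanSpace.norm_sq_eq]; simp [Fin.sum_univ_two]

@[simp] lemma circ_zero (θ : ℝ) : circ θ 0 = Real.cos θ := by simp [circ]
@[simp] lemma circ_one (θ : ℝ) : circ θ 1 = Real.sin θ := by simp [circ]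

lemma norm_circ (θ : ℝ) : ‖circ θ‖ = 1 := by
  have : ‖circ θ‖ ^ 2 = 1 := by rw [norm_sq_coord]; simp
  exact (sq_eq_sq₀ (norm_nonneg _) zero_le_one).mp (by simpa using this)

lemma circ_mem (θ : ℝ) : circ θ ∈ sphere (0 : E2) 1 := by simp [norm_circ]

lemma circ_eq (θ : ℝ) : circ θ = !₂[Real.cos θ, Real.sin θ] := by
  ext i
  fin_cases i <;> simp

lemma continuous_circ : Continuous circ := by
  have : circ = fun θ => !₂[Real.cos θ, Real.sin θ] := funext circ_eq
  rw [this]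
  fun_prop

lemma exists_circ {z : E2} (hz : ‖z‖ = 1) : ∃ θ, z = circ θ := by
  have h : z 0 ^ 2 + z 1 ^ 2 = 1 := by rw [← norm_sq_coord, hz]; norm_num
  refine ⟨Complex.arg ⟨z 0, z 1⟩, ?_⟩
  have hn : ‖(⟨z 0, z 1⟩ : ℂ)‖ = 1 := by
    rw [Complex.norm_def, Complex.normSq_mk, ← sq, ← sq, h, Real.sqrt_one]
  have h0 : (⟨z 0, z 1⟩ : ℂ) ≠ 0 := by
    intro h'; rw [h'] at hn; simp at hn
  ext i
  fin_cases i
  · simp [Complex.cos_arg h0, hn]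
  · simp [Complex.sin_arg, hn]

/-- The duality between the first fundamental form and its inverse. -/
lemma pair_cs (y v w : E2) :
    (1 - ‖y‖ ^ 2) * ⟪w, v⟫ ^ 2 ≤
      (‖w‖ ^ 2 - ⟪y, w⟫ ^ 2) * ((1 - ‖y‖ ^ 2) * ‖v‖ ^ 2 + ⟪y, v⟫ ^ 2) := by
  simp only [inner_coord, norm_sq_coord]
  have : 0 ≤ (w 0 * ((1 - (y 0 ^ 2 + y 1 ^ 2)) * v 1 + (y 0 * v 0 + y 1 * v 1) * y 1) -
    w 1 * ((1 - (y 0 ^ 2 + y 1 ^ 2)) * v 0 + (y 0 * v 0 + y 1 * v 1) * y 0)) ^ 2 := sq_nonneg _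
  nlinarith [this]

/-- The function `√(1-|y|²)`. -/
def WW (y : E2) : ℝ := Real.sqrt (1 - ‖y‖ ^ 2)

/-- The Hessian form of `-√(1-|y|²)`. -/
def HH (y w : E2) : ℝ := ‖w‖ ^ 2 / WW y + ⟪y, w⟫ ^ 2 / WW y ^ 3

lemma one_sub_pos {y : E2} (hy : ‖y‖ < 1) : 0 < 1 - ‖y‖ ^ 2 := by
  nlinarith [norm_nonneg y]

lemma WW_pos {y : E2} (hy : ‖y‖ < 1) : 0 < WW y := Real.sqrt_pos.mpr (one_sub_pos hy)

lemma WW_sq {y : E2} (hy : ‖y‖ < 1) : WW y ^ 2 = 1 - ‖y‖ ^ 2 :=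
  Real.sq_sqrt (one_sub_pos hy).le

lemma HH_nonneg {y : E2} (hy : ‖y‖ < 1) (w : E2) : 0 ≤ HH y w := by
  have := WW_pos hy
  unfold HH; positivity

lemma HH_pos {y : E2} (hy : ‖y‖ < 1) {w : E2} (hw : w ≠ 0) : 0 < HH y w := by
  have := WW_pos hy
  have := norm_pos_iff.mpr hw
  unfold HH; positivity

lemma WW_contDiffAt {y : E2} (hy : ‖y‖ < 1) : ContDiffAt ℝ (⊤ : ℕ∞) WW y := by
  unfold WW
  refine ContDiffAt.sqrt ?_ (one_sub_pos hy).ne'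
  exact contDiffAt_const.sub (contDiff_norm_sq ℝ).contDiffAt

lemma pair_cs' {y : E2} (hy : ‖y‖ < 1) (v w : E2) :
    ⟪w, v⟫ ^ 2 ≤ (WW y * (‖w‖ ^ 2 - ⟪y, w⟫ ^ 2)) * HH y v := by
  have hW := WW_pos hy
  have h := pair_cs y v w
  rw [← WW_sq hy] at h
  have : (WW y * (‖w‖ ^ 2 - ⟪y, w⟫ ^ 2)) * HH y v =
    (‖w‖ ^ 2 - ⟪y, w⟫ ^ 2) * (WW y ^ 2 * ‖v‖ ^ 2 + ⟪y, v⟫ ^ 2) / WW y ^ 2 := by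
    unfold HH; field_simp
  rw [this, le_div_iff₀ (by positivity)]
  linarith

lemma norm_line_sq (y w : E2) (t : ℝ) :
    ‖y + t • w‖ ^ 2 = ‖y‖ ^ 2 + 2 * t * ⟪y, w⟫ + t ^ 2 * ‖w‖ ^ 2 := by
  rw [norm_add_sq_real, real_inner_smul_right, norm_smul, mul_pow, Real.norm_eq_abs, sq_abs]; ring

lemma inner_line (y w : E2) (t : ℝ) : ⟪y + t • w, w⟫ = ⟪y, w⟫ + t * ‖w‖ ^ 2 := by
  rw [inner_add_left, real_inner_smul_left, real_inner_self_eq_norm_sq]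

lemma inner_line_hasDerivAt (y w : E2) (t : ℝ) :
    HasDerivAt (fun t : ℝ => ⟪y + t • w, w⟫) (‖w‖ ^ 2) t := by
  simp only [inner_line]
  simpa using ((hasDerivAt_id t).mul_const (‖w‖ ^ 2)).const_add ⟪y, w⟫

lemma WW_line_hasDerivAt {y w : E2} {t : ℝ} (h : ‖y + t • w‖ < 1) :
    HasDerivAt (fun t : ℝ => WW (y + t • w)) (-(⟪y + t • w, w⟫ / WW (y + t • w))) t := by
  have h1 : HasDerivAt (fun t : ℝ => 1 - ‖y + t • w‖ ^ 2) (-(2 * ⟪y + t • w, w⟫)) t := by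
    have := ((line_hasDerivAt y w t).norm_sq).const_sub 1
    simpa using this
  have h2 := h1.sqrt (one_sub_pos h).ne'
  refine h2.congr_deriv ?_
  have := WW_pos h
  unfold WW at *
  field_simp

lemma WW_line_hasDerivAt2 {y w : E2} {t : ℝ} (h : ‖y + t • w‖ < 1) :
    HasDerivAt (fun t : ℝ => -(⟪y + t • w, w⟫ / WW (y + t • w))) (-HH (y + t • w) w) t := by
  have h1 := inner_line_hasDerivAt y w t
  have h2 := (h1.div (WW_line_hasDerivAt h) (WW_pos h).ne').neg
  refine h2.congr_deriv ?_
  have := WW_pos h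
  unfold HH
  field_simp
  ring

/-! ### From curvature bounds to the Zygmund condition -/

lemma circ_mid (θ h : ℝ) : circ (θ + h) + circ (θ - h) = (2 * Real.cos h) • circ θ := by
  ext i
  fin_cases i
  · simp [Real.cos_add, Real.cos_sub]; ring
  · simp [Real.sin_add, Real.sin_sub]; ring

lemma zygmund_of_convex_concave {φ u : E2 → ℝ} {C M : ℝ} (hC : 0 ≤ C)
    (hM : ∀ z ∈ sphere (0 : E2) 1, |φ z| ≤ M)
    (hconv : ∀ x ∈ ball (0 : E2) 1, ∀ y ∈ ball (0 : E2) 1, ∀ t ∈ Set.Icc (0 : ℝ) 1,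
      u (x + t • (y - x)) ≤ (1 - t) * u x + t * u y)
    (hconc : ∀ x ∈ ball (0 : E2) 1, ∀ y ∈ ball (0 : E2) 1, ∀ t ∈ Set.Icc (0 : ℝ) 1,
      (1 - t) * (u x + C * WW x) + t * (u y + C * WW y) ≤
        u (x + t • (y - x)) + C * WW (x + t • (y - x)))
    (hlim : ∀ z ∈ sphere (0 : E2) 1, Tendsto (fun t : ℝ => u (t • z)) (𝓝[<] 1) (𝓝 (φ z))) :
    ZygmundClass φ := by
  have hM0 : 0 ≤ M := (abs_nonneg _).trans (hM _ (circ_mem 0))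
  refine ⟨2 * (C + |u 0| + M) + 4 * M, fun θ h => ?_⟩
  have b1 := abs_le.mp (hM _ (circ_mem (θ + h)))
  have b2 := abs_le.mp (hM _ (circ_mem (θ - h)))
  have b3 := abs_le.mp (hM _ (circ_mem θ))
  by_cases hh : 1 ≤ |h|
  · have h1 : |φ (circ (θ + h)) + φ (circ (θ - h)) - 2 * φ (circ θ)| ≤ 4 * M := by
      rw [abs_le]; constructor <;> linarith
    refine h1.trans ?_
    have : 0 ≤ |u 0| := abs_nonneg _
    nlinarith
  push Not at hh
  set a := Real.cos h with ha
  have hacos : 1 - h ^ 2 / 2 ≤ a := Real.one_sub_sq_div_two_le_cos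
  have hh2 : h ^ 2 ≤ |h| := by rw [← sq_abs]; nlinarith [abs_nonneg h]
  have ha0 : 0 ≤ a := by linarith
  have ha1 : a ≤ 1 := Real.cos_le_one h
  have key : ∀ t ∈ Set.Ioo (0 : ℝ) 1,
      |(u (t • circ (θ + h)) + u (t • circ (θ - h))) / 2 - u (t • circ θ)| ≤
        (1 - a) * |u 0 - u (t • circ θ)| + C * Real.sqrt (1 - a ^ 2 * t ^ 2) := by
    intro t ht
    have hn : ∀ α, ‖t • circ α‖ = t := by
      intro α; rw [norm_smul, norm_circ, mul_one, Real.norm_of_nonneg ht.1.le]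
    have hb : ∀ α, t • circ α ∈ ball (0 : E2) 1 := by
      intro α; rw [mem_ball_zero_iff, hn]; exact ht.2
    have h0 : (0 : E2) ∈ ball (0 : E2) 1 := by simp
    have hW : ∀ α, WW (t • circ α) = Real.sqrt (1 - t ^ 2) := by
      intro α; rw [WW, hn]
    have e1 : t • circ (θ + h) + (1 / 2 : ℝ) • (t • circ (θ - h) - t • circ (θ + h)) =
        (a * t) • circ θ := by
      have : t • circ (θ + h) + (1 / 2 : ℝ) • (t • circ (θ - h) - t • circ (θ + h)) =
        (t / 2) • (circ (θ + h) + circ (θ - h)) := by module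
      rw [this, circ_mid, smul_smul]; congr 1; ring
    have e2 : (0 : E2) + a • (t • circ θ - 0) = (a * t) • circ θ := by
      rw [zero_add, sub_zero, smul_smul]
    have hWm : WW ((a * t) • circ θ) = Real.sqrt (1 - a ^ 2 * t ^ 2) := by
      rw [WW, norm_smul, norm_circ, mul_one, Real.norm_eq_abs, sq_abs, mul_pow]
    have p1 := hconv _ (hb (θ + h)) _ (hb (θ - h)) (1 / 2) (by norm_num)
    have p2 := hconc _ (hb (θ + h)) _ (hb (θ - h)) (1 / 2) (by norm_num)
    have p3 := hconv _ h0 _ (hb θ) a ⟨ha0, ha1⟩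
    have p4 := hconc _ h0 _ (hb θ) a ⟨ha0, ha1⟩
    rw [e1] at p1 p2
    rw [e2] at p3 p4
    rw [hWm] at p2 p4
    rw [hW, hW] at p2
    rw [hW] at p4
    have hs : 0 ≤ C * Real.sqrt (1 - t ^ 2) := mul_nonneg hC (Real.sqrt_nonneg _)
    have hs0 : 0 ≤ C * WW 0 := mul_nonneg hC (Real.sqrt_nonneg _)
    have q1 : (1 - a) * (u 0 - u (t • circ θ)) ≤ (1 - a) * |u 0 - u (t • circ θ)| :=
      mul_le_mul_of_nonneg_left (le_abs_self _) (by linarith)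
    have q2 : -((1 - a) * |u 0 - u (t • circ θ)|) ≤ (1 - a) * (u 0 - u (t • circ θ)) := by
      have := mul_le_mul_of_nonneg_left (neg_abs_le (u 0 - u (t • circ θ)))
        (show 0 ≤ 1 - a by linarith)
      linarith
    have q3 : 0 ≤ a * (C * Real.sqrt (1 - t ^ 2)) := mul_nonneg ha0 hs
    have q4 : 0 ≤ (1 - a) * (C * WW 0) := mul_nonneg (by linarith) hs0
    rw [abs_le]
    constructor <;> linarith
  have ev : ∀ᶠ t in 𝓝[<] (1 : ℝ), t ∈ Set.Ioo (0 : ℝ) 1 := Ioo_mem_nhdsLT (by norm_num)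
  have l1 : Tendsto (fun t : ℝ =>
      |(u (t • circ (θ + h)) + u (t • circ (θ - h))) / 2 - u (t • circ θ)|) (𝓝[<] 1)
      (𝓝 |(φ (circ (θ + h)) + φ (circ (θ - h))) / 2 - φ (circ θ)|) :=
    (((((hlim _ (circ_mem (θ + h))).add (hlim _ (circ_mem (θ - h)))).div_const 2).sub
      (hlim _ (circ_mem θ)))).abs
  have l2 : Tendsto (fun t : ℝ =>
      (1 - a) * |u 0 - u (t • circ θ)| + C * Real.sqrt (1 - a ^ 2 * t ^ 2)) (𝓝[<] 1)
      (𝓝 ((1 - a) * |u 0 - φ (circ θ)| + C * Real.sqrt (1 - a ^ 2 * 1 ^ 2))) := by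
    refine ((tendsto_const_nhds.sub (hlim _ (circ_mem θ))).abs.const_mul _).add ?_
    have : Continuous fun t : ℝ => C * Real.sqrt (1 - a ^ 2 * t ^ 2) := by fun_prop
    exact (this.tendsto 1).mono_left nhdsWithin_le_nhds
  have l3 := le_of_tendsto_of_tendsto l1 l2 (ev.mono key)
  have s1 : Real.sqrt (1 - a ^ 2 * 1 ^ 2) ≤ |h| := by
    have : 1 - a ^ 2 * 1 ^ 2 = Real.sin h ^ 2 := by rw [ha]; nlinarith [Real.sin_sq_add_cos_sq h]
    rw [this, Real.sqrt_sq_eq_abs]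
    exact Real.abs_sin_le_abs
  have s2 : |u 0 - φ (circ θ)| ≤ |u 0| + M := by
    refine (abs_sub _ _).trans ?_
    linarith [hM _ (circ_mem θ)]
  have s3 : (1 - a) * |u 0 - φ (circ θ)| ≤ |h| * (|u 0| + M) := by
    apply mul_le_mul _ s2 (abs_nonneg _) (abs_nonneg _)
    linarith [abs_nonneg h]
  have s4 : C * Real.sqrt (1 - a ^ 2 * 1 ^ 2) ≤ C * |h| := mul_le_mul_of_nonneg_left s1 hC
  have s5 : |φ (circ (θ + h)) + φ (circ (θ - h)) - 2 * φ (circ θ)| =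
      2 * |(φ (circ (θ + h)) + φ (circ (θ - h))) / 2 - φ (circ θ)| := by
    rw [← abs_two, ← abs_mul, abs_two]; congr 1; ring
  rw [s5]
  have s6 : 0 ≤ M * |h| := mul_nonneg hM0 (abs_nonneg _)
  have s7 : |(φ (circ (θ + h)) + φ (circ (θ - h))) / 2 - φ (circ θ)| ≤
      |h| * (|u 0| + M) + C * |h| := l3.trans (add_le_add s3 s4)
  linarith

lemma sphere_bdd {φ : E2 → ℝ} (hφc : ContinuousOn φ (sphere (0 : E2) 1)) :
    ∃ M, ∀ z ∈ sphere (0 : E2) 1, |φ z| ≤ M := by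
  obtain ⟨M, hM⟩ := (isCompact_sphere (0 : E2) 1).exists_bound_of_continuousOn hφc
  exact ⟨M, fun z hz => by simpa using hM z hz⟩

theorem zygmund_of_graph (φ : E2 → ℝ) (hφc : ContinuousOn φ (sphere (0 : E2) 1))
    (f : E2 → ℝ) (d : ℝ) (hd : 0 < d) (hf : ContDiff ℝ (⊤ : ℕ∞) f)
    (hgrad : ∀ p : E2, ‖gradient f p‖ < 1)
    (hcurv : ∀ p v : E2, hess f p v v ≥ d * Real.sqrt (1 - ‖gradient f p‖ ^ 2) *
            (‖v‖ ^ 2 - ⟪gradient f p, v⟫ ^ 2))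
    (hlim : ∀ z ∈ sphere (0 : E2) 1,
        Tendsto (fun r : ℝ => r - f (r • z)) atTop (𝓝 (φ z))) : ZygmundClass φ := by
  obtain ⟨M, hM⟩ := sphere_bdd hφc
  have hM0 : 0 ≤ M := (abs_nonneg _).trans (hM _ (circ_mem 0))
  have hfd : Differentiable ℝ f := hf.differentiable (by simp)
  have hlip : ∀ p q, f q ≤ f p + ‖q - p‖ := by
    intro p q
    have := (convex_univ).norm_image_sub_le_of_norm_fderiv_le (𝕜 := ℝ) (f := f) (C := 1)
      (x := p) (y := q)
      (fun x _ => hfd x) (fun x _ => by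
        rw [← toDual_gradient, LinearIsometryEquiv.norm_map]; exact (hgrad x).le)
      (Set.mem_univ _) (Set.mem_univ _)
    rw [one_mul, Real.norm_eq_abs] at this
    linarith [le_abs_self (f q - f p)]
  have hray : ∀ z ∈ sphere (0 : E2) 1, ∀ r : ℝ, r - φ z ≤ f (r • z) := by
    intro z hz r
    have : r - f (r • z) ≤ φ z := by
      refine ge_of_tendsto (hlim z hz) ?_
      filter_upwards [eventually_ge_atTop r] with s hs
      have := hlip (r • z) (s • z)
      rw [← sub_smul, norm_smul, mem_sphere_zero_iff_norm.mp hz, mul_one,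
        Real.norm_of_nonneg (by linarith)] at this
      linarith
    linarith
  have hdir : ∀ p : E2, p ≠ 0 → ‖p‖ - φ (‖p‖⁻¹ • p) ≤ f p := by
    intro p hp
    have hz : ‖p‖⁻¹ • p ∈ sphere (0 : E2) 1 := by
      rw [mem_sphere_zero_iff_norm, norm_smul, norm_inv, norm_norm,
        inv_mul_cancel₀ (norm_ne_zero_iff.mpr hp)]
    have := hray _ hz ‖p‖
    rwa [smul_inv_smul₀ (norm_ne_zero_iff.mpr hp)] at this
  have hlow : ∀ p : E2, ‖p‖ - M ≤ f p := by
    intro p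
    by_cases hp : p = 0
    · subst hp
      have h1 := hray _ (circ_mem 0) 0
      rw [zero_smul] at h1
      have := abs_le.mp (hM _ (circ_mem 0))
      simp only [norm_zero]; linarith
    · have h1 := hdir p hp
      have hz : ‖p‖⁻¹ • p ∈ sphere (0 : E2) 1 := by
        rw [mem_sphere_zero_iff_norm, norm_smul, norm_inv, norm_norm,
          inv_mul_cancel₀ (norm_ne_zero_iff.mpr hp)]
      have := abs_le.mp (hM _ hz)
      linarith
  have hex : ∀ y ∈ ball (0 : E2) 1, ∃ p, gradient f p = y ∧
      ∀ q, ⟪y, q⟫ - f q ≤ ⟪y, p⟫ - f p := by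
    intro y hy
    rw [mem_ball_zero_iff] at hy
    have hcont : Continuous fun q => f q - ⟪y, q⟫ := hf.continuous.sub (by fun_prop)
    have htend : Tendsto (fun q : E2 => f q - ⟪y, q⟫) (cocompact E2) atTop := by
      have h1 : Tendsto (fun q : E2 => (1 - ‖y‖) * ‖q‖ + (-M)) (cocompact E2) atTop :=
        tendsto_atTop_add_const_right _ _
          ((tendsto_norm_cocompact_atTop (E := E2)).const_mul_atTop (by linarith))
      refine tendsto_atTop_mono (fun q => ?_) h1
      have := real_inner_le_norm y q
      have := hlow q
      linarith
    obtain ⟨p, hp⟩ := hcont.exists_forall_le htend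
    refine ⟨p, ?_, fun q => by linarith [hp q]⟩
    have hmin : IsLocalMin (fun q => f q - ⟪y, q⟫) p := Eventually.of_forall hp
    have hd1 : HasFDerivAt (fun q => f q - ⟪y, q⟫) (fderiv ℝ f p - innerSL ℝ y) p :=
      (hfd p).hasFDerivAt.sub (innerSL ℝ y).hasFDerivAt
    have h0 := hmin.hasFDerivAt_eq_zero hd1
    apply ext_inner_right ℝ
    intro v
    rw [gradient_inner]
    have := congrArg (fun L : E2 →L[ℝ] ℝ => L v) h0
    simpa [sub_eq_zero] using this
  choose! G hG1 hG2 using hex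
  have hpos : ∀ x ∈ (Set.univ : Set E2), ∀ w : E2, w ≠ 0 → 0 < hess f x w w := by
    intro x _ w hw
    refine lt_of_lt_of_le ?_ (hcurv x w)
    have h1 := hgrad x
    have h2 : 0 < Real.sqrt (1 - ‖gradient f x‖ ^ 2) := WW_pos h1
    have h3 := abs_real_inner_le_norm (gradient f x) w
    have h4 : ⟪gradient f x, w⟫ ^ 2 ≤ (‖gradient f x‖ * ‖w‖) ^ 2 := sq_le_sq' (by linarith [abs_le.mp h3]) (abs_le.mp h3).2
    have h5 := one_sub_pos h1
    have h6 := norm_pos_iff.mpr hw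
    have h7 : 0 < ‖w‖ ^ 2 - ⟪gradient f x, w⟫ ^ 2 := by
      have : 0 < (1 - ‖gradient f x‖ ^ 2) * ‖w‖ ^ 2 := by positivity
      nlinarith
    positivity
  obtain ⟨L1, L2, L3⟩ := legendre isOpen_univ convex_univ hf.contDiffOn hpos
    (isOpen_ball (x := (0 : E2)) (ε := 1)) (G := G) (fun y _ => Set.mem_univ _) hG1
  set u : E2 → ℝ := fun y => ⟪y, G y⟫ - f (G y) with hu
  have hC : 0 ≤ d⁻¹ := by positivity
  have hseg : ∀ x ∈ ball (0 : E2) 1, ∀ y ∈ ball (0 : E2) 1, ∀ t ∈ Set.Icc (0 : ℝ) 1,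
      x + t • (y - x) ∈ ball (0 : E2) 1 := fun x hx y hy t ht =>
    (convex_ball (0 : E2) 1).add_smul_sub_mem hx hy ht
  refine zygmund_of_convex_concave (u := u) hC hM ?_ ?_ ?_
  · intro x hx y hy t ht
    have h1 := hG2 x hx (G (x + t • (y - x)))
    have h2 := hG2 y hy (G (x + t • (y - x)))
    have h3 := mul_le_mul_of_nonneg_left h1 (show 0 ≤ 1 - t by linarith [ht.2])
    have h4 := mul_le_mul_of_nonneg_left h2 ht.1
    simp only [hu]
    rw [inner_add_left, real_inner_smul_left, inner_sub_left]
    linarith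
  · intro x hx y hy t ht
    set w := y - x with hw
    have hd1 : ∀ s ∈ Set.Icc (0 : ℝ) 1, HasDerivAt
        (fun s : ℝ => u (x + s • w) + d⁻¹ * WW (x + s • w))
        (⟪G (x + s • w), w⟫ + d⁻¹ * (-(⟪x + s • w, w⟫ / WW (x + s • w)))) s := by
      intro s hs
      have hb := hseg x hx y hy s hs
      have h1 := (L2 _ hb).comp_hasDerivAt s (line_hasDerivAt x w s)
      have h2 := (WW_line_hasDerivAt (mem_ball_zero_iff.mp hb)).const_mul d⁻¹
      exact h1.add h2
    have hd2 : ∀ s ∈ Set.Icc (0 : ℝ) 1, HasDerivAt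
        (fun s : ℝ => ⟪G (x + s • w), w⟫ + d⁻¹ * (-(⟪x + s • w, w⟫ / WW (x + s • w))))
        (⟪fderiv ℝ G (x + s • w) w, w⟫ + d⁻¹ * (-HH (x + s • w) w)) s := by
      intro s hs
      have hb := hseg x hx y hy s hs
      have h0 := ((L1 _ hb).differentiableAt (by simp)).hasFDerivAt
      have h1 := h0.comp_hasDerivAt s (line_hasDerivAt x w s)
      have h2 := (WW_line_hasDerivAt2 (mem_ball_zero_iff.mp hb)).const_mul d⁻¹
      have h3 := h1.inner ℝ (hasDerivAt_const s w)
      simp only [inner_zero_right, zero_add] at h3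
      exact h3.add h2
    have hneg : ∀ s ∈ Set.Icc (0 : ℝ) 1,
        ⟪fderiv ℝ G (x + s • w) w, w⟫ + d⁻¹ * (-HH (x + s • w) w) ≤ 0 := by
      intro s hs
      have hb := hseg x hx y hy s hs
      have hb' := mem_ball_zero_iff.mp hb
      set y' := x + s • w with hy'
      set v := fderiv ℝ G y' w with hv
      have h1 := L3 y' hb w v
      rw [← hv, real_inner_comm] at h1
      have h2 := hcurv (G y') v
      rw [hG1 y' hb, h1] at h2
      have h3 := pair_cs' hb' w v
      have h4 := HH_nonneg hb' w
      change ⟪v, w⟫ ≥ d * WW y' * _ at h2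
      by_contra hcon
      push Not at hcon
      have h5 : HH y' w < d * ⟪v, w⟫ := by
        have : d⁻¹ * HH y' w < ⟪v, w⟫ := by linarith
        rwa [inv_mul_lt_iff₀ hd] at this
      have h6 : 0 < ⟪v, w⟫ := by
        by_contra h; push Not at h
        nlinarith
      have h7 : d * ⟪v, w⟫ ^ 2 ≤ ⟪v, w⟫ * HH y' w := by
        calc d * ⟪v, w⟫ ^ 2 ≤ d * ((WW y' * (‖v‖ ^ 2 - ⟪y', v⟫ ^ 2)) * HH y' w) :=
              mul_le_mul_of_nonneg_left h3 hd.le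
          _ = (d * WW y' * (‖v‖ ^ 2 - ⟪y', v⟫ ^ 2)) * HH y' w := by ring
          _ ≤ _ := mul_le_mul_of_nonneg_right h2 h4
      nlinarith
    have hcv : ConcaveOn ℝ (Set.Icc (0 : ℝ) 1)
        (fun s : ℝ => u (x + s • w) + d⁻¹ * WW (x + s • w)) := by
      refine concaveOn_of_hasDerivWithinAt2_nonpos (convex_Icc 0 1)
        (fun s hs => (hd1 s hs).continuousAt.continuousWithinAt)
        (fun s hs => (hd1 s (interior_subset hs)).hasDerivWithinAt)
        (fun s hs => (hd2 s (interior_subset hs)).hasDerivWithinAt)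
        (fun s hs => hneg s (interior_subset hs))
    have := hcv.2 (show (0 : ℝ) ∈ Set.Icc (0 : ℝ) 1 by simp)
      (show (1 : ℝ) ∈ Set.Icc (0 : ℝ) 1 by simp)
      (show 0 ≤ 1 - t by linarith [ht.2]) ht.1 (by ring)
    simpa [hw] using this
  · intro z hz
    have hz1 := mem_sphere_zero_iff_norm.mp hz
    have hsup : ∀ p : E2, ⟪z, p⟫ - f p ≤ φ z := by
      intro p
      have hmono : ∀ s : ℝ, 0 ≤ s → ⟪z, p⟫ - f p ≤ ⟪z, p⟫ + s - f (p + s • z) := by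
        intro s hs
        have := hlip p (p + s • z)
        rw [add_sub_cancel_left, norm_smul, hz1, mul_one, Real.norm_of_nonneg hs] at this
        linarith
      -- direction of `p + s z` tends to `z`
      have hdirlim : Tendsto (fun s : ℝ => ‖s⁻¹ • p + z‖⁻¹ • (s⁻¹ • p + z)) atTop (𝓝 z) := by
        have h1 : Tendsto (fun s : ℝ => s⁻¹ • p + z) atTop (𝓝 z) := by
          have := (tendsto_inv_atTop_zero (𝕜 := ℝ)).smul_const p
          simpa using this.add_const z
        have h2 := (h1.norm.inv₀ (by rw [hz1]; norm_num)).smul h1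
        simpa [hz1] using h2
      have hne : ∀ᶠ s : ℝ in atTop, p + s • z ≠ 0 := by
        filter_upwards [eventually_gt_atTop (‖p‖)] with s hs hcon
        have h1 : ‖p‖ = ‖s • z‖ := by
          rw [← norm_neg (s • z)]; congr 1; exact eq_neg_of_add_eq_zero_left hcon
        rw [norm_smul, hz1, mul_one, Real.norm_of_nonneg ((norm_nonneg p).trans hs.le)] at h1
        linarith
      have heq : ∀ᶠ s : ℝ in atTop, ‖s⁻¹ • p + z‖⁻¹ • (s⁻¹ • p + z) =
          ‖p + s • z‖⁻¹ • (p + s • z) := by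
        filter_upwards [eventually_gt_atTop 0] with s hs
        have h1 : p + s • z = s • (s⁻¹ • p + z) := by
          rw [smul_add, smul_inv_smul₀ hs.ne']
        rw [h1, norm_smul, Real.norm_of_nonneg hs.le, smul_smul, mul_inv]
        congr 1
        field_simp
      have hmem : ∀ᶠ s : ℝ in atTop, ‖p + s • z‖⁻¹ • (p + s • z) ∈ sphere (0 : E2) 1 := by
        filter_upwards [hne] with s hs
        rw [mem_sphere_zero_iff_norm, norm_smul, norm_inv, norm_norm,
          inv_mul_cancel₀ (norm_ne_zero_iff.mpr hs)]
      have hlimφ : Tendsto (fun s : ℝ => φ (‖p + s • z‖⁻¹ • (p + s • z))) atTop (𝓝 (φ z)) := by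
        refine (hφc z hz).tendsto.comp ?_
        exact tendsto_nhdsWithin_iff.mpr ⟨hdirlim.congr' heq, hmem⟩
      refine ge_of_tendsto hlimφ ?_
      filter_upwards [hne, eventually_ge_atTop 0] with s hs hs0
      have h1 := hmono s hs0
      have h2 := hdir _ hs
      have h3 := real_inner_le_norm z (p + s • z)
      rw [hz1, one_mul, inner_add_right, real_inner_smul_right, real_inner_self_eq_norm_sq,
        hz1] at h3
      linarith
    have hup : ∀ t ∈ Set.Ioo (0 : ℝ) 1, u (t • z) ≤ t * φ z + (1 - t) * M := by
      intro t ht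
      have h1 := hsup (G (t • z))
      have h2 := hlow (G (t • z))
      have h3 := mul_le_mul_of_nonneg_left h1 ht.1.le
      have h4 : (1 - t) * (-f (G (t • z))) ≤ (1 - t) * M := by
        apply mul_le_mul_of_nonneg_left _ (by linarith [ht.2])
        linarith [norm_nonneg (G (t • z))]
      simp only [hu]
      rw [real_inner_smul_left]
      linarith
    have hdn : ∀ t ∈ Set.Ioo (0 : ℝ) 1, ∀ r : ℝ, (r - f (r • z)) - r * (1 - t) ≤ u (t • z) := by
      intro t ht r
      have hb : t • z ∈ ball (0 : E2) 1 := by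
        rw [mem_ball_zero_iff, norm_smul, hz1, mul_one, Real.norm_of_nonneg ht.1.le]; exact ht.2
      have := hG2 _ hb (r • z)
      rw [real_inner_smul_left, real_inner_smul_right, real_inner_self_eq_norm_sq, hz1] at this
      simp only [hu]
      linarith
    have ev : ∀ᶠ t in 𝓝[<] (1 : ℝ), t ∈ Set.Ioo (0 : ℝ) 1 := Ioo_mem_nhdsLT (by norm_num)
    rw [tendsto_order]
    constructor
    · intro a ha
      obtain ⟨r, hr⟩ := ((tendsto_order.mp (hlim z hz)).1 a ha).exists
      have hl : Tendsto (fun t : ℝ => (r - f (r • z)) - r * (1 - t)) (𝓝[<] 1)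
          (𝓝 ((r - f (r • z)) - r * (1 - 1))) := by
        have : Continuous fun t : ℝ => (r - f (r • z)) - r * (1 - t) := by fun_prop
        exact (this.tendsto 1).mono_left nhdsWithin_le_nhds
      have := (tendsto_order.mp hl).1 a (by simpa using hr)
      filter_upwards [this, ev] with t h1 h2
      exact h1.trans_le (hdn t h2 r)
    · intro a ha
      have hl : Tendsto (fun t : ℝ => t * φ z + (1 - t) * M) (𝓝[<] 1)
          (𝓝 (1 * φ z + (1 - 1) * M)) := by
        have : Continuous fun t : ℝ => t * φ z + (1 - t) * M := by fun_prop
        exact (this.tendsto 1).mono_left nhdsWithin_le_nhds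
      have := (tendsto_order.mp hl).2 a (by simpa using ha)
      filter_upwards [this, ev] with t h1 h2
      exact (hup t h2).trans_lt h1

/-! ### Approximation of Zygmund functions by affine functions -/

lemma zyg_line {k : ℝ → ℝ} (hk : Continuous k) {C h : ℝ} (hC : 0 ≤ C) (hh : 0 < h)
    (hz : ∀ t s, |k (t + s) + k (t - s) - 2 * k t| ≤ C * |s|)
    (h0 : k 0 = 0) (hs : k h = k (-h)) (t : ℝ) : |k t| ≤ 3 * C * (h + t ^ 2 / h) := by
  have hkh : |k h| ≤ C * h / 2 := by
    have := hz 0 h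
    rw [zero_add, zero_sub, ← hs, h0, abs_of_pos hh] at this
    have h2 : k h + k h - 2 * 0 = 2 * k h := by ring
    rw [h2, abs_mul, abs_two] at this
    linarith
  -- bound on `[-h, h]`
  have hbase : ∀ t ∈ Set.Icc (-h) h, |k t| ≤ C * h := by
    obtain ⟨x, hx, hmax⟩ := (isCompact_Icc (a := -h) (b := h)).exists_isMaxOn
      ⟨0, by constructor <;> linarith⟩ (hk.abs.continuousOn)
    have hmax' : ∀ t ∈ Set.Icc (-h) h, |k t| ≤ |k x| := fun t ht => hmax ht
    suffices hx' : |k x| ≤ C * h from fun t ht => (hmax' t ht).trans hx'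
    have gen : ∀ a b, |k (x + a) + k (x - a) - 2 * k x| ≤ b →
        2 * |k x| ≤ |k (x + a)| + |k (x - a)| + b := by
      intro a b hb
      have h1 := abs_le.mp hb
      have := neg_abs_le (k (x + a))
      have := neg_abs_le (k (x - a))
      have := le_abs_self (k (x + a))
      have := le_abs_self (k (x - a))
      rcases abs_cases (k x) with hc | hc <;> linarith
    rcases le_total x (-(h / 2)) with h1 | h1
    · have := gen _ _ (hz x (x + h))
      rw [show x - (x + h) = -h by ring, ← hs, abs_of_nonneg (by linarith [hx.1] : 0 ≤ x + h)] at this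
      have h3 := hmax' (x + (x + h)) (by constructor <;> linarith [hx.1])
      have : C * (x + h) ≤ C * (h / 2) := mul_le_mul_of_nonneg_left (by linarith) hC
      linarith
    rcases le_total x (h / 2) with h2 | h2
    · have := gen _ _ (hz x x)
      rw [sub_self, h0, abs_zero] at this
      have h3 := hmax' (x + x) (by constructor <;> linarith)
      have : C * |x| ≤ C * (h / 2) := mul_le_mul_of_nonneg_left (abs_le.mpr ⟨h1, h2⟩) hC
      nlinarith
    · have := gen _ _ (hz x (h - x))
      rw [show x + (h - x) = h by ring, abs_of_nonneg (by linarith [hx.2] : 0 ≤ h - x)] at this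
      have h3 := hmax' (x - (h - x)) (by constructor <;> linarith [hx.2])
      have : C * (h - x) ≤ C * (h / 2) := mul_le_mul_of_nonneg_left (by linarith) hC
      linarith
  have hdouble : ∀ t, |k (2 * t)| ≤ 2 * |k t| + C * |t| := by
    intro t
    have h1 := hz t t
    rw [sub_self, h0, ← two_mul] at h1
    have h1 := abs_le.mp h1
    have := neg_abs_le (k t)
    have := le_abs_self (k t)
    rw [abs_le]; constructor <;> linarith
  have hind : ∀ n : ℕ, ∀ t, |t| ≤ 2 ^ n * h → |k t| ≤ 3 * C * (h + t ^ 2 / h) := by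
    have hsmall : ∀ t, |t| ≤ 2 * h → |k t| ≤ 3 * C * (h + t ^ 2 / h) := by
      intro t ht
      have h1 := hdouble (t / 2)
      rw [mul_div_cancel₀ t two_ne_zero] at h1
      have h2 : |t / 2| ≤ h := by rw [abs_div, abs_two]; linarith
      have h3 := hbase (t / 2) (abs_le.mp h2)
      have h4 : C * |t / 2| ≤ C * h := mul_le_mul_of_nonneg_left h2 hC
      have h5 : 0 ≤ 3 * C * (t ^ 2 / h) := by positivity
      linarith
    intro n
    induction n with
    | zero => intro t ht; apply hsmall; rw [pow_zero, one_mul] at ht; linarith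
    | succ n ih =>
      intro t ht
      by_cases hc : |t| ≤ 2 * h
      · exact hsmall t hc
      push Not at hc
      have h2 : |t / 2| = |t| / 2 := by rw [abs_div, abs_two]
      have h1 := hdouble (t / 2)
      rw [mul_div_cancel₀ t two_ne_zero, h2] at h1
      have h3 := ih (t / 2) (by rw [h2]; rw [pow_succ] at ht; linarith)
      have hx : h ≤ t ^ 2 / h / 4 := by
        rw [← sq_abs, div_div, le_div_iff₀ (by positivity)]; nlinarith
      have hx2 : |t| / 2 ≤ t ^ 2 / h / 4 := by
        rw [← sq_abs, div_div, le_div_iff₀ (by positivity)]; nlinarith [abs_nonneg t]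
      have e : (t / 2) ^ 2 / h = t ^ 2 / h / 4 := by ring
      rw [e] at h3
      have h4 : C * (|t| / 2) ≤ C * (t ^ 2 / h / 4) := mul_le_mul_of_nonneg_left hx2 hC
      have h5 : C * h ≤ C * (t ^ 2 / h / 4) := mul_le_mul_of_nonneg_left hx hC
      nlinarith
  obtain ⟨n, hn⟩ := pow_unbounded_of_one_lt (|t| / h) (one_lt_two)
  exact hind n t (by rw [div_lt_iff₀ hh] at hn; exact hn.le)

lemma abs_sub_sin_le (t : ℝ) : |t - Real.sin t| ≤ 2 * t ^ 2 := by
  have key : ∀ x : ℝ, 0 ≤ x → |x - Real.sin x| ≤ 2 * x ^ 2 := by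
    intro x hx
    rcases hx.eq_or_lt with rfl | hx
    · simp
    have h1 := Real.sin_lt hx
    rw [abs_of_pos (by linarith)]
    rcases le_total x 1 with h | h
    · have := Real.sin_gt_sub_cube hx
      nlinarith [mul_nonneg (sq_nonneg x) (by linarith : 0 ≤ 1 - x)]
    · nlinarith [Real.neg_one_le_sin x]
  rcases le_total 0 t with h | h
  · exact key t h
  · have := key (-t) (by linarith)
    rw [Real.sin_neg, neg_sq, ← abs_neg] at this
    convert this using 2
    ring

lemma circ_add_int (θ : ℝ) (n : ℤ) : circ (θ + n * (2 * Real.pi)) = circ θ := by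
  rw [circ_eq, circ_eq, Real.cos_add_int_mul_two_pi, Real.sin_add_int_mul_two_pi]

lemma zyg_approx {φ : E2 → ℝ} (hφc : ContinuousOn φ (sphere (0 : E2) 1)) (hZ : ZygmundClass φ) :
    ∃ C, 0 ≤ C ∧ ∀ θ₀ ρ : ℝ, 0 ≤ ρ → ρ < 1 → ∃ c : ℝ, ∀ t : ℝ,
      |φ (circ (θ₀ + t)) - φ (circ θ₀) - c * Real.sin t| ≤
        C * ((1 - ρ * Real.cos t) / Real.sqrt (1 - ρ ^ 2)) := by
  obtain ⟨M, hM⟩ := sphere_bdd hφc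
  have hM0 : 0 ≤ M := (abs_nonneg _).trans (hM _ (circ_mem 0))
  obtain ⟨C, hC⟩ := hZ
  have hC0 : 0 ≤ C := by
    have := (abs_nonneg _).trans (hC 0 1); simpa using this
  refine ⟨(3 * C + 2 * M) * (2 + 2 * Real.pi ^ 2), by positivity, fun θ₀ ρ hρ0 hρ1 => ?_⟩
  set h := Real.sqrt (1 - ρ ^ 2) with hh
  have h1ρ : 0 < 1 - ρ ^ 2 := by nlinarith
  have hpos : 0 < h := Real.sqrt_pos.mpr h1ρ
  have hsq : h ^ 2 = 1 - ρ ^ 2 := Real.sq_sqrt h1ρ.le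
  set g : ℝ → ℝ := fun t => φ (circ (θ₀ + t)) with hg
  have hgc : Continuous g :=
    hφc.comp_continuous (continuous_circ.comp (continuous_const.add continuous_id))
      (fun t => circ_mem _)
  set s := (g h - g (-h)) / (2 * h) with hs
  have hsM : |s| ≤ M / h := by
    rw [hs, abs_div, abs_of_pos (by positivity : 0 < 2 * h), div_le_div_iff₀ (by positivity) hpos]
    have : |g h - g (-h)| ≤ 2 * M := by
      have := abs_le.mp (hM _ (circ_mem (θ₀ + h)))
      have := abs_le.mp (hM _ (circ_mem (θ₀ + -h)))
      rw [abs_le]; constructor <;> simp only [hg] <;> linarith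
    nlinarith
  have hk := zyg_line (k := fun t => g t - g 0 - s * t) (by fun_prop) hC0 hpos
    (by
      intro t r
      have := hC (θ₀ + t) r
      have e : (g (t + r) - g 0 - s * (t + r)) + (g (t - r) - g 0 - s * (t - r)) -
          2 * (g t - g 0 - s * t) = g (t + r) + g (t - r) - 2 * g t := by ring
      rw [e]
      simp only [hg]
      rw [← add_assoc, ← add_sub_assoc]
      exact this) (by simp) (by
      have : s * (2 * h) = g h - g (-h) := by rw [hs]; field_simp
      linarith)
  have main : ∀ t, |t| ≤ Real.pi → |φ (circ (θ₀ + t)) - φ (circ θ₀) - s * Real.sin t| ≤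
      (3 * C + 2 * M) * (2 + 2 * Real.pi ^ 2) * ((1 - ρ * Real.cos t) / h) := by
    intro t ht
    have k1 := hk t
    simp only [hg, add_zero] at k1
    have k2 : |s * (t - Real.sin t)| ≤ 2 * M * (t ^ 2 / h) := by
      rw [abs_mul]
      calc |s| * |t - Real.sin t| ≤ (M / h) * (2 * t ^ 2) :=
            mul_le_mul hsM (abs_sub_sin_le t) (abs_nonneg _) (by positivity)
        _ = _ := by ring
    have k3 : |φ (circ (θ₀ + t)) - φ (circ θ₀) - s * Real.sin t| ≤
        3 * C * (h + t ^ 2 / h) + 2 * M * (t ^ 2 / h) := by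
      have e : φ (circ (θ₀ + t)) - φ (circ θ₀) - s * Real.sin t =
        (φ (circ (θ₀ + t)) - φ (circ θ₀) - s * t) + s * (t - Real.sin t) := by ring
      rw [e]
      exact (abs_add_le _ _).trans (add_le_add k1 k2)
    have c1 := Real.cos_le_one t
    have c2 := Real.neg_one_le_cos t
    have hpi := Real.pi_pos
    have k4 : h ^ 2 ≤ 2 * (1 - ρ * Real.cos t) := by
      rw [hsq]; nlinarith
    have ht2 : t ^ 2 ≤ Real.pi ^ 2 := sq_le_sq' (abs_le.mp ht).1 (abs_le.mp ht).2
    have k5 : t ^ 2 ≤ 2 * Real.pi ^ 2 * (1 - ρ * Real.cos t) := by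
      rcases le_total (1 / 2) ρ with hr | hr
      · have q := Real.cos_le_one_sub_mul_cos_sq ht
        have q2 : t ^ 2 ≤ Real.pi ^ 2 / 2 * (1 - Real.cos t) := by
          have : 2 / Real.pi ^ 2 * t ^ 2 ≤ 1 - Real.cos t := by linarith
          calc t ^ 2 = Real.pi ^ 2 / 2 * (2 / Real.pi ^ 2 * t ^ 2) := by field_simp
            _ ≤ _ := mul_le_mul_of_nonneg_left this (by positivity)
        have q3 : 1 - Real.cos t ≤ 2 * (1 - ρ * Real.cos t) := by nlinarith
        have := mul_le_mul_of_nonneg_left q3 (show 0 ≤ Real.pi ^ 2 / 2 by positivity)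
        have : 0 ≤ Real.pi ^ 2 * (1 - ρ * Real.cos t) := by
          apply mul_nonneg (by positivity); nlinarith
        linarith
      · have q : 1 / 2 ≤ 1 - ρ * Real.cos t := by nlinarith
        have := mul_le_mul_of_nonneg_left q (show 0 ≤ 2 * Real.pi ^ 2 by positivity)
        linarith
    have k6 : h + t ^ 2 / h ≤ (2 + 2 * Real.pi ^ 2) * ((1 - ρ * Real.cos t) / h) := by
      rw [← mul_div_assoc, le_div_iff₀ hpos, add_mul, div_mul_cancel₀ _ hpos.ne']
      nlinarith
    have k7 := mul_le_mul_of_nonneg_left k6 (show 0 ≤ 3 * C + 2 * M by positivity)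
    have k8 : 0 ≤ M * h := by positivity
    linarith
  refine ⟨s, fun t => ?_⟩
  obtain ⟨n, hn, -⟩ := existsUnique_add_zsmul_mem_Ioc (show 0 < 2 * Real.pi by positivity) t (-Real.pi)
  simp only [zsmul_eq_mul] at hn
  have := main (t + n * (2 * Real.pi)) (abs_le.mpr ⟨hn.1.le, by linarith [hn.2]⟩)
  rwa [← add_assoc, circ_add_int, Real.sin_add_int_mul_two_pi, Real.cos_add_int_mul_two_pi] at this

/-! ### The extension kernel -/

/-- The integrals `∫ g(θ) / (1 - y·e^{iθ})^k dθ`. -/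
def JJ (k : ℕ) (g : ℝ → ℝ) (y : E2) : ℝ :=
  ∫ θ in (0 : ℝ)..(2 * Real.pi), g θ / (1 - ⟪y, circ θ⟫) ^ k

lemma ss_ge (y : E2) (θ : ℝ) : 1 - ‖y‖ ≤ 1 - ⟪y, circ θ⟫ := by
  have := real_inner_le_norm y (circ θ)
  rw [norm_circ, mul_one] at this
  linarith

lemma ss_pos {y : E2} (hy : ‖y‖ < 1) (θ : ℝ) : 0 < 1 - ⟪y, circ θ⟫ :=
  lt_of_lt_of_le (by linarith) (ss_ge y θ)

lemma continuous_ss (y : E2) : Continuous fun θ => 1 - ⟪y, circ θ⟫ :=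
  continuous_const.sub (continuous_const.inner continuous_circ)

lemma continuous_JJ_integrand (k : ℕ) {g : ℝ → ℝ} (hg : Continuous g) {y : E2} (hy : ‖y‖ < 1) :
    Continuous fun θ => g θ / (1 - ⟪y, circ θ⟫) ^ k :=
  hg.div ((continuous_ss y).pow k) fun θ => (pow_pos (ss_pos hy θ) k).ne'

lemma JJ_hasFDerivAt (k : ℕ) {g : ℝ → ℝ} (hg : Continuous g) {y : E2} (hy : ‖y‖ < 1) :
    HasFDerivAt (JJ k g) (∫ θ in (0 : ℝ)..(2 * Real.pi),
      (g θ * k / (1 - ⟪y, circ θ⟫) ^ (k + 1)) • innerSL ℝ (circ θ)) y := by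
  unfold JJ
  set r := (1 + ‖y‖) / 2 with hr
  have hr1 : r < 1 := by linarith
  have hyr : y ∈ ball (0 : E2) r := by rw [mem_ball_zero_iff]; linarith
  have hcirc : Continuous fun θ => innerSL ℝ (circ θ) :=
    (innerSL ℝ).continuous.comp continuous_circ
  have hc' : Continuous fun θ => (g θ * k / (1 - ⟪y, circ θ⟫) ^ (k + 1)) • innerSL ℝ (circ θ) :=
    (continuous_JJ_integrand (k + 1) (hg.mul continuous_const) hy).smul hcirc
  refine intervalIntegral.hasFDerivAt_integral_of_dominated_of_fderiv_le
    (s := ball (0 : E2) r) (bound := fun θ => |g θ| * k / (1 - r) ^ (k + 1))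
    (F' := fun x θ => (g θ * k / (1 - ⟪x, circ θ⟫) ^ (k + 1)) • innerSL ℝ (circ θ))
    (isOpen_ball.mem_nhds hyr) ?_ ?_ ?_ ?_ ?_ ?_
  · filter_upwards [isOpen_ball.mem_nhds hyr] with x hx
    have hx1 : ‖x‖ < 1 := (mem_ball_zero_iff.mp hx).trans hr1
    exact (continuous_JJ_integrand k hg hx1).aestronglyMeasurable
  · exact (continuous_JJ_integrand k hg hy).intervalIntegrable _ _
  · exact hc'.aestronglyMeasurable
  · refine Eventually.of_forall fun θ _ x hx => ?_
    have hx1 : ‖x‖ < r := mem_ball_zero_iff.mp hx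
    have h1 : 1 - r ≤ 1 - ⟪x, circ θ⟫ := le_trans (by linarith) (ss_ge x θ)
    have h2 : 0 < 1 - r := by linarith
    rw [norm_smul, innerSL_apply_norm, norm_circ, mul_one, Real.norm_eq_abs, abs_div, abs_mul,
      Nat.abs_cast, abs_of_pos (pow_pos (h2.trans_le h1) _)]
    gcongr
  · exact ((hg.abs.mul continuous_const).div_const _).intervalIntegrable _ _
  · refine Eventually.of_forall fun θ _ x hx => ?_
    have hx1 : ‖x‖ < 1 := (mem_ball_zero_iff.mp hx).trans hr1
    have hs := ss_pos hx1 θ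
    have h1 : HasFDerivAt (fun x : E2 => 1 - ⟪x, circ θ⟫) (-(innerSL ℝ (circ θ))) x := by
      have := ((innerSL ℝ (circ θ)).hasFDerivAt (x := x)).const_sub 1
      refine this.congr_of_eventuallyEq (Eventually.of_forall fun z => ?_)
      simp [real_inner_comm]
    have h2 : HasDerivAt (fun s : ℝ => g θ / s ^ k)
        (-(g θ * k / (1 - ⟪x, circ θ⟫) ^ (k + 1))) (1 - ⟪x, circ θ⟫) := by
      have h3 := ((hasDerivAt_pow k (1 - ⟪x, circ θ⟫)).inv (pow_pos hs k).ne').const_mul (g θ)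
      refine (h3.congr_deriv ?_).congr_of_eventuallyEq
        (Eventually.of_forall fun z => by simp [div_eq_mul_inv])
      rcases k with _ | k
      · simp
      · generalize 1 - ⟪x, circ θ⟫ = s at hs
        simp only [Nat.add_sub_cancel]
        have h5 : s ^ (k + 1 + 1) ≠ 0 := (pow_pos hs _).ne'
        have h6 : (s ^ (k + 1)) ^ 2 ≠ 0 := (pow_pos (pow_pos hs _) _).ne'
        rw [mul_div_assoc', ← neg_div, div_eq_div_iff h6 h5]
        ring
    have h4 := h2.comp_hasFDerivAt x h1
    refine h4.congr_fderiv ?_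
    rw [smul_neg, neg_smul, neg_neg]

lemma JJ_fderiv_apply (k : ℕ) {g : ℝ → ℝ} (hg : Continuous g) {y : E2} (hy : ‖y‖ < 1) (w : E2) :
    (∫ θ in (0 : ℝ)..(2 * Real.pi),
      (g θ * k / (1 - ⟪y, circ θ⟫) ^ (k + 1)) • innerSL ℝ (circ θ)) w =
      k * JJ (k + 1) (fun θ => g θ * ⟪circ θ, w⟫) y := by
  have hcirc : Continuous fun θ => innerSL ℝ (circ θ) :=
    (innerSL ℝ).continuous.comp continuous_circ
  have hc' : Continuous fun θ => (g θ * k / (1 - ⟪y, circ θ⟫) ^ (k + 1)) • innerSL ℝ (circ θ) :=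
    (continuous_JJ_integrand (k + 1) (hg.mul continuous_const) hy).smul hcirc
  rw [ContinuousLinearMap.intervalIntegral_apply (hc'.intervalIntegrable _ _), JJ,
    ← intervalIntegral.integral_const_mul]
  congr 1
  ext θ
  simp
  ring

lemma JJ_line (k : ℕ) {g : ℝ → ℝ} (hg : Continuous g) {y w : E2} {t : ℝ} (hy : ‖y + t • w‖ < 1) :
    HasDerivAt (fun t : ℝ => JJ k g (y + t • w))
      (k * JJ (k + 1) (fun θ => g θ * ⟪circ θ, w⟫) (y + t • w)) t := by
  rw [← JJ_fderiv_apply k hg hy]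
  exact (JJ_hasFDerivAt k hg hy).comp_hasDerivAt t (line_hasDerivAt y w t)

lemma JJ_contDiffOn_nat (n : ℕ) : ∀ (k : ℕ) (g : ℝ → ℝ), Continuous g →
    ContDiffOn ℝ n (JJ k g) (ball (0 : E2) 1) := by
  induction n with
  | zero =>
    intro k g hg
    rw [Nat.cast_zero, contDiffOn_zero]
    intro y hy
    exact (JJ_hasFDerivAt k hg (mem_ball_zero_iff.mp hy)).continuousAt.continuousWithinAt
  | succ n ih =>
    intro k g hg
    rw [Nat.cast_add, Nat.cast_one, contDiffOn_succ_iff_fderiv_of_isOpen isOpen_ball]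
    refine ⟨fun y hy => (JJ_hasFDerivAt k hg
      (mem_ball_zero_iff.mp hy)).differentiableAt.differentiableWithinAt, by simp, ?_⟩
    have key : ContDiffOn ℝ n (fun y =>
        ((k : ℝ) * JJ (k + 1) (fun θ => g θ * Real.cos θ) y) • innerSL ℝ (circ 0) +
        ((k : ℝ) * JJ (k + 1) (fun θ => g θ * Real.sin θ) y) • innerSL ℝ (circ (Real.pi / 2)))
        (ball (0 : E2) 1) :=
      ((contDiffOn_const.mul (ih _ _ (hg.mul Real.continuous_cos))).smul contDiffOn_const).add
        ((contDiffOn_const.mul (ih _ _ (hg.mul Real.continuous_sin))).smul contDiffOn_const)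
    refine key.congr fun y hy => ?_
    have hy' := mem_ball_zero_iff.mp hy
    rw [(JJ_hasFDerivAt k hg hy').fderiv]
    ext w
    rw [JJ_fderiv_apply k hg hy']
    have e : JJ (k + 1) (fun θ => g θ * ⟪circ θ, w⟫) y =
        JJ (k + 1) (fun θ => g θ * Real.cos θ) y * w 0 +
        JJ (k + 1) (fun θ => g θ * Real.sin θ) y * w 1 := by
      unfold JJ
      rw [← intervalIntegral.integral_mul_const, ← intervalIntegral.integral_mul_const,
        ← intervalIntegral.integral_add]
      · congr 1
        ext θ
        simp only [inner_coord (circ θ) w, circ_zero, circ_one]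
        ring
      · exact ((continuous_JJ_integrand (k + 1) (hg.mul Real.continuous_cos)
          hy').mul continuous_const).intervalIntegrable _ _
      · exact ((continuous_JJ_integrand (k + 1) (hg.mul Real.continuous_sin)
          hy').mul continuous_const).intervalIntegrable _ _
    rw [e]
    simp only [add_apply, smul_apply, innerSL_apply_apply, smul_eq_mul,
      inner_coord (circ _), circ_zero, circ_one, Real.cos_zero, Real.sin_zero,
      Real.cos_pi_div_two, Real.sin_pi_div_two]
    ring

lemma JJ_contDiffAt (k : ℕ) {g : ℝ → ℝ} (hg : Continuous g) {y : E2} (hy : ‖y‖ < 1) :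
    ContDiffAt ℝ (⊤ : ℕ∞) (JJ k g) y :=
  (contDiffOn_infty.mpr fun n => JJ_contDiffOn_nat n k g hg).contDiffAt
    (isOpen_ball.mem_nhds (mem_ball_zero_iff.mpr hy))

/-! #### Exact values on affine functions -/

lemma JJ_linear_eq {y : E2} (hy : ‖y‖ < 1) (c : E2) :
    JJ 2 (fun θ => ⟪circ θ, c⟫) y = ⟪y, c⟫ * JJ 2 (fun _ => 1) y := by
  have hd : ∀ θ ∈ Set.uIcc (0 : ℝ) (2 * Real.pi), HasDerivAt
      (fun θ : ℝ => (-(Real.sin θ) * c 0 + Real.cos θ * c 1) /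
        (1 - (y 0 * Real.cos θ + y 1 * Real.sin θ)))
      (⟪y, c⟫ * (1 / (1 - ⟪y, circ θ⟫) ^ 2) - ⟪circ θ, c⟫ / (1 - ⟪y, circ θ⟫) ^ 2) θ := by
    intro θ _
    have hs := ss_pos hy θ
    have hs' : 0 < 1 - (y 0 * Real.cos θ + y 1 * Real.sin θ) := by
      simpa [inner_coord] using hs
    have h1 := (((Real.hasDerivAt_sin θ).neg.mul_const (c 0)).add
      ((Real.hasDerivAt_cos θ).mul_const (c 1)))
    have h2 := (((Real.hasDerivAt_cos θ).const_mul (y 0)).add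
      ((Real.hasDerivAt_sin θ).const_mul (y 1))).const_sub 1
    refine (h1.div h2 hs'.ne').congr_deriv ?_
    simp only [inner_coord, circ_zero, circ_one, Pi.add_apply, Pi.neg_apply]
    have h3 := Real.sin_sq_add_cos_sq θ
    rw [mul_one_div, ← sub_div]
    congr 1
    linear_combination (y 0 * c 0 + y 1 * c 1) * h3
  have hi1 : IntervalIntegrable (fun θ => ⟪y, c⟫ * (1 / (1 - ⟪y, circ θ⟫) ^ 2))
      MeasureTheory.volume 0 (2 * Real.pi) :=
    (continuous_const.mul (continuous_JJ_integrand 2 continuous_const hy)).intervalIntegrable _ _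
  have hi2 : IntervalIntegrable (fun θ => ⟪circ θ, c⟫ / (1 - ⟪y, circ θ⟫) ^ 2)
      MeasureTheory.volume 0 (2 * Real.pi) :=
    (continuous_JJ_integrand 2 (continuous_circ.inner continuous_const) hy).intervalIntegrable _ _
  have h := intervalIntegral.integral_eq_sub_of_hasDerivAt hd (hi1.sub hi2)
  rw [intervalIntegral.integral_sub hi1 hi2, intervalIntegral.integral_const_mul] at h
  simp only [Real.sin_two_pi, Real.cos_two_pi, Real.sin_zero, Real.cos_zero, sub_self] at h
  unfold JJ
  linarith

lemma JJ_two_one {y : E2} (hy : ‖y‖ < 1) :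
    WW y ^ 2 * JJ 2 (fun _ => 1) y = JJ 1 (fun _ => 1) y := by
  have h1 : JJ 2 (fun _ => 1) y = JJ 1 (fun _ => 1) y + JJ 2 (fun θ => ⟪circ θ, y⟫) y := by
    unfold JJ
    rw [← intervalIntegral.integral_add]
    · congr 1
      ext θ
      have := ss_pos hy θ
      simp only [real_inner_comm y (circ θ)]
      rw [pow_one, div_add_div _ _ this.ne' (pow_pos this 2).ne',
        div_eq_div_iff (pow_pos this 2).ne' (mul_pos this (pow_pos this 2)).ne']
      ring
    · exact (continuous_JJ_integrand 1 continuous_const hy).intervalIntegrable _ _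
    · exact (continuous_JJ_integrand 2 (continuous_circ.inner continuous_const)
        hy).intervalIntegrable _ _
  rw [JJ_linear_eq hy, real_inner_self_eq_norm_sq] at h1
  rw [WW_sq hy]
  linarith

lemma JJ_one_one {y : E2} (hy : ‖y‖ < 1) : WW y * JJ 1 (fun _ => 1) y = 2 * Real.pi := by
  have hb : ∀ t ∈ Set.Icc (0 : ℝ) 1, ‖(0 : E2) + t • y‖ < 1 := by
    intro t ht
    rw [zero_add, norm_smul, Real.norm_of_nonneg ht.1]
    nlinarith [norm_nonneg y, ht.1, ht.2]
  have hd : ∀ t ∈ Set.Icc (0 : ℝ) 1, HasDerivAt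
      (fun t : ℝ => WW ((0 : E2) + t • y) * JJ 1 (fun _ => 1) ((0 : E2) + t • y)) 0 t := by
    intro t ht
    have h1 := (WW_line_hasDerivAt (hb t ht)).mul (JJ_line 1 (continuous_const (y := (1 : ℝ))) (hb t ht))
    refine h1.congr_deriv ?_
    simp only [one_mul, Nat.cast_one]
    rw [JJ_linear_eq (hb t ht), ← JJ_two_one (hb t ht)]
    have := WW_pos (hb t ht)
    field_simp
    ring
  have hconst := constant_of_has_deriv_right_zero
    (fun t ht => (hd t ht).continuousAt.continuousWithinAt)
    (fun t ht => (hd t (Set.Ico_subset_Icc_self ht)).hasDerivWithinAt) 1 (by simp)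
  simp only [zero_smul, one_smul, zero_add, add_zero] at hconst
  rw [hconst]
  simp [WW, JJ]

lemma JJ_one_eq {y : E2} (hy : ‖y‖ < 1) : JJ 1 (fun _ => 1) y = 2 * Real.pi / WW y := by
  rw [eq_div_iff (WW_pos hy).ne', mul_comm]; exact JJ_one_one hy

lemma JJ_two_eq {y : E2} (hy : ‖y‖ < 1) : JJ 2 (fun _ => 1) y = 2 * Real.pi / WW y ^ 3 := by
  have h1 := JJ_two_one hy
  rw [JJ_one_eq hy] at h1
  have := WW_pos hy
  field_simp at h1 ⊢
  linarith

/-- The equivariant extension of a function on the circle to the disc. -/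
def vv (g : ℝ → ℝ) (y : E2) : ℝ := (2 * Real.pi)⁻¹ * (WW y ^ 3 * JJ 2 g y)

lemma vv_affine (a : ℝ) (c : E2) {y : E2} (hy : ‖y‖ < 1) :
    vv (fun θ => a + ⟪circ θ, c⟫) y = a + ⟪y, c⟫ := by
  have h1 : JJ 2 (fun θ => a + ⟪circ θ, c⟫) y =
      a * JJ 2 (fun _ => 1) y + JJ 2 (fun θ => ⟪circ θ, c⟫) y := by
    unfold JJ
    rw [← intervalIntegral.integral_const_mul, ← intervalIntegral.integral_add]
    · congr 1
      ext θ
      ring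
    · exact (continuous_const.mul
        (continuous_JJ_integrand 2 continuous_const hy)).intervalIntegrable _ _
    · exact (continuous_JJ_integrand 2 (continuous_circ.inner continuous_const)
        hy).intervalIntegrable _ _
  have := WW_pos hy
  have := Real.pi_pos
  rw [vv, h1, JJ_linear_eq hy, JJ_two_eq hy]
  field_simp

lemma vv_contDiffAt {g : ℝ → ℝ} (hg : Continuous g) {y : E2} (hy : ‖y‖ < 1) :
    ContDiffAt ℝ (⊤ : ℕ∞) (vv g) y :=
  contDiffAt_const.mul (((WW_contDiffAt hy).pow 3).mul (JJ_contDiffAt 2 hg hy))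

/-! ### Second derivatives of the extension -/

lemma hess_of_line {g : E2 → ℝ} {y w : E2} {D1 : ℝ → ℝ} {D2 : ℝ}
    (hg : ∀ᶠ t in 𝓝 (0 : ℝ), ContDiffAt ℝ (⊤ : ℕ∞) g (y + t • w))
    (h0 : ∀ᶠ t in 𝓝 (0 : ℝ), HasDerivAt (fun t : ℝ => g (y + t • w)) (D1 t) t)
    (h1 : HasDerivAt D1 D2 0) : hess g y w w = D2 := by
  have h2 : (fun t : ℝ => fderiv ℝ g (y + t • w) w) =ᶠ[𝓝 0] D1 := by
    filter_upwards [hg, h0] with t ht ht'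
    exact (line_deriv1 ht).unique ht'
  have h3 := line_deriv2 (v := w) hg.self_of_nhds
  have h4 := h3.unique (h1.congr_of_eventuallyEq h2)
  simpa using h4

lemma line_ball {y : E2} (hy : ‖y‖ < 1) (w : E2) : ∀ᶠ t in 𝓝 (0 : ℝ), ‖y + t • w‖ < 1 := by
  have hc : Continuous fun t : ℝ => ‖y + t • w‖ := by fun_prop
  exact hc.continuousAt.eventually_lt continuousAt_const (by simpa using hy)

/-- The kernel representing the Hessian of the extension. -/
def KK (y w : E2) (θ : ℝ) : ℝ :=
  WW y ^ 2 / (1 - ⟪y, circ θ⟫) ^ 2 *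
    (6 * WW y * (⟪circ θ, w⟫ / (1 - ⟪y, circ θ⟫) - ⟪y, w⟫ / WW y ^ 2) ^ 2 - 3 * HH y w)

lemma continuous_KK {y : E2} (hy : ‖y‖ < 1) (w : E2) : Continuous (KK y w) := by
  have h1 := continuous_JJ_integrand 2 (continuous_const (y := WW y ^ 2)) hy
  have h2 := continuous_JJ_integrand 1 (continuous_circ.inner (continuous_const (y := w))) hy
  simp only [pow_one] at h2
  unfold KK
  exact h1.mul ((continuous_const.mul ((h2.sub continuous_const).pow 2)).sub continuous_const)

lemma hess_vv {g : ℝ → ℝ} (hg : Continuous g) {y : E2} (hy : ‖y‖ < 1) (w : E2) :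
    hess (vv g) y w w = (2 * Real.pi)⁻¹ * ∫ θ in (0 : ℝ)..(2 * Real.pi), g θ * KK y w θ := by
  have hgs : Continuous fun θ => g θ * ⟪circ θ, w⟫ :=
    hg.mul (continuous_circ.inner continuous_const)
  have hgss : Continuous fun θ => g θ * ⟪circ θ, w⟫ * ⟪circ θ, w⟫ :=
    hgs.mul (continuous_circ.inner continuous_const)
  have hball := line_ball hy w
  have h0 : ‖y + (0 : ℝ) • w‖ < 1 := by simpa using hy
  have hH : hess (vv g) y w w = (2 * Real.pi)⁻¹ *
      ((-(3 * WW y * ‖w‖ ^ 2) + 3 * ⟪y, w⟫ ^ 2 / WW y) * JJ 2 g y -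
        12 * WW y * ⟪y, w⟫ * JJ 3 (fun θ => g θ * ⟪circ θ, w⟫) y +
        6 * WW y ^ 3 * JJ 4 (fun θ => g θ * ⟪circ θ, w⟫ * ⟪circ θ, w⟫) y) := by
    refine hess_of_line (D1 := fun t => (2 * Real.pi)⁻¹ *
      (3 * WW (y + t • w) ^ 2 * (-(⟪y + t • w, w⟫ / WW (y + t • w))) * JJ 2 g (y + t • w) +
        WW (y + t • w) ^ 3 * (2 * JJ 3 (fun θ => g θ * ⟪circ θ, w⟫) (y + t • w))))
      (hball.mono fun t ht => vv_contDiffAt hg ht) (hball.mono fun t ht => ?_) ?_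
    · have h1 := (((WW_line_hasDerivAt ht).pow 3).mul (JJ_line 2 hg ht)).const_mul (2 * Real.pi)⁻¹
      refine h1.congr_deriv ?_
      simp
    · have h1 := ((((WW_line_hasDerivAt h0).pow 2).const_mul 3).mul
        (WW_line_hasDerivAt2 h0)).mul (JJ_line 2 hg h0)
      have h2 := ((WW_line_hasDerivAt h0).pow 3).mul ((JJ_line 3 hgs h0).const_mul 2)
      refine ((h1.add h2).const_mul (2 * Real.pi)⁻¹).congr_deriv ?_
      have hW := WW_pos hy
      simp only [Pi.mul_apply, Pi.pow_apply, zero_smul, add_zero, HH]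
      push_cast
      field_simp
      ring
  rw [hH]
  congr 1
  unfold JJ
  rw [← intervalIntegral.integral_const_mul, ← intervalIntegral.integral_const_mul,
    ← intervalIntegral.integral_const_mul, ← intervalIntegral.integral_sub,
    ← intervalIntegral.integral_add]
  · congr 1
    ext θ
    have hs := ss_pos hy θ
    have hW := WW_pos hy
    unfold KK HH
    generalize 1 - ⟪y, circ θ⟫ = s at hs
    field_simp
    ring
  · exact ((continuous_const.mul (continuous_JJ_integrand 2 hg hy)).sub
      (continuous_const.mul (continuous_JJ_integrand 3 hgs hy))).intervalIntegrable _ _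
  · exact (continuous_const.mul (continuous_JJ_integrand 4 hgss hy)).intervalIntegrable _ _
  · exact (continuous_const.mul (continuous_JJ_integrand 2 hg hy)).intervalIntegrable _ _
  · exact (continuous_const.mul (continuous_JJ_integrand 3 hgs hy)).intervalIntegrable _ _

lemma KK_bound {y : E2} (hy : ‖y‖ < 1) (w : E2) (θ : ℝ) :
    |KK y w θ| ≤ 3 * WW y ^ 2 * HH y w / (1 - ⟪y, circ θ⟫) ^ 2 := by
  have hs := ss_pos hy θ
  have hW := WW_pos hy
  have hW2 := WW_sq hy
  have hcs : ⟪circ θ, w⟫ ^ 2 ≤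
      ‖(1 - ⟪y, circ θ⟫) • w + ⟪circ θ, w⟫ • y‖ ^ 2 := by
    have h1 := abs_real_inner_le_norm (circ θ) ((1 - ⟪y, circ θ⟫) • w + ⟪circ θ, w⟫ • y)
    rw [norm_circ, one_mul] at h1
    have h2 : ⟪circ θ, (1 - ⟪y, circ θ⟫) • w + ⟪circ θ, w⟫ • y⟫ = ⟪circ θ, w⟫ := by
      rw [inner_add_right, real_inner_smul_right, real_inner_smul_right, real_inner_comm y (circ θ)]
      ring
    rw [h2] at h1
    rw [← sq_abs]
    gcongr
  have hexp : ‖(1 - ⟪y, circ θ⟫) • w + ⟪circ θ, w⟫ • y‖ ^ 2 =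
      (1 - ⟪y, circ θ⟫) ^ 2 * ‖w‖ ^ 2 + 2 * (1 - ⟪y, circ θ⟫) * ⟪circ θ, w⟫ * ⟪y, w⟫ +
        ⟪circ θ, w⟫ ^ 2 * ‖y‖ ^ 2 := by
    rw [norm_add_sq_real, norm_smul, norm_smul, mul_pow, mul_pow, Real.norm_eq_abs, sq_abs,
      Real.norm_eq_abs, sq_abs, real_inner_smul_left, real_inner_smul_right, real_inner_comm y w]
    ring
  rw [hexp] at hcs
  have hy2 : ‖y‖ ^ 2 = 1 - WW y ^ 2 := by linarith
  rw [hy2] at hcs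
  have hH := HH_nonneg hy w
  have key : WW y * (⟪circ θ, w⟫ / (1 - ⟪y, circ θ⟫) - ⟪y, w⟫ / WW y ^ 2) ^ 2 ≤ HH y w := by
    unfold HH
    generalize 1 - ⟪y, circ θ⟫ = s at hs hcs
    generalize WW y = W at hW hcs
    have e : ‖w‖ ^ 2 / W + ⟪y, w⟫ ^ 2 / W ^ 3 -
        W * (⟪circ θ, w⟫ / s - ⟪y, w⟫ / W ^ 2) ^ 2 =
        (s ^ 2 * ‖w‖ ^ 2 + 2 * s * ⟪circ θ, w⟫ * ⟪y, w⟫ - W ^ 2 * ⟪circ θ, w⟫ ^ 2) /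
          (W * s ^ 2) := by
      field_simp
      ring
    have : 0 ≤ (s ^ 2 * ‖w‖ ^ 2 + 2 * s * ⟪circ θ, w⟫ * ⟪y, w⟫ - W ^ 2 * ⟪circ θ, w⟫ ^ 2) /
          (W * s ^ 2) := div_nonneg (by linarith) (by positivity)
    linarith
  have hk0 : 0 ≤ WW y * (⟪circ θ, w⟫ / (1 - ⟪y, circ θ⟫) - ⟪y, w⟫ / WW y ^ 2) ^ 2 := by positivity
  have h3 : |6 * WW y * (⟪circ θ, w⟫ / (1 - ⟪y, circ θ⟫) - ⟪y, w⟫ / WW y ^ 2) ^ 2 - 3 * HH y w| ≤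
      3 * HH y w := by
    rw [abs_le]; constructor <;> linarith
  unfold KK
  rw [abs_mul, abs_of_nonneg (by positivity)]
  calc _ ≤ WW y ^ 2 / (1 - ⟪y, circ θ⟫) ^ 2 * (3 * HH y w) := by gcongr
    _ = _ := by ring

lemma hess_vv_affine (a : ℝ) (c : E2) {y : E2} (hy : ‖y‖ < 1) (w : E2) :
    hess (vv fun θ => a + ⟪circ θ, c⟫) y w w = 0 := by
  have hg : Continuous fun θ => a + ⟪circ θ, c⟫ :=
    continuous_const.add (continuous_circ.inner continuous_const)
  have hball := line_ball hy w
  refine hess_of_line (D1 := fun _ => ⟪w, c⟫) (hball.mono fun t ht => vv_contDiffAt hg ht) ?_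
    (hasDerivAt_const _ _)
  filter_upwards [hball.eventually_nhds] with t ht
  have h1 : HasDerivAt (fun t : ℝ => a + ⟪y + t • w, c⟫) ⟪w, c⟫ t := by
    have := ((line_hasDerivAt y w t).inner ℝ (hasDerivAt_const t c)).const_add a
    simpa using this
  refine h1.congr_of_eventuallyEq ?_
  filter_upwards [ht] with t' ht'
  exact vv_affine a c ht'

/-- The basic estimates for the extension, by comparison with an affine function. -/
lemma vv_estimates {g : ℝ → ℝ} (hg : Continuous g) {y : E2} (hy : ‖y‖ < 1) {C : ℝ} (hC : 0 ≤ C)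
    (a : ℝ) (c : E2)
    (hga : ∀ θ, |g θ - (a + ⟪circ θ, c⟫)| ≤ C * ((1 - ⟪y, circ θ⟫) / WW y)) :
    |vv g y - (a + ⟪y, c⟫)| ≤ C * WW y ∧ ∀ w, |hess (vv g) y w w| ≤ 3 * C * HH y w := by
  have ha : Continuous fun θ => a + ⟪circ θ, c⟫ :=
    continuous_const.add (continuous_circ.inner continuous_const)
  have hW := WW_pos hy
  have hpi := Real.pi_pos
  have hJ1 := JJ_one_eq hy
  have hint1 : IntervalIntegrable (fun θ => 1 / (1 - ⟪y, circ θ⟫) ^ 1)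
      MeasureTheory.volume 0 (2 * Real.pi) :=
    (continuous_JJ_integrand 1 continuous_const hy).intervalIntegrable _ _
  constructor
  · have h1 : vv g y - (a + ⟪y, c⟫) = (2 * Real.pi)⁻¹ * (WW y ^ 3 *
        ∫ θ in (0 : ℝ)..(2 * Real.pi), (g θ - (a + ⟪circ θ, c⟫)) / (1 - ⟪y, circ θ⟫) ^ 2) := by
      rw [← vv_affine a c hy]
      simp only [sub_div]
      rw [intervalIntegral.integral_sub ((continuous_JJ_integrand 2 hg hy).intervalIntegrable _ _)
        ((continuous_JJ_integrand 2 ha hy).intervalIntegrable _ _)]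
      simp only [vv, JJ]
      ring
    have h2 := intervalIntegral.norm_integral_le_of_norm_le (a := 0) (b := 2 * Real.pi)
      (μ := MeasureTheory.volume)
      (f := fun θ => (g θ - (a + ⟪circ θ, c⟫)) / (1 - ⟪y, circ θ⟫) ^ 2)
      (g := fun θ => C / WW y * (1 / (1 - ⟪y, circ θ⟫) ^ 1)) (by positivity)
      (Eventually.of_forall fun θ _ => by
        have hs := ss_pos hy θ
        rw [Real.norm_eq_abs, abs_div, abs_of_pos (pow_pos hs 2), div_le_iff₀ (pow_pos hs 2)]
        refine (hga θ).trans (le_of_eq ?_)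
        generalize 1 - ⟪y, circ θ⟫ = s at hs
        field_simp)
      (hint1.const_mul _)
    rw [intervalIntegral.integral_const_mul] at h2
    change _ ≤ C / WW y * JJ 1 (fun _ => 1) y at h2
    rw [hJ1, Real.norm_eq_abs] at h2
    rw [h1, abs_mul, abs_mul, abs_of_pos (inv_pos.mpr (by positivity : (0 : ℝ) < 2 * Real.pi)),
      abs_of_pos (pow_pos hW 3)]
    calc _ ≤ (2 * Real.pi)⁻¹ * (WW y ^ 3 * (C / WW y * (2 * Real.pi / WW y))) := by gcongr
      _ = _ := by field_simp
  · intro w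
    have hK := continuous_KK hy w
    have hH := HH_nonneg hy w
    have h1 : hess (vv g) y w w = (2 * Real.pi)⁻¹ *
        ∫ θ in (0 : ℝ)..(2 * Real.pi), (g θ - (a + ⟪circ θ, c⟫)) * KK y w θ := by
      have hz := hess_vv_affine a c hy w
      rw [hess_vv ha hy] at hz
      have i1 : IntervalIntegrable (fun θ => g θ * KK y w θ)
        MeasureTheory.volume 0 (2 * Real.pi) := (hg.mul hK).intervalIntegrable _ _
      have i2 : IntervalIntegrable (fun θ => (a + ⟪circ θ, c⟫) * KK y w θ)
        MeasureTheory.volume 0 (2 * Real.pi) := (ha.mul hK).intervalIntegrable _ _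
      rw [hess_vv hg hy]
      simp only [sub_mul]
      rw [intervalIntegral.integral_sub i1 i2, mul_sub, hz, sub_zero]
    have h2 := intervalIntegral.norm_integral_le_of_norm_le (a := 0) (b := 2 * Real.pi)
      (μ := MeasureTheory.volume)
      (f := fun θ => (g θ - (a + ⟪circ θ, c⟫)) * KK y w θ)
      (g := fun θ => 3 * C * WW y * HH y w * (1 / (1 - ⟪y, circ θ⟫) ^ 1)) (by positivity)
      (Eventually.of_forall fun θ _ => by
        have hs := ss_pos hy θ
        rw [Real.norm_eq_abs, abs_mul]
        refine (mul_le_mul (hga θ) (KK_bound hy w θ) (abs_nonneg _) (by positivity)).trans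
          (le_of_eq ?_)
        generalize 1 - ⟪y, circ θ⟫ = s at hs
        field_simp)
      (hint1.const_mul _)
    rw [intervalIntegral.integral_const_mul] at h2
    change _ ≤ 3 * C * WW y * HH y w * JJ 1 (fun _ => 1) y at h2
    rw [hJ1, Real.norm_eq_abs] at h2
    rw [h1, abs_mul, abs_of_pos (inv_pos.mpr (by positivity : (0 : ℝ) < 2 * Real.pi))]
    calc _ ≤ (2 * Real.pi)⁻¹ * (3 * C * WW y * HH y w * (2 * Real.pi / WW y)) := by gcongr
      _ = _ := by field_simp

lemma exists_polar (y : E2) : ∃ θ, y = ‖y‖ • circ θ := by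
  by_cases h : y = 0
  · exact ⟨0, by simp [h]⟩
  · have hn : ‖y‖ ≠ 0 := norm_ne_zero_iff.mpr h
    obtain ⟨θ, hθ⟩ := exists_circ (z := ‖y‖⁻¹ • y) (by
      rw [norm_smul, norm_inv, norm_norm, inv_mul_cancel₀ hn])
    exact ⟨θ, by rw [← hθ, smul_smul, mul_inv_cancel₀ hn, one_smul]⟩

lemma vv_zygmund {φ : E2 → ℝ} (hφc : ContinuousOn φ (sphere (0 : E2) 1)) (hZ : ZygmundClass φ) :
    ∃ C, 0 ≤ C ∧
      (∀ θ₀ ρ : ℝ, 0 ≤ ρ → ρ < 1 →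
        |vv (fun θ => φ (circ θ)) (ρ • circ θ₀) - φ (circ θ₀)| ≤ C * WW (ρ • circ θ₀)) ∧
      (∀ y : E2, ‖y‖ < 1 → ∀ w, |hess (vv fun θ => φ (circ θ)) y w w| ≤ 3 * C * HH y w) := by
  obtain ⟨C, hC, h⟩ := zyg_approx hφc hZ
  have hg : Continuous fun θ => φ (circ θ) :=
    hφc.comp_continuous continuous_circ circ_mem
  have main : ∀ θ₀ ρ : ℝ, 0 ≤ ρ → ρ < 1 →
      |vv (fun θ => φ (circ θ)) (ρ • circ θ₀) - φ (circ θ₀)| ≤ C * WW (ρ • circ θ₀) ∧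
      ∀ w, |hess (vv fun θ => φ (circ θ)) (ρ • circ θ₀) w w| ≤ 3 * C * HH (ρ • circ θ₀) w := by
    intro θ₀ ρ hρ hρ1
    have hn : ‖ρ • circ θ₀‖ = ρ := by
      rw [norm_smul, norm_circ, mul_one, Real.norm_of_nonneg hρ]
    obtain ⟨c, hc⟩ := h θ₀ ρ hρ hρ1
    have hWe : WW (ρ • circ θ₀) = √(1 - ρ ^ 2) := by rw [WW, hn]
    have e := vv_estimates hg (y := ρ • circ θ₀) (by rw [hn]; exact hρ1) hC (φ (circ θ₀))
      (c • circ (θ₀ + Real.pi / 2)) (fun θ => by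
        have h1 := hc (θ - θ₀)
        rw [add_sub_cancel] at h1
        have e1 : ⟪circ θ, c • circ (θ₀ + Real.pi / 2)⟫ = c * Real.sin (θ - θ₀) := by
          rw [real_inner_smul_right, inner_coord]
          simp only [circ_zero, circ_one, Real.cos_add_pi_div_two, Real.sin_add_pi_div_two, Real.sin_sub]
          ring
        have e2 : ⟪ρ • circ θ₀, circ θ⟫ = ρ * Real.cos (θ - θ₀) := by
          rw [real_inner_smul_left, inner_coord]
          simp only [circ_zero, circ_one, Real.cos_sub]
          ring
        rw [e1, e2, hWe, ← sub_sub]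
        exact h1)
    have e3 : ⟪ρ • circ θ₀, c • circ (θ₀ + Real.pi / 2)⟫ = 0 := by
      rw [real_inner_smul_right, real_inner_smul_left, inner_coord]
      simp only [circ_zero, circ_one, Real.cos_add_pi_div_two, Real.sin_add_pi_div_two]
      ring
    rw [e3, add_zero] at e
    exact e
  refine ⟨C, hC, fun θ₀ ρ h0 h1 => (main θ₀ ρ h0 h1).1, fun y hy w => ?_⟩
  obtain ⟨θ, hθ⟩ := exists_polar y
  have := (main θ ‖y‖ (norm_nonneg y) hy).2 w
  rwa [← hθ] at this

/-! ### The graph dual to a function on the disc -/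

lemma exists_max_point {u : E2 → ℝ} (hsm : ContDiffOn ℝ (⊤ : ℕ∞) u (ball (0 : E2) 1))
    (hcont : ContinuousOn u (closedBall (0 : E2) 1))
    (hbd : ∀ z ∈ sphere (0 : E2) 1, ∀ ρ : ℝ, 0 ≤ ρ → ρ < 1 → u (ρ • z) ≤ u z - WW (ρ • z))
    (p : E2) :
    ∃ y : E2, ‖y‖ < 1 ∧ gradient u y = p ∧
      ∀ x ∈ closedBall (0 : E2) 1, ⟪p, x⟫ - u x ≤ ⟪p, y⟫ - u y := by
  have hc : ContinuousOn (fun x => ⟪p, x⟫ - u x) (closedBall (0 : E2) 1) :=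
    (continuous_const.inner continuous_id).continuousOn.sub hcont
  obtain ⟨y, hy, hmax⟩ := (isCompact_closedBall (0 : E2) 1).exists_isMaxOn
    ⟨0, by simp⟩ hc
  have hmax' : ∀ x ∈ closedBall (0 : E2) 1, ⟪p, x⟫ - u x ≤ ⟪p, y⟫ - u y := fun x hx => hmax hx
  have hy1 : ‖y‖ ≤ 1 := mem_closedBall_zero_iff.mp hy
  have hlt : ‖y‖ < 1 := by
    refine lt_of_le_of_ne hy1 fun hy2 => ?_
    have hP := norm_nonneg p
    set t : ℝ := 1 / (‖p‖ ^ 2 + 2) with ht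
    have ht0 : 0 < t := by positivity
    have ht1 : t * (‖p‖ ^ 2 + 2) = 1 := by rw [ht]; field_simp
    have ht2 : t ≤ 1 / 2 := by nlinarith [mul_nonneg ht0.le (sq_nonneg ‖p‖)]
    have hn : ‖(1 - t) • y‖ = 1 - t := by
      rw [norm_smul, hy2, mul_one, Real.norm_of_nonneg (by linarith)]
    have h1 := hbd y (by simp [hy2]) (1 - t) (by linarith) (by linarith)
    have h2 := hmax' ((1 - t) • y) (by rw [mem_closedBall_zero_iff, hn]; linarith)
    rw [real_inner_smul_right] at h2
    have h3 := real_inner_le_norm p y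
    rw [hy2, mul_one] at h3
    have hW0 := WW_pos (y := (1 - t) • y) (by rw [hn]; linarith)
    have hW := WW_sq (y := (1 - t) • y) (by rw [hn]; linarith)
    rw [hn] at hW
    have h4 : WW ((1 - t) • y) ≤ t * ‖p‖ := by nlinarith [mul_le_mul_of_nonneg_left h3 ht0.le]
    have h5 : WW ((1 - t) • y) ^ 2 ≤ (t * ‖p‖) ^ 2 := by gcongr
    have h6 : (t * ‖p‖) ^ 2 = t * (1 - 2 * t) := by
      have : t * ‖p‖ ^ 2 = 1 - 2 * t := by linarith
      rw [mul_pow, sq t, mul_assoc, this]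
    rw [h6, hW] at h5
    nlinarith
  refine ⟨y, hlt, ?_, hmax'⟩
  have hmem : ball (0 : E2) 1 ∈ 𝓝 y := isOpen_ball.mem_nhds (mem_ball_zero_iff.mpr hlt)
  have hloc : IsLocalMax (fun x => ⟪p, x⟫ - u x) y := by
    filter_upwards [hmem] with x hx
    exact hmax' x (ball_subset_closedBall hx)
  have hd : HasFDerivAt (fun x => ⟪p, x⟫ - u x) (innerSL ℝ p - fderiv ℝ u y) y :=
    (innerSL ℝ p).hasFDerivAt.sub ((hsm.contDiffAt hmem).differentiableAt (by simp)).hasFDerivAt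
  have h0 := hloc.hasFDerivAt_eq_zero hd
  refine ext_inner_right ℝ fun w => ?_
  rw [gradient_inner, ← sub_eq_zero.mp h0]
  simp

lemma HH_dual {y : E2} (hy : ‖y‖ < 1) (v : E2) :
    HH y (WW y • (v - ⟪y, v⟫ • y)) = WW y * (‖v‖ ^ 2 - ⟪y, v⟫ ^ 2) := by
  have hW := WW_pos hy
  have hW2 := WW_sq hy
  have hn : ‖y‖ ^ 2 = 1 - WW y ^ 2 := by linarith
  have e1 : ‖WW y • (v - ⟪y, v⟫ • y)‖ ^ 2 =
      WW y ^ 2 * (‖v‖ ^ 2 - 2 * ⟪y, v⟫ ^ 2 + ⟪y, v⟫ ^ 2 * (1 - WW y ^ 2)) := by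
    rw [norm_smul, mul_pow, Real.norm_eq_abs, sq_abs, norm_sub_sq_real, norm_smul, mul_pow,
      Real.norm_eq_abs, sq_abs, real_inner_smul_right, real_inner_comm y v, hn]
    ring
  have e2 : ⟪y, WW y • (v - ⟪y, v⟫ • y)⟫ = WW y ^ 3 * ⟪y, v⟫ := by
    rw [real_inner_smul_right, inner_sub_right, real_inner_smul_right, real_inner_self_eq_norm_sq,
      hn]
    ring
  rw [HH, e1, e2]
  field_simp
  ring

lemma inner_dual (y v : E2) :
    ⟪v, WW y • (v - ⟪y, v⟫ • y)⟫ = WW y * (‖v‖ ^ 2 - ⟪y, v⟫ ^ 2) := by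
  rw [real_inner_smul_right, inner_sub_right, real_inner_smul_right, real_inner_self_eq_norm_sq,
    real_inner_comm y v]
  ring

theorem dual_graph {φ u : E2 → ℝ} {B : ℝ} (hB : 0 < B)
    (hsm : ContDiffOn ℝ (⊤ : ℕ∞) u (ball (0 : E2) 1))
    (hcont : ContinuousOn u (closedBall (0 : E2) 1))
    (hφu : ∀ z ∈ sphere (0 : E2) 1, u z = φ z)
    (hbd : ∀ z ∈ sphere (0 : E2) 1, ∀ ρ : ℝ, 0 ≤ ρ → ρ < 1 → u (ρ • z) ≤ u z - WW (ρ • z))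
    (hlow : ∀ y : E2, ‖y‖ < 1 → ∀ w, HH y w ≤ hess u y w w)
    (hup : ∀ y : E2, ‖y‖ < 1 → ∀ w, hess u y w w ≤ B * HH y w) :
    ∃ (f : E2 → ℝ) (d : ℝ), 0 < d ∧
      ContDiff ℝ (⊤ : ℕ∞) f ∧ ConvexOn ℝ Set.univ f ∧
      (∀ p : E2, ‖gradient f p‖ < 1) ∧
      (∀ p v : E2,
        hess f p v v ≥
          d * Real.sqrt (1 - ‖gradient f p‖ ^ 2) *
            (‖v‖ ^ 2 - ⟪gradient f p, v⟫ ^ 2)) ∧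
      (∀ z ∈ sphere (0 : E2) 1,
        Tendsto (fun r : ℝ => r - f (r • z)) atTop (𝓝 (φ z))) := by
  choose Y hY1 hYg hYmax using exists_max_point hsm hcont hbd
  have hYb : ∀ p, Y p ∈ ball (0 : E2) 1 := fun p => mem_ball_zero_iff.mpr (hY1 p)
  have hYcb : ∀ p, Y p ∈ closedBall (0 : E2) 1 := fun p => ball_subset_closedBall (hYb p)
  have hua : ∀ p, ContDiffAt ℝ (⊤ : ℕ∞) u (Y p) := fun p =>
    hsm.contDiffAt (isOpen_ball.mem_nhds (hYb p))
  obtain ⟨hYs, hfd, hYh⟩ := legendre isOpen_ball (convex_ball (0 : E2) 1) hsm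
    (fun x hx w hw => (HH_pos (mem_ball_zero_iff.mp hx) hw).trans_le
      (hlow x (mem_ball_zero_iff.mp hx) w)) isOpen_univ (G := Y)
    (fun p _ => hYb p) (fun p _ => hYg p)
  set f : E2 → ℝ := fun p => ⟪p, Y p⟫ - u (Y p) with hf
  have hgrad : gradient f = Y := by
    funext p
    refine ext_inner_right ℝ fun w => ?_
    rw [gradient_inner, (hfd p (Set.mem_univ p)).fderiv]
    simp
  have hfs : ContDiff ℝ (⊤ : ℕ∞) f := by
    rw [contDiff_iff_contDiffAt]
    intro p
    have h1 := hYs p (Set.mem_univ p)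
    exact (contDiffAt_id.inner ℝ h1).sub ((hua p).comp p h1)
  refine ⟨f, 1 / B, by positivity, hfs, ?_, ?_, ?_, ?_⟩
  · refine ⟨convex_univ, fun p _ q _ a b ha hb hab => ?_⟩
    have h1 := hYmax p _ (hYcb (a • p + b • q))
    have h2 := hYmax q _ (hYcb (a • p + b • q))
    simp only [hf, smul_eq_mul]
    set y := Y (a • p + b • q) with hy
    have h3 : ⟪a • p + b • q, y⟫ - u y = a * (⟪p, y⟫ - u y) + b * (⟪q, y⟫ - u y) := by
      rw [inner_add_left, real_inner_smul_left, real_inner_smul_left]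
      linear_combination u y * hab
    rw [h3]
    gcongr
  · intro p
    rw [hgrad]
    exact hY1 p
  · intro p v
    have h0 : hess f p v v = ⟪fderiv ℝ Y p v, v⟫ := by
      rw [← fderiv_gradient_inner hfs.contDiffAt, hgrad]
    rw [h0, hgrad]
    change 1 / B * WW (Y p) * _ ≤ _
    have hy := hY1 p
    have hS := hYh p (Set.mem_univ p) v
    have hupp := hup (Y p) hy
    have hlo := hlow (Y p) hy
    have hsymm : ∀ a b, hess u (Y p) a b = hess u (Y p) b a := by
      intro a b
      have h := (hua p).isSymmSndFDerivAt (by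
        rw [minSmoothness_of_isRCLikeNormedField]; exact WithTop.coe_le_coe.mpr (le_top (a := (2 : ℕ∞))))
      exact h a b
    set y := Y p with hyd
    set w := fderiv ℝ Y p v with hw
    set x := WW y • (v - ⟪y, v⟫ • y) with hx
    have hq := hS x
    rw [hx, inner_dual, ← hx] at hq
    have h1 : 0 ≤ hess u y (x - B • w) (x - B • w) := (HH_nonneg hy _).trans (hlo _)
    have h2 : hess u y (x - B • w) (x - B • w) =
        hess u y x x - 2 * B * hess u y w x + B ^ 2 * hess u y w w := by
      have h3 := hsymm x w
      simp only [hess, map_sub, map_smul, sub_apply, smul_apply, smul_eq_mul] at h3 ⊢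
      rw [h3]
      ring
    have h3 := hupp x
    rw [hx, HH_dual hy, ← hx] at h3
    rw [h2, hq, hS w] at h1
    rw [real_inner_comm v w]
    have h4 : WW y * (‖v‖ ^ 2 - ⟪y, v⟫ ^ 2) ≤ B * ⟪v, w⟫ := by
      have : 0 ≤ B * (B * ⟪v, w⟫ - WW y * (‖v‖ ^ 2 - ⟪y, v⟫ ^ 2)) := by nlinarith
      have := nonneg_of_mul_nonneg_right this hB
      linarith
    rw [mul_assoc, one_div, inv_mul_le_iff₀ hB]
    exact h4
  · intro z hz
    have hz1 : ‖z‖ = 1 := mem_sphere_zero_iff_norm.mp hz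
    have hzc : z ∈ closedBall (0 : E2) 1 := sphere_subset_closedBall hz
    obtain ⟨m, hm⟩ := ((isCompact_closedBall (0 : E2) 1).bddBelow_image hcont)
    have hm' : ∀ x ∈ closedBall (0 : E2) 1, m ≤ u x := fun x hx => hm ⟨x, hx, rfl⟩
    rw [Metric.tendsto_atTop]
    intro ε hε
    obtain ⟨δ, hδ, hδu⟩ := Metric.continuousOn_iff.mp hcont z hzc ε hε
    refine ⟨max 0 (2 * (φ z - m) / δ ^ 2), fun r hr => ?_⟩
    have hr0 : 0 ≤ r := (le_max_left _ _).trans hr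
    have hr1 : 2 * (φ z - m) / δ ^ 2 ≤ r := (le_max_right _ _).trans hr
    rw [div_le_iff₀ (by positivity)] at hr1
    have h1 := hYmax (r • z) z hzc
    have h2 : ⟪r • z, z⟫ = r := by
      rw [real_inner_smul_left, real_inner_self_eq_norm_sq, hz1]; ring
    rw [h2, hφu z hz] at h1
    have hyc := hYcb (r • z)
    have hyn := hY1 (r • z)
    simp only [hf]
    set y := Y (r • z) with hyd
    have h3 : ⟪r • z, y⟫ = r * ⟪z, y⟫ := real_inner_smul_left _ _ _
    have h4 : ‖y - z‖ ^ 2 ≤ 2 - 2 * ⟪z, y⟫ := by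
      rw [norm_sub_sq_real, hz1, real_inner_comm z y]
      have := one_sub_pos hyn
      linarith
    have h5 : 0 ≤ r * (1 - ⟪z, y⟫) := mul_nonneg hr0 (by nlinarith [sq_nonneg ‖y - z‖])
    rw [Real.dist_eq, abs_lt]
    refine ⟨?_, by linarith⟩
    by_cases hd : dist y z < δ
    · have h6 := hδu y hyc hd
      rw [Real.dist_eq, hφu z hz, abs_lt] at h6
      rw [h3]
      linarith [h6.1]
    · rw [not_lt, dist_eq_norm] at hd
      have h6 : δ ^ 2 ≤ ‖y - z‖ ^ 2 := by gcongr
      have h7 : r * δ ^ 2 ≤ r * (2 - 2 * ⟪z, y⟫) := by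
        gcongr
        linarith
      have h8 := hm' y hyc
      rw [h3]
      linarith

/-! ### The converse direction -/

theorem graph_of_zygmund {φ : E2 → ℝ} (hφc : ContinuousOn φ (sphere (0 : E2) 1))
    (hZ : ZygmundClass φ) :
    ∃ (f : E2 → ℝ) (d : ℝ), 0 < d ∧
      ContDiff ℝ (⊤ : ℕ∞) f ∧ ConvexOn ℝ Set.univ f ∧
      (∀ p : E2, ‖gradient f p‖ < 1) ∧
      (∀ p v : E2,
        hess f p v v ≥
          d * Real.sqrt (1 - ‖gradient f p‖ ^ 2) *
            (‖v‖ ^ 2 - ⟪gradient f p, v⟫ ^ 2)) ∧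
      (∀ z ∈ sphere (0 : E2) 1,
        Tendsto (fun r : ℝ => r - f (r • z)) atTop (𝓝 (φ z))) := by
  obtain ⟨C, hC, hv1, hv2⟩ := vv_zygmund hφc hZ
  have hg : Continuous fun θ => φ (circ θ) :=
    hφc.comp_continuous continuous_circ circ_mem
  set v : E2 → ℝ := vv fun θ => φ (circ θ) with hvd
  have hvs : ∀ y : E2, ‖y‖ < 1 → ContDiffAt ℝ (⊤ : ℕ∞) v y := fun y hy => vv_contDiffAt hg hy
  set A : ℝ := 4 * C + 1 with hA
  let u : E2 → ℝ := fun y => if ‖y‖ < 1 then v y - A * WW y else φ y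
  have hu1 : ∀ y : E2, ‖y‖ < 1 → u y = v y - A * WW y := fun y hy => if_pos hy
  have hu2 : ∀ y : E2, ‖y‖ = 1 → u y = φ y := fun y hy => if_neg (by rw [hy]; exact lt_irrefl 1)
  have hus : ∀ y : E2, ‖y‖ < 1 → ContDiffAt ℝ (⊤ : ℕ∞) u y := by
    intro y hy
    refine ((hvs y hy).sub ((contDiffAt_const (c := A)).mul (WW_contDiffAt hy))).congr_of_eventuallyEq ?_
    filter_upwards [isOpen_ball.mem_nhds (mem_ball_zero_iff.mpr hy)] with x hx
    exact hu1 x (mem_ball_zero_iff.mp hx)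
  have huh : ∀ y : E2, ‖y‖ < 1 → ∀ w, hess u y w w = hess v y w w + A * HH y w := by
    intro y hy w
    have hball := line_ball hy w
    have h0 : ‖y + (0 : ℝ) • w‖ < 1 := by simpa using hy
    refine hess_of_line (D1 := fun t => fderiv ℝ v (y + t • w) w -
      A * (-(⟪y + t • w, w⟫ / WW (y + t • w)))) (hball.mono fun t ht => hus _ ht) ?_ ?_
    · filter_upwards [hball.eventually_nhds] with t ht
      have ht0 := ht.self_of_nhds
      refine ((line_deriv1 (hvs _ ht0)).sub
        ((WW_line_hasDerivAt ht0).const_mul A)).congr_of_eventuallyEq ?_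
      filter_upwards [ht] with t' ht'
      exact hu1 _ ht'
    · refine ((line_deriv2 (hvs _ h0)).sub
        ((WW_line_hasDerivAt2 h0).const_mul A)).congr_deriv ?_
      simp only [zero_smul, add_zero]
      ring
  have hcmp : ∀ y : E2, 0 < ‖y‖ → ‖y‖ ≤ 1 → |u y - φ (‖y‖⁻¹ • y)| ≤ (5 * C + 1) * WW y := by
    intro y hy0 hy
    rcases lt_or_eq_of_le hy with hlt | heq
    · obtain ⟨θ, hθ⟩ := exists_polar y
      have h1 := hv1 θ ‖y‖ hy0.le hlt
      rw [← hθ] at h1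
      have h2 : ‖y‖⁻¹ • y = circ θ := by
        nth_rewrite 2 [hθ]
        rw [smul_smul, inv_mul_cancel₀ hy0.ne', one_smul]
      rw [h2, hu1 y hlt]
      rw [abs_le] at h1 ⊢
      have hW := mul_nonneg hC (WW_pos hlt).le
      have hW' := WW_pos hlt
      constructor <;> nlinarith [h1.1, h1.2]
    · rw [hu2 y heq, heq]
      simp [WW, heq]
  refine dual_graph (φ := φ) (u := u) (B := 7 * C + 1) (by positivity)
    (fun y hy => (hus y (mem_ball_zero_iff.mp hy)).contDiffWithinAt) ?_ ?_ ?_ ?_ ?_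
  · intro z hz
    have hz1 : ‖z‖ ≤ 1 := mem_closedBall_zero_iff.mp hz
    rcases lt_or_eq_of_le hz1 with hlt | heq
    · exact (hus z hlt).continuousAt.continuousWithinAt
    · have hne : ‖z‖ ≠ 0 := by rw [heq]; exact one_ne_zero
      have hpos : ∀ᶠ y in 𝓝[closedBall (0 : E2) 1] z, 0 < ‖y‖ :=
        nhdsWithin_le_nhds (continuous_norm.continuousAt.eventually_const_lt
          (show 0 < ‖z‖ by rw [heq]; exact one_pos))
      have hmap : ContinuousAt (fun y : E2 => ‖y‖⁻¹ • y) z :=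
        (continuous_norm.continuousAt.inv₀ hne).smul continuousAt_id
      have hzz : ‖z‖⁻¹ • z = z := by rw [heq]; simp
      have hΦ : Tendsto (fun y : E2 => φ (‖y‖⁻¹ • y)) (𝓝[closedBall (0 : E2) 1] z) (𝓝 (φ z)) := by
        have hφz := hφc z (by simp [heq])
        refine Tendsto.comp hφz (tendsto_nhdsWithin_iff.mpr ⟨?_, ?_⟩)
        · have := hmap.tendsto
          rw [hzz] at this
          exact this.mono_left nhdsWithin_le_nhds
        · filter_upwards [hpos] with y hy
          rw [mem_sphere_zero_iff_norm, norm_smul, norm_inv, norm_norm, inv_mul_cancel₀ hy.ne']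
      have hW : Tendsto (fun y : E2 => (5 * C + 1) * WW y) (𝓝[closedBall (0 : E2) 1] z) (𝓝 0) := by
        have hc : Continuous fun y : E2 => (5 * C + 1) * WW y := by
          unfold WW
          fun_prop
        have h := (hc.tendsto z).mono_left (nhdsWithin_le_nhds (s := closedBall (0 : E2) 1))
        have h0 : (5 * C + 1) * WW z = 0 := by simp [WW, heq]
        rwa [h0] at h
      have hdiff : Tendsto (fun y : E2 => u y - φ (‖y‖⁻¹ • y))
          (𝓝[closedBall (0 : E2) 1] z) (𝓝 0) := by
        refine squeeze_zero_norm' ?_ hW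
        filter_upwards [hpos, self_mem_nhdsWithin] with y hy hy'
        exact hcmp y hy (mem_closedBall_zero_iff.mp hy')
      have := hdiff.add hΦ
      simp only [sub_add_cancel, zero_add] at this
      rw [ContinuousWithinAt, hu2 z heq]
      exact this
  · intro z hz
    exact hu2 z (mem_sphere_zero_iff_norm.mp hz)
  · intro z hz ρ hρ hρ1
    have hz1 := mem_sphere_zero_iff_norm.mp hz
    obtain ⟨θ, rfl⟩ := exists_circ hz1
    have hn : ‖ρ • circ θ‖ < 1 := by
      rw [norm_smul, norm_circ, mul_one, Real.norm_of_nonneg hρ]; exact hρ1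
    have h1 := (abs_le.mp (hv1 θ ρ hρ hρ1)).2
    rw [hu1 _ hn, hu2 _ hz1]
    have hW := mul_nonneg hC (WW_pos hn).le
    nlinarith
  · intro y hy w
    have h1 := (abs_le.mp (hv2 y hy w)).1
    rw [huh y hy]
    have hH := mul_nonneg hC (HH_nonneg hy w)
    nlinarith
  · intro y hy w
    have h1 := (abs_le.mp (hv2 y hy w)).2
    rw [huh y hy]
    have hH := mul_nonneg hC (HH_nonneg hy w)
    nlinarith

/-- **Theorem 1.1.** For a continuous `φ : ∂𝔻 → ℝ`, there exists a spacelike entire graph in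
`ℝ^{2,1}` with principal curvatures bounded from below by a positive constant and support
function at infinity `φ` if and only if `φ` is in the Zygmund class. -/
theorem entire_graph_bounded_curvature_iff_zygmund
    (φ : E2 → ℝ) (hφc : ContinuousOn φ (sphere (0 : E2) 1)) :
    (∃ (f : E2 → ℝ) (d : ℝ), 0 < d ∧
      ContDiff ℝ (⊤ : ℕ∞) f ∧ ConvexOn ℝ Set.univ f ∧
      (∀ p : E2, ‖gradient f p‖ < 1) ∧
      (∀ p v : E2,
        hess f p v v ≥
          d * Real.sqrt (1 - ‖gradient f p‖ ^ 2) *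
            (‖v‖ ^ 2 - ⟪gradient f p, v⟫ ^ 2)) ∧
      (∀ z ∈ sphere (0 : E2) 1,
        Tendsto (fun r : ℝ => r - f (r • z)) atTop (𝓝 (φ z)))) ↔
    ZygmundClass φ := by
  constructor
  · rintro ⟨f, d, hd, hf, _, hgrad, hcurv, hlim⟩
    exact zygmund_of_graph φ hφc f d hd hf hgrad hcurv hlim
  · intro hZ
    exact graph_of_zygmund hφc hZ
end
end

section
/- Let φ : ∂𝔻 → ℝ be bounded and lower semicontinuous. For each K ∈ (−∞, 0), let f_K : ℝ² → ℝ be the unique smooth convex function with ‖∇f_K(p)‖ < 1 for all p, det D²f_K(p) = |K|·(1 − ‖∇f_K(p)‖²)² for all p, and lim_{r→+∞}(r − f_K(rz)) = φ(z) for every z ∈ ∂𝔻. Then for every point (y, t) ∈ ℝ² × ℝ satisfying ⟨y, z⟩ − t < φ(z) for every z ∈ ∂𝔻 (i.e. every point of the interior of the domain of dependence determined by φ), there exists exactly one K ∈ (−∞, 0) such that t = f_K(y). In other words, the constant curvature spacelike entire graphs foliate the domain of dependence. -/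
open Metric Filter
open scoped RealInnerProductSpace Topology

noncomputable section

/-- One-dimensional necessary second-order condition at a maximum. -/
lemma second_order_max {w w' : ℝ → ℝ} {w'' : ℝ} (h1 : ∀ s, HasDerivAt w (w' s) s)
    (h2 : HasDerivAt w' w'' 0) (hm : ∀ s, w s ≤ w 0) : w' 0 = 0 ∧ w'' ≤ 0 := by
  have hlm : IsLocalMax w 0 := Eventually.of_forall hm
  have h0 : w' 0 = 0 := hlm.hasDerivAt_eq_zero (h1 0)
  refine ⟨h0, ?_⟩
  by_contra hpos
  push Not at hpos
  have hd : deriv w = w' := funext fun s => (h1 s).deriv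
  have hmin : IsLocalMin w 0 := by
    apply isLocalMin_of_deriv_deriv_pos
    · rw [hd, h2.deriv]; exact hpos
    · rw [hd, h0]
    · exact (h1 0).continuousAt
  have hc : w =ᶠ[𝓝 0] fun _ => w 0 := by
    filter_upwards [hmin] with s hs using le_antisymm (hm s) hs
  have hc' : w' =ᶠ[𝓝 0] fun _ => (0 : ℝ) := by
    have := hc.deriv
    rw [hd] at this
    simpa using this
  have := (h2.congr_of_eventuallyEq hc'.symm).unique (hasDerivAt_const (0 : ℝ) (0 : ℝ))
  linarith

lemma line_deriv {f : E2 → ℝ} (hf : ContDiff ℝ 2 f) (a v : E2) (s : ℝ) :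
    HasDerivAt (fun s : ℝ => f (a + s • v)) (fderiv ℝ f (a + s • v) v) s := by
  have h1 : HasDerivAt (fun s : ℝ => a + s • v) v s := by
    simpa using ((hasDerivAt_id s).smul_const v).const_add a
  exact ((hf.differentiable (by norm_num)) _).hasFDerivAt.comp_hasDerivAt s h1

lemma line_deriv2_s3 {f : E2 → ℝ} (hf : ContDiff ℝ 2 f) (a v : E2) (s : ℝ) :
    HasDerivAt (fun s : ℝ => fderiv ℝ f (a + s • v) v) (hess f (a + s • v) v v) s := by
  have h1 : HasDerivAt (fun s : ℝ => a + s • v) v s := by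
    simpa using ((hasDerivAt_id s).smul_const v).const_add a
  have hd : Differentiable ℝ (fderiv ℝ f) :=
    (hf.fderiv_right (m := 1) (by norm_num)).differentiable (by norm_num)
  have h2 := (hd (a + s • v)).hasFDerivAt.comp_hasDerivAt s h1
  have h3 := h2.clm_apply (hasDerivAt_const s v)
  simpa [hess] using h3

/-- First and second order conditions at a maximum of `g - f(μ ·)`. -/
lemma max_conditions {g f : E2 → ℝ} (hg : ContDiff ℝ 2 g) (hf : ContDiff ℝ 2 f) (μ : ℝ) (x0 : E2)
    (hm : ∀ x, g x - f (μ • x) ≤ g x0 - f (μ • x0)) (v : E2) :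
    fderiv ℝ g x0 v = μ * fderiv ℝ f (μ • x0) v ∧
      hess g x0 v v ≤ μ ^ 2 * hess f (μ • x0) v v := by
  have key := second_order_max (w := fun s : ℝ => g (x0 + s • v) - f (μ • x0 + s • (μ • v)))
    (w' := fun s => fderiv ℝ g (x0 + s • v) v - fderiv ℝ f (μ • x0 + s • (μ • v)) (μ • v))
    (w'' := hess g x0 v v - hess f (μ • x0) (μ • v) (μ • v))
    (fun s => (line_deriv hg x0 v s).sub (line_deriv hf (μ • x0) (μ • v) s))
    (by
      have h := (line_deriv2_s3 hg x0 v 0).sub (line_deriv2_s3 hf (μ • x0) (μ • v) 0)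
      simp only [zero_smul, add_zero] at h
      exact h)
    (by
      intro s
      have := hm (x0 + s • v)
      simp only [zero_smul, add_zero]
      rw [smul_add, smul_comm μ s v] at this
      exact this)
  obtain ⟨k1, k2⟩ := key
  simp only [zero_smul, add_zero, map_smul, smul_eq_mul, hess, _root_.smul_apply] at k1 k2
  constructor
  · linarith
  · simp only [hess]; nlinarith

lemma hess_symm {f : E2 → ℝ} (hf : ContDiff ℝ 2 f) (p v w : E2) : hess f p v w = hess f p w v := by
  have : IsSymmSndFDerivAt ℝ f p := hf.contDiffAt.isSymmSndFDerivAt (by simp)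
  exact this v w

/-- Monotonicity of the determinant for 2×2 symmetric matrices. -/
lemma det_mono {a1 a2 a3 b1 b2 b3 : ℝ} (ha1 : 0 ≤ a1) (ha3 : 0 ≤ a3) (hd : 0 ≤ a1 * a3 - a2 * a2)
    (hle : ∀ s t : ℝ, s ^ 2 * a1 + 2 * s * t * a2 + t ^ 2 * a3 ≤
      s ^ 2 * b1 + 2 * s * t * b2 + t ^ 2 * b3) :
    a1 * a3 - a2 * a2 ≤ b1 * b3 - b2 * b2 := by
  have hc1 : 0 ≤ b1 - a1 := by have := hle 1 0; linarith
  have hc3 : 0 ≤ b3 - a3 := by have := hle 0 1; linarith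
  have hdis : discrim (b1 - a1) (2 * (b2 - a2)) (b3 - a3) ≤ 0 :=
    discrim_le_zero fun x => by have := hle x 1; nlinarith
  rw [discrim] at hdis
  obtain ⟨c1, rfl⟩ : ∃ c, b1 = a1 + c := ⟨b1 - a1, by ring⟩
  obtain ⟨c2, rfl⟩ : ∃ c, b2 = a2 + c := ⟨b2 - a2, by ring⟩
  obtain ⟨c3, rfl⟩ : ∃ c, b3 = a3 + c := ⟨b3 - a3, by ring⟩
  simp only [add_sub_cancel_left] at hc1 hc3 hdis
  have hC : c2 ^ 2 ≤ c1 * c3 := by nlinarith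
  have hmix : 2 * (a2 * c2) ≤ a1 * c3 + a3 * c1 := by
    refine (abs_le_of_sq_le_sq' ?_ ?_).2
    · have h1 : (a2 * c2) ^ 2 ≤ (a1 * a3) * (c1 * c3) := by
        rw [mul_pow]
        exact mul_le_mul (by nlinarith) hC (sq_nonneg _) (mul_nonneg ha1 ha3)
      nlinarith [sq_nonneg (a1 * c3 - a3 * c1)]
    · positivity
  nlinarith

/-- Entire spacelike graph of constant curvature `-κ` with support function at infinity `φ`. -/
structure KS (κ : ℝ) (φ : E2 → ℝ) (f : E2 → ℝ) : Prop where
  pos : 0 < κ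
  smooth : ContDiff ℝ 2 f
  sub : ∀ x y : E2, f x + fderiv ℝ f x (y - x) ≤ f y
  grad : ∀ x : E2, ‖fderiv ℝ f x‖ < 1
  det : ∀ x : E2, detHess f x = κ * (1 - ‖fderiv ℝ f x‖ ^ 2) ^ 2
  lim : ∀ z ∈ sphere (0 : E2) 1, Tendsto (fun r : ℝ => r - f (r • z)) atTop (𝓝 (φ z))

namespace KS

lemma hess_nonneg {κ : ℝ} {φ f : E2 → ℝ} (hf : KS κ φ f) (x v : E2) : 0 ≤ hess f x v v := by
  have key := second_order_max (w := fun s : ℝ => s * fderiv ℝ f x v - f (x + s • v))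
    (w' := fun s => fderiv ℝ f x v - fderiv ℝ f (x + s • v) v)
    (w'' := 0 - hess f x v v)
    (fun s => by
      have h1 := (hasDerivAt_id s).mul_const (fderiv ℝ f x v)
      simp only [id, one_mul] at h1
      exact h1.sub (line_deriv hf.smooth x v s))
    (by
      have h := (hasDerivAt_const (0 : ℝ) (fderiv ℝ f x v)).sub (line_deriv2_s3 hf.smooth x v 0)
      simp only [zero_smul, add_zero] at h
      exact h)
    (by
      intro s
      have := hf.sub x (x + s • v)
      simp only [add_sub_cancel_left, map_smul, smul_eq_mul] at this
      simp only [zero_smul, add_zero, zero_mul]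
      linarith)
  linarith [key.2]

lemma hess_expand {f : E2 → ℝ} (hf : ContDiff ℝ 2 f) (x v w : E2) (s t : ℝ) :
    hess f x (s • v + t • w) (s • v + t • w) =
      s ^ 2 * hess f x v v + 2 * s * t * hess f x v w + t ^ 2 * hess f x w w := by
  have h := hess_symm hf x v w
  simp only [hess, map_add, map_smul, _root_.add_apply, _root_.smul_apply, smul_eq_mul] at h ⊢
  rw [h]; ring

/-- The maximum principle for `g - f(μ ·)`. -/
lemma max_principle {κg κf : ℝ} {φg φf g f : E2 → ℝ} (hg : KS κg φg g) (hf : KS κf φf f)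
    (μ : ℝ) (x0 : E2) (hm : ∀ x, g x - f (μ • x) ≤ g x0 - f (μ • x0)) :
    fderiv ℝ g x0 = μ • fderiv ℝ f (μ • x0) ∧
    κg * (1 - ‖fderiv ℝ g x0‖ ^ 2) ^ 2 ≤
      μ ^ 4 * (κf * (1 - ‖fderiv ℝ f (μ • x0)‖ ^ 2) ^ 2) := by
  have mc := max_conditions hg.smooth hf.smooth μ x0 hm
  refine ⟨by ext v; simpa using (mc v).1, ?_⟩
  rw [← hg.det, ← hf.det]
  have hpos : 0 ≤ detHess g x0 := by
    rw [hg.det]; have := hg.pos; positivity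
  unfold detHess at hpos ⊢
  rw [hess_symm hg.smooth x0 (EuclideanSpace.single 1 1) (EuclideanSpace.single 0 1)] at hpos ⊢
  rw [hess_symm hf.smooth (μ • x0) (EuclideanSpace.single 1 1) (EuclideanSpace.single 0 1)]
  have := det_mono (hg.hess_nonneg x0 (EuclideanSpace.single 0 1))
    (hg.hess_nonneg x0 (EuclideanSpace.single 1 1)) hpos
    (b1 := μ ^ 2 * hess f (μ • x0) (EuclideanSpace.single 0 1) (EuclideanSpace.single 0 1))
    (b2 := μ ^ 2 * hess f (μ • x0) (EuclideanSpace.single 0 1) (EuclideanSpace.single 1 1))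
    (b3 := μ ^ 2 * hess f (μ • x0) (EuclideanSpace.single 1 1) (EuclideanSpace.single 1 1))
    (by
      intro s t
      have h := (mc (s • EuclideanSpace.single 0 1 + t • EuclideanSpace.single 1 1)).2
      rw [hess_expand hg.smooth, hess_expand hf.smooth] at h
      linarith)
  linarith

lemma lip {κ : ℝ} {φ f : E2 → ℝ} (hf : KS κ φ f) (x y : E2) : f x ≤ f y + ‖x - y‖ := by
  have h1 := hf.sub x y
  have h2 : fderiv ℝ f x (x - y) ≤ ‖x - y‖ := by
    calc fderiv ℝ f x (x - y) ≤ ‖fderiv ℝ f x (x - y)‖ := Real.le_norm_self _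
      _ ≤ ‖fderiv ℝ f x‖ * ‖x - y‖ := ContinuousLinearMap.le_opNorm _ _
      _ ≤ 1 * ‖x - y‖ := by gcongr; exact (hf.grad x).le
      _ = _ := one_mul _
  have h3 : fderiv ℝ f x (y - x) = - fderiv ℝ f x (x - y) := by rw [← map_neg, neg_sub]
  linarith

lemma mono {κ : ℝ} {φ f : E2 → ℝ} (hf : KS κ φ f) {z : E2} (hz : ‖z‖ = 1) :
    Monotone (fun r : ℝ => r - f (r • z)) := by
  intro r s hrs
  have := hf.lip (s • z) (r • z)
  rw [← sub_smul, norm_smul, hz, Real.norm_of_nonneg (sub_nonneg.2 hrs)] at this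
  simp only
  linarith

lemma le_lim {κ : ℝ} {φ f : E2 → ℝ} (hf : KS κ φ f) {z : E2} (hz : ‖z‖ = 1) (r : ℝ) :
    r - f (r • z) ≤ φ z :=
  (hf.mono hz).ge_of_tendsto (hf.lim z (by simpa using hz)) r

lemma growth {κ M : ℝ} {φ f : E2 → ℝ} (hf : KS κ φ f) (hM : ∀ z ∈ sphere (0 : E2) 1, φ z ≤ M)
    (x : E2) : ‖x‖ - M ≤ f x := by
  obtain ⟨z, hz, hx⟩ : ∃ z : E2, ‖z‖ = 1 ∧ x = ‖x‖ • z := by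
    by_cases h : x = 0
    · exact ⟨EuclideanSpace.single 0 1, by simp, by simp [h]⟩
    · have : ‖x‖ ≠ 0 := by simpa using h
      exact ⟨‖x‖⁻¹ • x, by simp [norm_smul, this], by rw [smul_smul, mul_inv_cancel₀ this, one_smul]⟩
  have h1 := hf.le_lim hz ‖x‖
  rw [← hx] at h1
  have := hM z (by simpa using hz)
  linarith

end KS

lemma hyp_sq (y z : E2) (hz : ‖z‖ = 1) (r : ℝ) :
    ‖r • z - y‖ ^ 2 = (r - ⟪y, z⟫) ^ 2 + (‖y‖ ^ 2 - ⟪y, z⟫ ^ 2) := by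
  rw [norm_sub_sq_real, norm_smul, real_inner_smul_left, hz, real_inner_comm, mul_one,
    Real.norm_eq_abs, sq_abs]
  ring

lemma tendsto_hyp (c : ℝ) (y z : E2) (hz : ‖z‖ = 1) :
    Tendsto (fun r : ℝ => r - √(c ^ 2 + ‖r • z - y‖ ^ 2)) atTop (𝓝 ⟪y, z⟫) := by
  have hcs : ⟪y, z⟫ ^ 2 ≤ ‖y‖ ^ 2 := by
    have := abs_real_inner_le_norm y z
    rw [hz, mul_one] at this
    exact sq_le_sq' (abs_le.1 this).1 (abs_le.1 this).2
  set E := c ^ 2 + (‖y‖ ^ 2 - ⟪y, z⟫ ^ 2) with hE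
  have hE0 : 0 ≤ E := by nlinarith
  have hlow : Tendsto (fun r : ℝ => ⟪y, z⟫ - E * (r - ⟪y, z⟫)⁻¹) atTop (𝓝 ⟪y, z⟫) := by
    have h1 : Tendsto (fun r : ℝ => (r - ⟪y, z⟫)⁻¹) atTop (𝓝 0) :=
      tendsto_inv_atTop_zero.comp (tendsto_atTop_add_const_right _ _ tendsto_id)
    simpa using (h1.const_mul E).const_sub ⟪y, z⟫
  refine tendsto_of_tendsto_of_tendsto_of_le_of_le' hlow tendsto_const_nhds ?_ ?_
  · filter_upwards [eventually_gt_atTop ⟪y, z⟫] with r hr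
    have ha : 0 < r - ⟪y, z⟫ := by linarith
    have : √(c ^ 2 + ‖r • z - y‖ ^ 2) ≤ (r - ⟪y, z⟫) + E * (r - ⟪y, z⟫)⁻¹ := by
      rw [Real.sqrt_le_iff]
      refine ⟨by positivity, ?_⟩
      rw [hyp_sq y z hz]
      have h2 : (r - ⟪y, z⟫) * (r - ⟪y, z⟫)⁻¹ = 1 := mul_inv_cancel₀ ha.ne'
      nlinarith [sq_nonneg (E * (r - ⟪y, z⟫)⁻¹)]
    linarith
  · filter_upwards [eventually_gt_atTop ⟪y, z⟫] with r hr
    have : r - ⟪y, z⟫ ≤ √(c ^ 2 + ‖r • z - y‖ ^ 2) := by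
      apply Real.le_sqrt_of_sq_le
      rw [hyp_sq y z hz]
      nlinarith
    linarith

lemma KS.dom {κ : ℝ} {φ f : E2 → ℝ} (hf : KS κ φ f) (y : E2) {z : E2} (hz : ‖z‖ = 1) :
    ⟪y, z⟫ - f y ≤ φ z := by
  have h1 := (tendsto_hyp 0 y z hz).sub_const (f y)
  refine le_of_tendsto' h1 fun r => ?_
  have h2 := hf.le_lim hz r
  have h3 := hf.lip (r • z) y
  have h4 : √((0 : ℝ) ^ 2 + ‖r • z - y‖ ^ 2) = ‖r • z - y‖ := by
    rw [zero_pow two_ne_zero, zero_add, Real.sqrt_sq (norm_nonneg _)]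
  rw [h4]; linarith

/-- The hyperboloid. -/
def hyp (c : ℝ) (y : E2) (t : ℝ) (x : E2) : ℝ := t + √(c ^ 2 + ‖x - y‖ ^ 2)

lemma hyp_fderiv {c : ℝ} (hc : 0 < c) (y : E2) (t : ℝ) (x : E2) :
    HasFDerivAt (hyp c y t) ((√(c ^ 2 + ‖x - y‖ ^ 2))⁻¹ • innerSL ℝ (x - y)) x := by
  have h1 : HasFDerivAt (fun x : E2 => x - y) (ContinuousLinearMap.id ℝ E2) x :=
    (hasFDerivAt_id x).sub_const y
  have hp : c ^ 2 + ‖x - y‖ ^ 2 ≠ 0 := by positivity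
  have h2 := ((h1.norm_sq.const_add (c ^ 2)).sqrt hp).const_add t
  refine HasFDerivAt.congr_fderiv (f := hyp c y t) h2 ?_
  have hs : √(c ^ 2 + ‖x - y‖ ^ 2) ≠ 0 := by positivity
  ext v
  simp [-map_sub]
  field_simp

lemma hyp_hess {c : ℝ} (hc : 0 < c) (y : E2) (t : ℝ) (x v w : E2) :
    hess (hyp c y t) x v w = (√(c ^ 2 + ‖x - y‖ ^ 2))⁻¹ * ⟪v, w⟫ -
      (√(c ^ 2 + ‖x - y‖ ^ 2))⁻¹ ^ 3 * (⟪x - y, v⟫ * ⟪x - y, w⟫) := by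
  have hfd : fderiv ℝ (hyp c y t) =
      fun x => (√(c ^ 2 + ‖x - y‖ ^ 2))⁻¹ • innerSL ℝ (x - y) :=
    funext fun x => (hyp_fderiv hc y t x).fderiv
  have hD : 0 < √(c ^ 2 + ‖x - y‖ ^ 2) := by positivity
  have h0 := (hyp_fderiv hc y 0 x)
  have h1 : HasFDerivAt (fun x : E2 => √(c ^ 2 + ‖x - y‖ ^ 2))
      ((√(c ^ 2 + ‖x - y‖ ^ 2))⁻¹ • innerSL ℝ (x - y)) x := by
    convert h0 using 1
    ext; simp [hyp]
  have h2 := (hasDerivAt_inv hD.ne').comp_hasFDerivAt x h1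
  have h3 : HasFDerivAt (fun x : E2 => innerSL ℝ (x - y)) (innerSL ℝ : E2 →L[ℝ] E2 →L[ℝ] ℝ) x := by
    have := (innerSL ℝ : E2 →L[ℝ] E2 →L[ℝ] ℝ).hasFDerivAt (x := x - y)
    exact this.comp x ((hasFDerivAt_id x).sub_const y)
  have h4 := h2.smul h3
  unfold hess
  rw [hfd]
  have h5 := h4.fderiv
  simp only [Function.comp_def] at h5
  erw [h5]
  have e1 : innerSL ℝ v w = ⟪v, w⟫ := rfl
  simp only [_root_.add_apply, _root_.smul_apply, ContinuousLinearMap.smulRight_apply,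
    innerSL_apply_apply, smul_eq_mul, e1]
  ring

lemma hyp_KS {c : ℝ} (hc : 0 < c) (y : E2) (t : ℝ) :
    KS (1 / c ^ 2) (fun z => ⟪y, z⟫ - t) (hyp c y t) where
  pos := by positivity
  smooth := by
    unfold hyp
    refine contDiff_const.add (ContDiff.sqrt
      (contDiff_const.add ((contDiff_id.sub contDiff_const).norm_sq ℝ)) fun x => by positivity)
  sub := by
    intro a b
    rw [(hyp_fderiv hc y t a).fderiv]
    have hD : 0 < √(c ^ 2 + ‖a - y‖ ^ 2) := by positivity
    have hB : 0 < √(c ^ 2 + ‖b - y‖ ^ 2) := by positivity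
    have hD2 := Real.sq_sqrt (show 0 ≤ c ^ 2 + ‖a - y‖ ^ 2 by positivity)
    have hB2 := Real.sq_sqrt (show 0 ≤ c ^ 2 + ‖b - y‖ ^ 2 by positivity)
    unfold hyp
    have e : b - a = (b - y) - (a - y) := by abel
    rw [e]
    simp only [_root_.smul_apply, innerSL_apply_apply, smul_eq_mul]
    rw [inner_sub_right (a - y) (b - y) (a - y), real_inner_self_eq_norm_sq]
    have hcs := real_inner_le_norm (a - y) (b - y)
    set D := √(c ^ 2 + ‖a - y‖ ^ 2)
    set B := √(c ^ 2 + ‖b - y‖ ^ 2)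
    set p := ‖a - y‖
    set q := ‖b - y‖
    have hDB : c ^ 2 + p * q ≤ D * B := by
      refine (abs_le_of_sq_le_sq' ?_ (by positivity)).2
      rw [mul_pow, hD2, hB2]
      nlinarith [sq_nonneg (c * (p - q))]
    have : D⁻¹ * (⟪a - y, b - y⟫ - p ^ 2) ≤ B - D := by
      rw [inv_mul_le_iff₀ hD]
      nlinarith
    linarith
  grad := by
    intro x
    rw [(hyp_fderiv hc y t x).fderiv]
    have hD : 0 < √(c ^ 2 + ‖x - y‖ ^ 2) := by positivity
    rw [norm_smul, innerSL_apply_norm, norm_inv, Real.norm_of_nonneg hD.le, inv_mul_lt_iff₀ hD,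
      mul_one]
    apply Real.lt_sqrt_of_sq_lt
    nlinarith [pow_pos hc 2]
  det := by
    intro x
    rw [(hyp_fderiv hc y t x).fderiv]
    unfold detHess
    simp only [hyp_hess hc]
    have hD : 0 < √(c ^ 2 + ‖x - y‖ ^ 2) := by positivity
    have hD2 := Real.sq_sqrt (show 0 ≤ c ^ 2 + ‖x - y‖ ^ 2 by positivity)
    rw [norm_smul, innerSL_apply_norm, norm_inv, Real.norm_of_nonneg hD.le]
    set D := √(c ^ 2 + ‖x - y‖ ^ 2)
    have hn : ‖x - y‖ ^ 2 = (x - y) 0 ^ 2 + (x - y) 1 ^ 2 := by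
      rw [EuclideanSpace.real_norm_sq_eq]; simp [Fin.sum_univ_two]
    rw [hn] at hD2
    rw [mul_pow, hn]
    simp only [EuclideanSpace.inner_single_right]
    simp
    simp at hD2
    set a := x 0 - y 0
    set b := x 1 - y 1
    have hDc : c ^ 2 = D ^ 2 - a ^ 2 - b ^ 2 := by linarith
    field_simp
    rw [show c ^ 2 = D ^ 2 - a ^ 2 - b ^ 2 from hDc]
    ring
  lim := by
    intro z hz
    have h := (tendsto_hyp c y z (by simpa using hz)).sub_const t
    refine h.congr fun r => ?_
    unfold hyp; ring

lemma KS.mono' {κ : ℝ} {φ f : E2 → ℝ} (hf : KS κ φ f) {z : E2} (hz : ‖z‖ ≤ 1) :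
    Monotone (fun r : ℝ => r - f (r • z)) := by
  intro r s hrs
  have := hf.lip (s • z) (r • z)
  rw [← sub_smul, norm_smul, Real.norm_of_nonneg (sub_nonneg.2 hrs)] at this
  have h2 : (s - r) * ‖z‖ ≤ (s - r) * 1 := mul_le_mul_of_nonneg_left hz (sub_nonneg.2 hrs)
  simp only
  linarith

/-- Barrier: a surface of curvature `-κ` lies below the hyperboloids centred at points of the
domain of dependence. -/
lemma KS.barrier {κ c t : ℝ} {φ g : E2 → ℝ} (hg : KS κ φ g) (hc : 0 < c) (hck : 1 / c ^ 2 < κ)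
    (y : E2) (hy : ∀ z : E2, ‖z‖ = 1 → ⟪y, z⟫ - t ≤ φ z) (x : E2) : g x ≤ hyp c y t x := by
  have hH := hyp_KS hc y t
  have hcont : Continuous fun x => g x - hyp c y t x :=
    hg.smooth.continuous.sub hH.smooth.continuous
  apply le_of_forall_pos_le_add
  intro ε hε
  by_contra hcon
  push Not at hcon
  -- uniform control at infinity
  obtain ⟨n, hn⟩ : ∃ n : ℕ, sphere (0 : E2) 1 ⊆
      {z | 1 < ‖z‖ ∨ -ε < (n : ℝ) - g ((n : ℝ) • z) + t - ⟪y, z⟫} := by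
    have hgc := hg.smooth.continuous
    refine (isCompact_sphere (0 : E2) 1).elim_directed_cover
      (fun n : ℕ => {z | 1 < ‖z‖ ∨ -ε < (n : ℝ) - g ((n : ℝ) • z) + t - ⟪y, z⟫}) ?_ ?_ ?_
    · intro n
      have hcn : Continuous fun z : E2 => (n : ℝ) - g ((n : ℝ) • z) + t - ⟪y, z⟫ := by fun_prop
      exact (isOpen_lt continuous_const continuous_norm).union
        (isOpen_lt continuous_const hcn)
    · intro z hz
      have h1 := hg.lim z hz
      have hz' : ‖z‖ = 1 := by simpa using hz
      have h2 := (h1.comp tendsto_natCast_atTop_atTop).eventually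
        (lt_mem_nhds (show φ z - ε < φ z by linarith))
      obtain ⟨n, hn⟩ := h2.exists
      simp only [Function.comp] at hn
      have := hy z hz'
      refine Set.mem_iUnion.2 ⟨n, Or.inr ?_⟩
      linarith
    · apply Monotone.directed_le
      rintro n m hnm z (hz | hz)
      · exact Or.inl hz
      · by_cases h1 : 1 < ‖z‖
        · exact Or.inl h1
        · right
          have := hg.mono' (not_lt.1 h1) (show (n : ℝ) ≤ m by exact_mod_cast hnm)
          simp only at this
          linarith
  have hinf : ∀ᶠ x' in cocompact E2, g x' - hyp c y t x' ≤ g x - hyp c y t x := by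
    filter_upwards [(tendsto_norm_cocompact_atTop (E := E2)).eventually_ge_atTop ((n : ℝ) + 1)]
      with x' hx'
    have hpos : 0 < ‖x'‖ := by have : (0 : ℝ) ≤ n := n.cast_nonneg
                               linarith
    obtain ⟨z, hz, hxz⟩ : ∃ z : E2, ‖z‖ = 1 ∧ x' = ‖x'‖ • z :=
      ⟨‖x'‖⁻¹ • x', by simp [norm_smul, hpos.ne'], by
        rw [smul_smul, mul_inv_cancel₀ hpos.ne', one_smul]⟩
    rcases hn (show z ∈ sphere (0 : E2) 1 by simpa using hz) with h1 | h1
    · linarith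
    have h2 := hg.mono hz (show (n : ℝ) ≤ ‖x'‖ by linarith)
    simp only [← hxz] at h2
    have h3 : t + (‖x'‖ - ⟪y, z⟫) ≤ hyp c y t x' := by
      unfold hyp
      have e : ⟪x' - y, z⟫ = ‖x'‖ - ⟪y, z⟫ := by
        rw [inner_sub_left]
        congr 1
        conv_lhs => rw [hxz, real_inner_smul_left, real_inner_self_eq_norm_sq, hz]
        ring
      have h4 := real_inner_le_norm (x' - y) z
      rw [e, hz, mul_one] at h4
      have h5 : ‖x' - y‖ ≤ √(c ^ 2 + ‖x' - y‖ ^ 2) :=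
        Real.le_sqrt_of_sq_le (by nlinarith [sq_nonneg c])
      linarith
    linarith
  obtain ⟨x0, hx0⟩ := hcont.exists_forall_ge' x hinf
  obtain ⟨h1, h2⟩ := KS.max_principle hg hH 1 x0 (by simpa using hx0)
  simp only [one_smul, one_pow, one_mul] at h1 h2
  rw [← h1] at h2
  have hlt := hg.grad x0
  have hp : 0 < (1 - ‖fderiv ℝ g x0‖ ^ 2) ^ 2 := by
    have : 0 < 1 - ‖fderiv ℝ g x0‖ ^ 2 := by nlinarith [norm_nonneg (fderiv ℝ g x0)]
    positivity
  nlinarith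

lemma KS.grad_norm (f : E2 → ℝ) (x : E2) : ‖gradient f x‖ = ‖fderiv ℝ f x‖ := by
  rw [← toDual_gradient, LinearIsometryEquiv.norm_map]

/-- Estimate at a contact point. -/
lemma KS.contact {κ c M μ : ℝ} {φ g : E2 → ℝ} (hg : KS κ φ g) (hc : 0 < c) (hck : 1 / c ^ 2 < κ)
    (hM : ∀ z ∈ sphere (0 : E2) 1, φ z ≤ M) (hμ : 1 < μ) (x0 : E2) (t : ℝ)
    (hy : ∀ z : E2, ‖z‖ = 1 → ⟪μ • x0, z⟫ - t ≤ φ z) :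
    g x0 - t ≤ (μ - 1) * (M + g 0) + c * √(1 - ‖fderiv ℝ g x0‖ ^ 2) := by
  have hlt := hg.grad x0
  set z := gradient g x0 with hz
  have hzn : ‖z‖ = ‖fderiv ℝ g x0‖ := KS.grad_norm g x0
  have hin : ∀ v, fderiv ℝ g x0 v = ⟪z, v⟫ := fun v => (inner_gradient_left).symm
  rw [← hzn] at hlt ⊢
  have hp : 0 < 1 - ‖z‖ ^ 2 := by nlinarith [norm_nonneg z]
  have hs : 0 < √(1 - ‖z‖ ^ 2) := Real.sqrt_pos.2 hp
  have hs2 : √(1 - ‖z‖ ^ 2) ^ 2 = 1 - ‖z‖ ^ 2 := Real.sq_sqrt hp.le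
  set s := √(1 - ‖z‖ ^ 2) with hsdef
  have hb := hg.barrier hc hck (μ • x0) hy (μ • x0 + (c / s) • z)
  have hsub := hg.sub x0 (μ • x0 + (c / s) • z)
  have e1 : √(c ^ 2 + ‖μ • x0 + (c / s) • z - μ • x0‖ ^ 2) = c / s := by
    rw [add_sub_cancel_left, norm_smul, Real.norm_of_nonneg (by positivity)]
    rw [show c ^ 2 + (c / s * ‖z‖) ^ 2 = (c / s) ^ 2 by
      field_simp; linarith]
    exact Real.sqrt_sq (by positivity)
  unfold hyp at hb
  rw [e1] at hb
  have e2 : ⟪z, μ • x0 + (c / s) • z - x0⟫ = (μ - 1) * ⟪z, x0⟫ + c / s * ‖z‖ ^ 2 := by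
    rw [inner_sub_right, inner_add_right, real_inner_smul_right, real_inner_smul_right,
      real_inner_self_eq_norm_sq]
    ring
  rw [hin, e2] at hsub
  have h0 := hg.sub x0 0
  rw [hin, zero_sub, inner_neg_right] at h0
  have hgr := hg.growth hM x0
  have e3 : c / s - c / s * ‖z‖ ^ 2 = c * s := by
    field_simp; linarith
  have h5 : -(M + g 0) ≤ ⟪z, x0⟫ := by linarith [norm_nonneg x0]
  nlinarith

/-- Comparison principle. -/
lemma KS.comparison {κg κf M : ℝ} {φg φf g f : E2 → ℝ} (hg : KS κg φg g) (hf : KS κf φf f)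
    (hκ : κf < κg) (hM : ∀ z ∈ sphere (0 : E2) 1, φg z ≤ M)
    (hle : ∀ z ∈ sphere (0 : E2) 1, φf z ≤ φg z) (x : E2) : g x ≤ f x := by
  have hκg := hg.pos
  have hκf := hf.pos
  obtain ⟨c, hc, hck⟩ : ∃ c : ℝ, 0 < c ∧ 1 / c ^ 2 < κg := by
    refine ⟨√(2 / κg), by positivity, ?_⟩
    rw [Real.sq_sqrt (by positivity), one_div_div]
    linarith
  have hsq : √κf < √κg := Real.sqrt_lt_sqrt hκf.le hκ
  have hfp : 0 < √κf := Real.sqrt_pos.2 hκf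
  set Q := √κf / (√κg - √κf) with hQ
  have hmain : ∀ μ : ℝ, 1 < μ →
      g x - f (μ • x) ≤ (μ - 1) * (M + g 0) + c * √(Q * (μ ^ 2 - 1)) := by
    intro μ hμ
    have hcont : Continuous fun x => g x - f (μ • x) :=
      hg.smooth.continuous.sub (hf.smooth.continuous.comp (continuous_const_smul μ))
    have hinf : ∀ᶠ x' in cocompact E2, g x' - f (μ • x') ≤ g x - f (μ • x) := by
      filter_upwards [(tendsto_norm_cocompact_atTop (E := E2)).eventually_ge_atTop
        ((g 0 + M - (g x - f (μ • x))) / (μ - 1))] with x' hx'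
      rw [div_le_iff₀ (by linarith)] at hx'
      have h1 := hg.lip x' 0
      have h2 := hf.growth (fun z hz => (hle z hz).trans (hM z hz)) (μ • x')
      rw [norm_smul, Real.norm_of_nonneg (by linarith)] at h2
      rw [sub_zero] at h1
      linarith
    obtain ⟨x0, hx0⟩ := hcont.exists_forall_ge' x hinf
    obtain ⟨h1, h2⟩ := KS.max_principle hg hf μ x0 hx0
    refine (hx0 x).trans ((hg.contact hc hck hM hμ x0 (f (μ • x0)) fun z hz =>
      (hf.dom (μ • x0) hz).trans (hle z (by simpa using hz))).trans ?_)
    gcongr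
    -- the gradient estimate
    have hn : ‖fderiv ℝ g x0‖ = μ * ‖fderiv ℝ f (μ • x0)‖ := by
      rw [h1, norm_smul, Real.norm_of_nonneg (by linarith)]
    have hlt := hg.grad x0
    set n := ‖fderiv ℝ g x0‖
    have hn0 : 0 ≤ n := norm_nonneg _
    have e : μ ^ 4 * (κf * (1 - ‖fderiv ℝ f (μ • x0)‖ ^ 2) ^ 2) = κf * (μ ^ 2 - n ^ 2) ^ 2 := by
      rw [hn]; ring
    rw [e] at h2
    have hm : 0 ≤ 1 - n ^ 2 := by nlinarith
    have h3 : √κg * (1 - n ^ 2) ≤ √κf * (μ ^ 2 - n ^ 2) := by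
      refine (abs_le_of_sq_le_sq' ?_ ?_).2
      · rw [mul_pow, mul_pow, Real.sq_sqrt hκg.le, Real.sq_sqrt hκf.le]; exact h2
      · refine mul_nonneg hfp.le ?_
        nlinarith
    rw [hQ, div_mul_eq_mul_div, le_div_iff₀ (by linarith)]
    nlinarith
  have l1 : Tendsto (fun μ : ℝ => g x - f (μ • x)) (𝓝[>] 1) (𝓝 (g x - f x)) := by
    have hfc := hf.smooth.continuous
    have : Continuous fun μ : ℝ => g x - f (μ • x) := by fun_prop
    have h := this.tendsto 1
    simp only [one_smul] at h
    exact h.mono_left nhdsWithin_le_nhds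
  have l2 : Tendsto (fun μ : ℝ => (μ - 1) * (M + g 0) + c * √(Q * (μ ^ 2 - 1))) (𝓝[>] 1)
      (𝓝 0) := by
    have : Continuous fun μ : ℝ => (μ - 1) * (M + g 0) + c * √(Q * (μ ^ 2 - 1)) := by fun_prop
    have h := this.tendsto 1
    simp only [sub_self, zero_mul, one_pow, mul_zero, Real.sqrt_zero, add_zero] at h
    exact h.mono_left nhdsWithin_le_nhds
  have := le_of_tendsto_of_tendsto l1 l2 (by
    filter_upwards [self_mem_nhdsWithin] with μ hμ using hmain μ hμ)
  linarith

/-- Strict comparison. -/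
lemma KS.strict {κg κf M : ℝ} {φ g f : E2 → ℝ} (hg : KS κg φ g) (hf : KS κf φ f)
    (hκ : κf < κg) (hM : ∀ z ∈ sphere (0 : E2) 1, φ z ≤ M) (x : E2) : g x < f x := by
  have hle := hg.comparison hf hκ hM (fun _ _ => le_rfl)
  refine lt_of_le_of_ne (hle x) fun heq => ?_
  obtain ⟨h1, h2⟩ := KS.max_principle hg hf 1 x (by
    intro x'; simp only [one_smul]; have := hle x'; linarith)
  simp only [one_smul, one_pow, one_mul] at h1 h2
  rw [← h1] at h2
  have hlt := hg.grad x
  have hp : 0 < (1 - ‖fderiv ℝ g x‖ ^ 2) ^ 2 := by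
    have : 0 < 1 - ‖fderiv ℝ g x‖ ^ 2 := by nlinarith [norm_nonneg (fderiv ℝ g x)]
    positivity
  nlinarith

/-- Homothety and vertical translation. -/
lemma KS.scale {κ l : ℝ} {φ f : E2 → ℝ} (hf : KS κ φ f) (hl : 0 < l) (δ : ℝ) :
    KS (κ / l ^ 2) (fun z => l * φ z - δ) (fun x => l * f (l⁻¹ • x) + δ) := by
  have hfd : ∀ x, HasFDerivAt (fun x => l * f (l⁻¹ • x) + δ) (fderiv ℝ f (l⁻¹ • x)) x := by
    intro x
    have h1 : HasFDerivAt (fun x : E2 => l⁻¹ • x) (l⁻¹ • ContinuousLinearMap.id ℝ E2) x :=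
      (hasFDerivAt_id x).const_smul l⁻¹
    have h2 := (((hf.smooth.differentiable (by norm_num)) (l⁻¹ • x)).hasFDerivAt.comp x h1)
    have h3 := (h2.const_mul l).add_const δ
    refine HasFDerivAt.congr_fderiv h3 ?_
    ext v
    simp
    field_simp
  have hfd' : fderiv ℝ (fun x => l * f (l⁻¹ • x) + δ) = fun x => fderiv ℝ f (l⁻¹ • x) :=
    funext fun x => (hfd x).fderiv
  have hh : ∀ x v w, hess (fun x => l * f (l⁻¹ • x) + δ) x v w = l⁻¹ * hess f (l⁻¹ • x) v w := by
    intro x v w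
    unfold hess
    rw [hfd']
    have h1 : HasFDerivAt (fun x : E2 => l⁻¹ • x) (l⁻¹ • ContinuousLinearMap.id ℝ E2) x :=
      (hasFDerivAt_id x).const_smul l⁻¹
    have hd : Differentiable ℝ (fderiv ℝ f) :=
      (hf.smooth.fderiv_right (m := 1) (by norm_num)).differentiable (by norm_num)
    have h2 := ((hd (l⁻¹ • x)).hasFDerivAt.comp x h1).fderiv
    simp only [Function.comp_def] at h2
    rw [h2]
    simp
  refine ⟨div_pos hf.pos (by positivity), ?_, ?_, ?_, ?_, ?_⟩
  · have := hf.smooth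
    fun_prop
  · intro x y
    rw [hfd']
    have h := hf.sub (l⁻¹ • x) (l⁻¹ • y)
    rw [← smul_sub, map_smul, smul_eq_mul] at h
    have h' := mul_le_mul_of_nonneg_left h hl.le
    rw [mul_add, mul_inv_cancel_left₀ hl.ne'] at h'
    simp only
    linarith
  · intro x
    rw [hfd']; exact hf.grad _
  · intro x
    have h := hf.det (l⁻¹ • x)
    unfold detHess at h ⊢
    simp only [hh, hfd']
    rw [show κ / l ^ 2 * (1 - ‖fderiv ℝ f (l⁻¹ • x)‖ ^ 2) ^ 2 =
      (l⁻¹) ^ 2 * (κ * (1 - ‖fderiv ℝ f (l⁻¹ • x)‖ ^ 2) ^ 2) by field_simp, ← h]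
    ring
  · intro z hz
    have h1 : Tendsto (fun r : ℝ => l⁻¹ * r) atTop atTop :=
      tendsto_id.const_mul_atTop (inv_pos.2 hl)
    have h2 := (((hf.lim z hz).comp h1).const_mul l).sub_const δ
    refine h2.congr fun r => ?_
    simp only [Function.comp, smul_smul]
    field_simp
    ring

lemma convex_sub {f : E2 → ℝ} (hf : ContDiff ℝ 2 f) (hc : ConvexOn ℝ Set.univ f) (x y : E2) :
    f x + fderiv ℝ f x (y - x) ≤ f y := by
  have h1 := line_deriv hf x (y - x) 0
  simp only [zero_smul, add_zero] at h1
  have h2 := h1.tendsto_slope_zero_right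
  have h3 : fderiv ℝ f x (y - x) ≤ f y - f x := by
    refine le_of_tendsto h2 ?_
    filter_upwards [Ioo_mem_nhdsGT (show (0 : ℝ) < 1 by norm_num)] with s hs
    have h4 := hc.2 (Set.mem_univ x) (Set.mem_univ y) (show 0 ≤ 1 - s by linarith [hs.2]) hs.1.le
      (by ring)
    have e : (1 - s) • x + s • y = x + s • (y - x) := by module
    rw [e] at h4
    simp only [smul_eq_mul, zero_add, zero_smul, add_zero] at h4 ⊢
    rw [inv_mul_le_iff₀ hs.1]
    linarith
  linarith

/-- **Theorem 1.4 (foliation by constant curvature surfaces).**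
Let `φ : ∂𝔻 → ℝ` be bounded and lower semicontinuous, and for each `K < 0` let `F K` be the
smooth convex function whose graph is the spacelike entire graph of constant curvature `K`
with support function at infinity `φ`. Then every point `(y, t)` of the interior of the
domain of dependence determined by `φ` lies on exactly one of these graphs. -/
theorem foliation_constant_curvature
    (φ : E2 → ℝ)
    (hφb : ∃ M : ℝ, ∀ z ∈ sphere (0 : E2) 1, |φ z| ≤ M)
    (hφl : LowerSemicontinuousOn φ (sphere (0 : E2) 1))
    (F : ℝ → E2 → ℝ)
    (hF : ∀ K : ℝ, K < 0 →
      ContDiff ℝ (⊤ : ℕ∞) (F K) ∧ ConvexOn ℝ Set.univ (F K) ∧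
      (∀ p : E2, ‖gradient (F K) p‖ < 1) ∧
      (∀ p : E2, detHess (F K) p = |K| * (1 - ‖gradient (F K) p‖ ^ 2) ^ 2) ∧
      (∀ z ∈ sphere (0 : E2) 1,
        Tendsto (fun r : ℝ => r - F K (r • z)) atTop (𝓝 (φ z))))
    (y : E2) (t : ℝ)
    (hyt : ∀ z ∈ sphere (0 : E2) 1, ⟪y, z⟫ - t < φ z) :
    ∃! K : ℝ, K < 0 ∧ t = F K y := by
  obtain ⟨M, hM⟩ := hφb
  have hMu : ∀ z ∈ sphere (0 : E2) 1, φ z ≤ M := fun z hz => (abs_le.1 (hM z hz)).2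
  have hMl : ∀ z ∈ sphere (0 : E2) 1, -M ≤ φ z := fun z hz => (abs_le.1 (hM z hz)).1
  have hKS : ∀ K : ℝ, K < 0 → KS (-K) φ (F K) := by
    intro K hK
    obtain ⟨h1, h2, h3, h4, h5⟩ := hF K hK
    have h1' : ContDiff ℝ 2 (F K) := contDiff_infty.1 h1 2
    refine ⟨by linarith, h1', convex_sub h1' h2, ?_, ?_, h5⟩
    · intro x; rw [← KS.grad_norm]; exact h3 x
    · intro x; rw [h4, KS.grad_norm, abs_of_neg hK]
  have hstrict : ∀ K L : ℝ, K < L → L < 0 → F K y < F L y := fun K L h hL =>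
    (hKS K (h.trans hL)).strict (hKS L hL) (by linarith) hMu y
  -- reparametrisation
  set G : ℝ → ℝ := fun s => F (-(1 / s ^ 2)) y with hG
  have hneg : ∀ s : ℝ, 0 < s → -(1 / s ^ 2) < 0 := fun s hs => by
    have : 0 < 1 / s ^ 2 := by positivity
    linarith
  have hKS' : ∀ s : ℝ, 0 < s → KS (1 / s ^ 2) φ (F (-(1 / s ^ 2))) := fun s hs => by
    simpa using hKS _ (hneg s hs)
  have hGmono : ∀ s s' : ℝ, 0 < s → s ≤ s' → G s ≤ G s' := by
    intro s s' hs hss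
    rcases hss.eq_or_lt with rfl | hlt
    · exact le_rfl
    · refine (hstrict _ _ ?_ (hneg _ (hs.trans hlt))).le
      have : 1 / s' ^ 2 < 1 / s ^ 2 := by
        apply one_div_lt_one_div_of_lt (by positivity)
        gcongr
      linarith
  set B := ‖y‖ + M with hB
  -- quantitative continuity
  have hGup : ∀ s s' : ℝ, 0 < s → s < s' → G s' ≤ (s' / s) * (G s + B) - B := by
    intro s s' hs hss
    have hl1 : ∀ l : ℝ, s' / s < l → G s' ≤ l * (G s + B) - B := by
      intro l hl
      have h1l : 1 < l := lt_trans ((one_lt_div hs).2 hss) hl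
      have hl0 : 0 < l := by linarith
      have hs' : 0 < s' := hs.trans hss
      have hsc := (hKS' s hs).scale hl0 ((l - 1) * M)
      have hcmp := (hKS' s' hs').comparison hsc (by
        rw [div_div]
        apply one_div_lt_one_div_of_lt (by positivity)
        rw [← mul_pow]
        rw [div_lt_iff₀ hs] at hl
        rw [mul_comm s l]
        gcongr) hMu (by
        intro z hz
        have := hMu z hz
        nlinarith) y
      have hlip := (hKS' s hs).lip (l⁻¹ • y) y
      have e : ‖l⁻¹ • y - y‖ = (1 - l⁻¹) * ‖y‖ := by
        rw [show l⁻¹ • y - y = -((1 - l⁻¹) • y) by module, norm_neg, norm_smul,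
          Real.norm_of_nonneg (sub_nonneg.2 (inv_le_one_of_one_le₀ h1l.le))]
      rw [e] at hlip
      have h2 := mul_le_mul_of_nonneg_left hlip hl0.le
      have e2 : l * (F (-(1 / s ^ 2)) y + (1 - l⁻¹) * ‖y‖) =
          l * F (-(1 / s ^ 2)) y + (l - 1) * ‖y‖ := by
        field_simp
      rw [e2] at h2
      simp only [hG, hB]
      linarith
    have hc : Continuous fun l : ℝ => l * (G s + B) - B := by fun_prop
    refine ge_of_tendsto ((hc.tendsto (s' / s)).mono_left (nhdsWithin_le_nhds (s := Set.Ioi (s' / s)))) ?_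
    filter_upwards [self_mem_nhdsWithin] with l hl using hl1 l hl
  have hGcont : ContinuousOn G (Set.Ioi 0) := by
    intro s0 hs0
    have hs0 : 0 < s0 := hs0
    apply ContinuousAt.continuousWithinAt
    have hL : Tendsto (fun s : ℝ => (s / s0) * (G s0 + B) - B) (𝓝 s0) (𝓝 (G s0)) := by
      have hc : Continuous fun s : ℝ => (s / s0) * (G s0 + B) - B := by fun_prop
      have := hc.tendsto s0
      rwa [div_self hs0.ne', one_mul, add_sub_cancel_right] at this
    have hmin := hL.min (tendsto_const_nhds (x := G s0))
    have hmax := hL.max (tendsto_const_nhds (x := G s0))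
    rw [min_self] at hmin
    rw [max_self] at hmax
    refine tendsto_of_tendsto_of_tendsto_of_le_of_le' hmin hmax ?_ ?_
    · filter_upwards [lt_mem_nhds hs0] with s hs
      rcases le_or_gt s0 s with h | h
      · exact (min_le_right _ _).trans (hGmono _ _ hs0 h)
      · refine (min_le_left _ _).trans ?_
        have h1 := hGup s s0 hs h
        have h2 : s / s0 * (G s0 + B) ≤ s / s0 * (s0 / s * (G s + B)) :=
          mul_le_mul_of_nonneg_left (by linarith) (by positivity)
        have h3 : s / s0 * (s0 / s * (G s + B)) = G s + B := by
          field_simp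
        linarith
    · filter_upwards [lt_mem_nhds hs0] with s hs
      rcases lt_or_ge s0 s with h | h
      · exact (hGup s0 s hs0 h).trans (le_max_left _ _)
      · exact (hGmono _ _ hs h).trans (le_max_right _ _)
  -- small values
  obtain ⟨a, ha, hGa⟩ : ∃ a : ℝ, 0 < a ∧ G a ≤ t := by
    obtain ⟨t0, ht0, hdom⟩ : ∃ t0 < t, ∀ z : E2, ‖z‖ = 1 → ⟪y, z⟫ - t0 ≤ φ z := by
      have hne : (sphere (0 : E2) 1).Nonempty := ⟨EuclideanSpace.single 0 1, by simp⟩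
      have hcl : LowerSemicontinuousOn (fun z : E2 => φ z + -⟪y, z⟫) (sphere (0 : E2) 1) :=
        have hcn : Continuous fun z : E2 => -⟪y, z⟫ := by fun_prop
        hφl.add (hcn.lowerSemicontinuous.lowerSemicontinuousOn _)
      obtain ⟨z0, hz0, hmin⟩ := hcl.exists_isMinOn hne (isCompact_sphere (0 : E2) 1)
      refine ⟨-(φ z0 + -⟪y, z0⟫), by linarith [hyt z0 hz0], fun z hz => ?_⟩
      have := hmin (show z ∈ sphere (0 : E2) 1 by simpa using hz)
      simp only [Set.mem_ofPred_eq] at this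
      linarith
    have hd : 0 < t - t0 := by linarith
    refine ⟨(t - t0) / 2, by positivity, ?_⟩
    have h := (hKS' ((t - t0) / 2) (by positivity)).barrier hd (by
      apply one_div_lt_one_div_of_lt (by positivity)
      gcongr
      linarith) y hdom y
    simp only [hyp, sub_self, norm_zero] at h
    rw [show (t - t0) ^ 2 + (0 : ℝ) ^ 2 = (t - t0) ^ 2 by ring, Real.sqrt_sq hd.le] at h
    simp only [hG]
    linarith
  -- large values
  obtain ⟨b, hb, hGb⟩ : ∃ b : ℝ, 0 < b ∧ t ≤ G b := by
    have hp : 0 < |t + M| + 1 := by positivity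
    refine ⟨|t + M| + 1 + 1, by positivity, ?_⟩
    have h := (hyp_KS hp (0 : E2) (-M)).comparison (M := M) (hKS' (|t + M| + 1 + 1) (by positivity))
      (by
        apply one_div_lt_one_div_of_lt (by positivity)
        gcongr
        linarith) (by intro z _; simp) (by intro z hz; simpa using hMu z hz) y
    have h2 : |t + M| + 1 ≤ √((|t + M| + 1) ^ 2 + ‖y - 0‖ ^ 2) :=
      Real.le_sqrt_of_sq_le (by nlinarith [sq_nonneg ‖y - 0‖])
    unfold hyp at h
    simp only [hG]
    linarith [le_abs_self (t + M)]
  have hex : ∃ s : ℝ, 0 < s ∧ G s = t := by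
    have hsub : Set.uIcc a b ⊆ Set.Ioi 0 := by
      intro s hs
      exact lt_of_lt_of_le (lt_min ha hb) hs.1
    obtain ⟨s, hs, hst⟩ := intermediate_value_uIcc (hGcont.mono hsub)
      (show t ∈ Set.uIcc (G a) (G b) from ⟨(min_le_left _ _).trans hGa, hGb.trans (le_max_right _ _)⟩)
    exact ⟨s, hsub hs, hst⟩
  obtain ⟨s, hs, hst⟩ := hex
  refine ⟨-(1 / s ^ 2), ⟨hneg s hs, hst.symm⟩, ?_⟩
  rintro K ⟨hK, hKt⟩
  have hst' : F (-(1 / s ^ 2)) y = t := hst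
  rcases lt_trichotomy K (-(1 / s ^ 2)) with h | h | h
  · have := hstrict _ _ h (hneg s hs)
    linarith
  · exact h
  · have := hstrict _ _ h hK
    linarith
end
end

section
/- Let φ : ∂𝔻 → ℝ be bounded and lower semicontinuous and let ψ : 𝔻 → ℝ be smooth with a ≤ ψ(z) ≤ b for all z ∈ 𝔻, where 0 < a ≤ b < +∞. If u₁, u₂ : 𝔻 → ℝ are smooth convex functions with det D²uᵢ(z) = (1/ψ(z))·(1−|z|²)⁻² for every z ∈ 𝔻 and liminf_{w→z, w∈𝔻} uᵢ(w) = φ(z) for every z ∈ ∂𝔻 (i = 1, 2), then u₁ = u₂ on 𝔻. -/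
open Metric Filter
open scoped RealInnerProductSpace Topology

noncomputable section

/-- `f` is differentiable near `p` and its derivative has derivative `A` at `p`. -/
def HasHess (f : E2 → ℝ) (p : E2) (A : E2 →L[ℝ] E2 →L[ℝ] ℝ) : Prop :=
  ∃ f' : E2 → E2 →L[ℝ] ℝ, (∀ᶠ z in 𝓝 p, HasFDerivAt f (f' z) z) ∧ HasFDerivAt f' A p

lemma HasHess.fderiv_eq {f : E2 → ℝ} {p : E2} {A : E2 →L[ℝ] E2 →L[ℝ] ℝ} (h : HasHess f p A) :
    fderiv ℝ (fderiv ℝ f) p = A := by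
  obtain ⟨f', h1, h2⟩ := h
  have : fderiv ℝ f =ᶠ[𝓝 p] f' := h1.mono fun z hz => hz.fderiv
  rw [this.fderiv_eq, h2.fderiv]

lemma HasHess.hess_eq {f : E2 → ℝ} {p : E2} {A : E2 →L[ℝ] E2 →L[ℝ] ℝ} (h : HasHess f p A)
    (x y : E2) : hess f p x y = A x y := by
  rw [hess, h.fderiv_eq]

lemma HasHess.add {f g : E2 → ℝ} {p : E2} {A B : E2 →L[ℝ] E2 →L[ℝ] ℝ}
    (hf : HasHess f p A) (hg : HasHess g p B) : HasHess (fun z => f z + g z) p (A + B) := by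
  obtain ⟨f', h1, h2⟩ := hf
  obtain ⟨g', h3, h4⟩ := hg
  exact ⟨fun z => f' z + g' z, by filter_upwards [h1, h3] with z a b using a.add b, h2.add h4⟩

lemma HasHess.sub {f g : E2 → ℝ} {p : E2} {A B : E2 →L[ℝ] E2 →L[ℝ] ℝ}
    (hf : HasHess f p A) (hg : HasHess g p B) : HasHess (fun z => f z - g z) p (A - B) := by
  obtain ⟨f', h1, h2⟩ := hf
  obtain ⟨g', h3, h4⟩ := hg
  exact ⟨fun z => f' z - g' z, by filter_upwards [h1, h3] with z a b using a.sub b, h2.sub h4⟩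

lemma hasHess_of_contDiffAt {f : E2 → ℝ} {p : E2} (hf : ContDiffAt ℝ 2 f p) :
    HasHess f p (fderiv ℝ (fderiv ℝ f) p) := by
  refine ⟨fderiv ℝ f, ?_, ?_⟩
  · have := hf.eventually (by simp)
    filter_upwards [this] with z hz
    exact (hz.differentiableAt (by simp)).hasFDerivAt
  · have : ContDiffAt ℝ 1 (fderiv ℝ f) p := hf.fderiv_right (by norm_num)
    exact (this.differentiableAt (by simp)).hasFDerivAt

lemma HasHess.affine_add {f : E2 → ℝ} {p : E2} {A : E2 →L[ℝ] E2 →L[ℝ] ℝ}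
    (hf : HasHess f p A) (L : E2 →L[ℝ] ℝ) (k : ℝ) : HasHess (fun z => L z + k + f z) p A := by
  obtain ⟨f', h1, h2⟩ := hf
  exact ⟨fun z => L + f' z, h1.mono fun z hz => (L.hasFDerivAt.add_const k).add hz,
    h2.const_add L⟩

lemma hasHess_sq (ε : ℝ) (p : E2) :
    HasHess (fun z => ε * (‖z‖ ^ 2 - 1)) p ((2 * ε) • innerSL ℝ) := by
  refine ⟨fun z => (2 * ε) • innerSL ℝ z, Eventually.of_forall fun z => ?_, ?_⟩
  · have := (((hasStrictFDerivAt_norm_sq z).hasFDerivAt).sub_const 1).const_mul ε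
    refine this.congr_fderiv ?_
    ext x
    simp
    ring
  · exact ((innerSL ℝ).hasFDerivAt (x := p)).const_smul (2 * ε)

lemma HasHess.nonneg_of_isLocalMin {f : E2 → ℝ} {p : E2} {A : E2 →L[ℝ] E2 →L[ℝ] ℝ}
    (h : HasHess f p A) (hm : IsLocalMin f p) (x : E2) : 0 ≤ A x x := by
  obtain ⟨f', h1, h2⟩ := h
  by_contra! hneg
  set c : ℝ → E2 := fun t => p + t • x with hc
  have hcd : ∀ t, HasDerivAt c x t := fun t => by
    simpa [hc] using ((hasDerivAt_id t).smul_const x).const_add p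
  have hc0 : c 0 = p := by simp [hc]
  have hct : Tendsto c (𝓝 0) (𝓝 p) := by
    have := (hcd 0).continuousAt.tendsto
    rwa [hc0] at this
  have hd : ∀ᶠ t in 𝓝 (0 : ℝ), HasDerivAt (fun t => f (c t)) (f' (c t) x) t := by
    filter_upwards [hct.eventually h1] with t ht
    exact ht.comp_hasDerivAt t (hcd t)
  have hdd : HasDerivAt (fun t => f' (c t) x) (A x x) 0 := by
    have h3 : HasFDerivAt f' A (c 0) := by rwa [hc0]
    have := h3.comp_hasDerivAt 0 (hcd 0)
    simpa using this.clm_apply (hasDerivAt_const (0 : ℝ) x)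
  have hde : deriv (fun t => f (c t)) =ᶠ[𝓝 0] fun t => f' (c t) x :=
    hd.mono fun t ht => ht.deriv
  have hdd2 : deriv (deriv (fun t => f (c t))) 0 = A x x := by
    rw [hde.deriv_eq, hdd.deriv]
  have hmin : IsLocalMin (fun t => f (c t)) 0 := by
    have := hct.eventually hm
    simpa [IsLocalMin, IsMinFilter, hc0] using this
  have hmax : IsLocalMax (fun t => f (c t)) 0 :=
    isLocalMax_of_deriv_deriv_neg (by rw [hdd2]; exact hneg) hmin.deriv_eq_zero
      hd.self_of_nhds.continuousAt
  have hconst : (fun t => f (c t)) =ᶠ[𝓝 0] fun _ => f (c 0) := by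
    filter_upwards [hmin, hmax] with t a b using le_antisymm b a
  have : deriv (deriv (fun t => f (c t))) 0 = 0 := by
    rw [hconst.deriv.deriv_eq]; simp
  rw [hdd2] at this
  linarith

lemma tangent_le {u : E2 → ℝ} {B : Set E2} (hc : ConvexOn ℝ B u) {p z : E2}
    (hp : p ∈ B) (hz : z ∈ B) {L : E2 →L[ℝ] ℝ} (hL : HasFDerivAt u L p) :
    u p + L (z - p) ≤ u z := by
  have hd : HasDerivAt (fun t : ℝ => u (p + t • (z - p))) (L (z - p)) 0 := by
    have h1 : HasDerivAt (fun t : ℝ => p + t • (z - p)) (z - p) 0 := by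
      simpa using ((hasDerivAt_id (0 : ℝ)).smul_const (z - p)).const_add p
    have h2 : HasFDerivAt u L (p + (0 : ℝ) • (z - p)) := by simpa using hL
    exact h2.comp_hasDerivAt (0 : ℝ) h1
  have hs := hd.tendsto_slope_zero_right
  have : L (z - p) ≤ u z - u p := by
    refine le_of_tendsto hs ?_
    filter_upwards [Ioo_mem_nhdsGT (show (0 : ℝ) < 1 by norm_num)] with t ht
    have := hc.2 hp hz (show 0 ≤ 1 - t by linarith [ht.2]) ht.1.le (by ring)
    have e : (1 - t) • p + t • z = p + t • (z - p) := by module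
    rw [e] at this
    simp only [smul_eq_mul] at this
    simp only [zero_add, zero_smul, add_zero, smul_eq_mul]
    rw [inv_mul_le_iff₀ ht.1]
    nlinarith
  linarith

lemma det_lemma {u11 u22 u12 w11 w22 w12 ε : ℝ} (hε : 0 < ε)
    (hw : ∀ s t : ℝ, 0 ≤ w11 * s ^ 2 + 2 * w12 * s * t + w22 * t ^ 2)
    (hc : ∀ s t : ℝ, 0 ≤ (u11 - w11 - ε) * s ^ 2 + 2 * (u12 - w12) * s * t
      + (u22 - w22 - ε) * t ^ 2) : w11 * w22 - w12 ^ 2 < u11 * u22 - u12 ^ 2 := by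
  have key : ∀ a b c : ℝ, (∀ s t : ℝ, 0 ≤ a * s ^ 2 + 2 * b * s * t + c * t ^ 2) →
      0 ≤ a ∧ 0 ≤ c ∧ b ^ 2 ≤ a * c := by
    intro a b c h
    refine ⟨by simpa using h 1 0, by simpa using h 0 1, ?_⟩
    have := discrim_le_zero (a := a) (b := 2 * b) (c := c) (fun x => by nlinarith [h x 1])
    simp only [discrim] at this
    nlinarith
  obtain ⟨a1, a2, a3⟩ := key _ _ _ hw
  obtain ⟨b1, b2, b3⟩ := key _ _ _ hc
  set x := u11 - w11 - ε
  set y := u22 - w22 - ε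
  set o := u12 - w12
  have e1 : u11 = w11 + ε + x := by simp [x]
  have e2 : u22 = w22 + ε + y := by simp [y]
  have e3 : u12 = w12 + o := by simp [o]
  have hm : 2 * (w12 * o) ≤ w11 * y + w22 * x := by
    have h1 : (w12 * o) ^ 2 ≤ (w11 * y) * (w22 * x) := by
      calc (w12 * o) ^ 2 = w12 ^ 2 * o ^ 2 := by ring
        _ ≤ (w11 * w22) * (x * y) := by gcongr
        _ = _ := by ring
    have p1 : 0 ≤ w11 * y := by positivity
    have p2 : 0 ≤ w22 * x := by positivity
    refine (le_abs_self _).trans (abs_le_of_sq_le_sq ?_ (by positivity))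
    nlinarith [sq_nonneg (w11 * y - w22 * x)]
  rw [e1, e2, e3]
  nlinarith [mul_nonneg hε.le a1, mul_nonneg hε.le a2, mul_nonneg hε.le b1,
    mul_nonneg hε.le b2, mul_pos hε hε]

lemma vec_eq (s t : ℝ) : (s • EuclideanSpace.single 0 1 + t • EuclideanSpace.single 1 1 : E2)
    = !₂[s, t] := by
  ext i; fin_cases i <;> simp

/-- Comparison principle. -/
lemma comparison {Ω : Set E2} (hΩ : IsOpen Ω) (hsub : Ω ⊆ ball 0 1) {u w : E2 → ℝ}
    (hu : ContDiffOn ℝ 2 u Ω) (hw : ContDiffOn ℝ 2 w Ω)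
    (hwpos : ∀ p ∈ Ω, ∀ x, 0 ≤ hess w p x x)
    (hdet : ∀ p ∈ Ω, detHess u p ≤ detHess w p)
    (hbd : ∀ z ∈ closure Ω, z ∉ Ω → ∀ ε > 0, ∀ᶠ x in 𝓝[Ω] z, w x - ε < u x) :
    ∀ z ∈ Ω, w z ≤ u z := by
  intro p hp
  by_contra! hlt
  set ε := (w p - u p) / 2 with hε
  have hεpos : 0 < ε := by rw [hε]; linarith
  have hn : ∀ z ∈ Ω, ‖z‖ < 1 := fun z hz => by simpa using hsub hz
  set f : E2 → ℝ := fun z => u z - w z - ε * (‖z‖ ^ 2 - 1) with hf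
  have hfc : ContinuousOn f Ω :=
    (hu.continuousOn.sub hw.continuousOn).sub (by fun_prop)
  set K := {z ∈ Ω | f z ≤ -ε} with hK
  have hpK : p ∈ K := by
    refine ⟨hp, ?_⟩
    simp only [hf]
    nlinarith [sq_nonneg ‖p‖]
  have hKcl : IsClosed K := by
    refine isClosed_of_closure_subset fun z hz => ?_
    have hfr : ∃ᶠ x in 𝓝 z, x ∈ K := mem_closure_iff_frequently.1 hz
    have hzc : z ∈ closure Ω := closure_mono (fun x hx => hx.1) hz
    by_cases hzΩ : z ∈ Ω
    · refine ⟨hzΩ, ?_⟩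
      by_contra! hgt
      have := (hfc.continuousAt (hΩ.mem_nhds hzΩ)).eventually (lt_mem_nhds hgt)
      obtain ⟨x, hx, hx2⟩ := (hfr.and_eventually this).exists
      exact absurd hx.2 (not_le.2 hx2)
    · exfalso
      have := hbd z hzc hzΩ (ε / 2) (by linarith)
      rw [eventually_nhdsWithin_iff] at this
      obtain ⟨x, hx, hx2⟩ := (hfr.and_eventually this).exists
      have h1 := hx2 hx.1
      have h2 := hx.2
      have h3 := hn x hx.1
      simp only [hf] at h2
      have h4 : 0 ≤ ε * (1 - ‖x‖ ^ 2) :=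
        mul_nonneg hεpos.le (by nlinarith [norm_nonneg x])
      linarith
  have hKcomp : IsCompact K := by
    refine (isCompact_closedBall (0 : E2) 1).of_isClosed_subset hKcl fun z hz => ?_
    simpa using (hn z hz.1).le
  obtain ⟨q, hq, hmin⟩ := hKcomp.exists_isMinOn ⟨p, hpK⟩ (hfc.mono fun x hx => hx.1)
  have hloc : IsLocalMin f q := by
    filter_upwards [hΩ.mem_nhds hq.1] with x hx
    by_cases hxK : f x ≤ -ε
    · exact hmin ⟨hx, hxK⟩
    · exact hq.2.trans (not_le.1 hxK).le
  have huq := hu.contDiffAt (hΩ.mem_nhds hq.1)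
  have hwq := hw.contDiffAt (hΩ.mem_nhds hq.1)
  have hH := ((hasHess_of_contDiffAt huq).sub (hasHess_of_contDiffAt hwq)).sub (hasHess_sq ε q)
  have hpos := hH.nonneg_of_isLocalMin hloc
  have hsu : ∀ x y, hess u q x y = hess u q y x := fun x y =>
    (huq.isSymmSndFDerivAt (by simp)) x y
  have hsw : ∀ x y, hess w q x y = hess w q y x := fun x y =>
    (hwq.isSymmSndFDerivAt (by simp)) x y
  have hd := hdet q hq.1
  set e0 : E2 := EuclideanSpace.single 0 1 with he0
  set e1 : E2 := EuclideanSpace.single 1 1 with he1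
  have hexp : ∀ (g : E2 → ℝ) (s t : ℝ), hess g q (s • e0 + t • e1) (s • e0 + t • e1) =
      hess g q e0 e0 * s ^ 2 + (hess g q e0 e1 + hess g q e1 e0) * s * t
        + hess g q e1 e1 * t ^ 2 := by
    intro g s t
    simp only [hess, map_add, map_smul, add_apply,
      smul_apply, smul_eq_mul]
    ring
  have hnorm : ∀ s t : ℝ, inner ℝ (s • e0 + t • e1) (s • e0 + t • e1) = s ^ 2 + t ^ 2 := by
    intro s t
    rw [real_inner_self_eq_norm_sq, he0, he1, vec_eq, EuclideanSpace.norm_sq_eq]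
    simp
  have := det_lemma (u11 := hess u q e0 e0) (u22 := hess u q e1 e1) (u12 := hess u q e0 e1)
    (w11 := hess w q e0 e0) (w22 := hess w q e1 e1) (w12 := hess w q e0 e1)
    (ε := 2 * ε) (by linarith)
    (fun s t => by
      have := hwpos q hq.1 (s • e0 + t • e1)
      rw [hexp, hsw e1 e0] at this
      linarith)
    (fun s t => by
      have := hpos (s • e0 + t • e1)
      have h2 : 0 ≤ hess u q (s • e0 + t • e1) (s • e0 + t • e1)
        - hess w q (s • e0 + t • e1) (s • e0 + t • e1)
        - 2 * ε * inner ℝ (s • e0 + t • e1) (s • e0 + t • e1) := this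
      rw [hnorm, hexp, hexp, hsw e1 e0, hsu e1 e0] at h2
      linarith)
  simp only [detHess] at hd
  rw [← he0, ← he1, hsw e1 e0, hsu e1 e0] at hd
  linarith

/-- The radial barrier. -/
def vbar (k : ℝ) (z : E2) : ℝ := -(k * √(1 - ‖z‖ ^ 2))

lemma hasHess_vbar (k : ℝ) {p : E2} (hp : ‖p‖ < 1) :
    ∃ A, HasHess (vbar k) p A ∧ ∀ x y, A x y =
      k * ((√(1 - ‖p‖ ^ 2))⁻¹ ^ 3 * (inner ℝ p x * inner ℝ p y)
        + (√(1 - ‖p‖ ^ 2))⁻¹ * inner ℝ x y) := by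
  have hpos : ∀ z : E2, ‖z‖ < 1 → 0 < 1 - ‖z‖ ^ 2 := fun z hz => by
    nlinarith [norm_nonneg z]
  have hsq : ∀ z : E2, ‖z‖ < 1 →
      HasFDerivAt (fun z : E2 => √(1 - ‖z‖ ^ 2)) (-(√(1 - ‖z‖ ^ 2))⁻¹ • innerSL ℝ z) z := by
    intro z hz
    have h1 := ((hasStrictFDerivAt_norm_sq z).hasFDerivAt).const_sub 1
    have h2 := h1.sqrt (hpos z hz).ne'
    refine h2.congr_fderiv ?_
    ext x
    simp
    field_simp
  have hinv : HasFDerivAt (fun z : E2 => k * (√(1 - ‖z‖ ^ 2))⁻¹)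
      ((k * (√(1 - ‖p‖ ^ 2))⁻¹ ^ 3) • innerSL ℝ p) p := by
    have h0 := (Real.sqrt_pos.2 (hpos p hp)).ne'
    have := ((hasDerivAt_inv h0).comp_hasFDerivAt p (hsq p hp)).const_mul k
    refine this.congr_fderiv ?_
    ext x
    simp
    field_simp
  refine ⟨_, ⟨fun z => (k * (√(1 - ‖z‖ ^ 2))⁻¹) • innerSL ℝ z, ?_,
    hinv.smul ((innerSL ℝ).hasFDerivAt (x := p))⟩, ?_⟩
  · have : ∀ᶠ z : E2 in 𝓝 p, ‖z‖ < 1 := continuous_norm.continuousAt.eventually (gt_mem_nhds hp)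
    filter_upwards [this] with z hz
    refine ((hsq z hz).const_mul k).neg.congr_fderiv ?_
    ext x
    simp
    ring
  · intro x y
    simp only [add_apply, smul_apply, ContinuousLinearMap.smulRight_apply, smul_eq_mul,
      innerSL_apply_apply]
    change (k * (√(1 - ‖p‖ ^ 2))⁻¹) * inner ℝ x y
      + (k * (√(1 - ‖p‖ ^ 2))⁻¹ ^ 3 * inner ℝ p x) * inner ℝ p y = _
    ring

lemma contDiffOn_vbar (k : ℝ) : ContDiffOn ℝ 2 (vbar k) (ball 0 1) := by
  have : ContDiffOn ℝ 2 (fun z : E2 => 1 - ‖z‖ ^ 2) (ball 0 1) :=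
    (contDiff_const.sub (contDiff_norm_sq ℝ)).contDiffOn
  exact (contDiffOn_const.mul (this.sqrt fun z hz => by
    have : ‖z‖ < 1 := by simpa using hz
    nlinarith [norm_nonneg z])).neg

lemma barrier_props {k : ℝ} (hk : 0 ≤ k) (L : E2 →L[ℝ] ℝ) (c : ℝ) :
    ContDiffOn ℝ 2 (fun z => L z + c + vbar k z) (ball 0 1) ∧
    (∀ p ∈ ball (0 : E2) 1, ∀ x, 0 ≤ hess (fun z => L z + c + vbar k z) p x x) ∧
    ∀ p ∈ ball (0 : E2) 1, detHess (fun z => L z + c + vbar k z) p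
      = k ^ 2 * ((1 - ‖p‖ ^ 2) ^ 2)⁻¹ := by
  refine ⟨(L.contDiff.add contDiff_const).contDiffOn.add (contDiffOn_vbar k), ?_, ?_⟩
  · intro p hp x
    obtain ⟨A, hA, hA2⟩ := hasHess_vbar k (p := p) (by simpa using hp)
    rw [(hA.affine_add L c).hess_eq, hA2]
    have : 0 ≤ inner ℝ x x := real_inner_self_nonneg
    have := mul_self_nonneg (inner ℝ p x)
    positivity
  · intro p hp
    have hp1 : ‖p‖ < 1 := by simpa using hp
    obtain ⟨A, hA, hA2⟩ := hasHess_vbar k hp1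
    have hpos : 0 < 1 - ‖p‖ ^ 2 := by nlinarith [norm_nonneg p]
    have hs : √(1 - ‖p‖ ^ 2) ^ 2 = 1 - ‖p‖ ^ 2 := Real.sq_sqrt hpos.le
    have hs0 := Real.sqrt_pos.2 hpos
    have hnn : ‖p‖ ^ 2 = p 0 ^ 2 + p 1 ^ 2 := by
      rw [EuclideanSpace.norm_sq_eq]; simp
    simp only [detHess, (hA.affine_add L c).hess_eq, hA2]
    have h3 : √(1 - ‖p‖ ^ 2) ^ 2 = 1 - p 0 ^ 2 - p 1 ^ 2 := by rw [hs, hnn]; ring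
    set s := √(1 - ‖p‖ ^ 2)
    rw [← hs]
    simp [EuclideanSpace.inner_single_right]
    field_simp
    have h4 : p 0 ^ 2 = 1 - s ^ 2 - p 1 ^ 2 := by linarith
    ring_nf
    simp only [h4]
    ring

lemma vbar_nonpos {k : ℝ} (hk : 0 ≤ k) (z : E2) : vbar k z ≤ 0 := by
  simp only [vbar]
  have := Real.sqrt_nonneg (1 - ‖z‖ ^ 2)
  have := mul_nonneg hk this
  linarith

lemma compare_barrier {Ω : Set E2} (hΩ : IsOpen Ω) (hsub : Ω ⊆ ball 0 1) {u : E2 → ℝ}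
    (hu : ContDiffOn ℝ 2 u (ball 0 1)) {k : ℝ} (hk : 0 ≤ k)
    (hdet : ∀ p ∈ ball (0 : E2) 1, detHess u p ≤ k ^ 2 * ((1 - ‖p‖ ^ 2) ^ 2)⁻¹)
    (L : E2 →L[ℝ] ℝ) (c : ℝ)
    (hbd : ∀ z ∈ closure Ω, z ∉ Ω → ∀ ε > 0, ∀ᶠ x in 𝓝[Ω] z, L x + c - ε < u x) :
    ∀ z ∈ Ω, L z + c + vbar k z ≤ u z := by
  obtain ⟨h1, h2, h3⟩ := barrier_props hk L c
  refine comparison hΩ hsub (hu.mono hsub) (h1.mono hsub) (fun p hp => h2 p (hsub hp))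
    (fun p hp => (hdet p (hsub hp)).trans (h3 p (hsub hp)).ge) ?_
  intro z hz hz2 ε hε
  filter_upwards [hbd z hz hz2 ε hε] with x hx
  linarith [vbar_nonpos hk x]

lemma exists_lower_bound {u : E2 → ℝ} (hu : ContDiffOn ℝ 2 u (ball 0 1))
    (hc : ConvexOn ℝ (ball (0 : E2) 1) u) : ∃ m, ∀ x ∈ ball (0 : E2) 1, m ≤ u x := by
  have h0 : (0 : E2) ∈ ball (0 : E2) 1 := by simp
  have hd := ((hu.contDiffAt (isOpen_ball.mem_nhds h0)).differentiableAt (by simp)).hasFDerivAt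
  refine ⟨u 0 - ‖fderiv ℝ u 0‖, fun x hx => ?_⟩
  have h1 := tangent_le hc h0 hx hd
  have h2 := (fderiv ℝ u 0).le_opNorm (x - 0)
  have h3 : ‖x - 0‖ < 1 := by simpa using hx
  rw [Real.norm_eq_abs] at h2
  have h4 := neg_abs_le (fderiv ℝ u 0 (x - 0))
  nlinarith [norm_nonneg (fderiv ℝ u 0)]

lemma neBot_bd {z : E2} (hz : z ∈ sphere (0 : E2) 1) : (𝓝[ball (0 : E2) 1] z).NeBot := by
  rw [← mem_closure_iff_nhdsWithin_neBot, closure_ball _ one_ne_zero]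
  exact sphere_subset_closedBall hz

/-- A solution with bounded boundary value does not blow up at any boundary point. -/
lemma cobounded_bd {u : E2 → ℝ} (hu : ContDiffOn ℝ 2 u (ball 0 1))
    (hc : ConvexOn ℝ (ball (0 : E2) 1) u) {k : ℝ} (hk : 0 ≤ k)
    (hdet : ∀ p ∈ ball (0 : E2) 1, detHess u p ≤ k ^ 2 * ((1 - ‖p‖ ^ 2) ^ 2)⁻¹) {M : ℝ}
    (hM : ∀ z ∈ sphere (0 : E2) 1, Filter.liminf u (𝓝[ball (0 : E2) 1] z) ≤ M)
    {z₀ : E2} (hz₀ : z₀ ∈ sphere (0 : E2) 1) :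
    IsCoboundedUnder (· ≥ ·) (𝓝[ball (0 : E2) 1] z₀) u := by
  by_contra hcob
  have hinf : ∀ z : E2, ¬ IsCoboundedUnder (· ≥ ·) (𝓝[ball (0 : E2) 1] z) u →
      ∀ N : ℝ, ∀ᶠ x in 𝓝[ball (0 : E2) 1] z, N < u x := by
    intro z hz N
    by_contra hN
    apply hz
    refine ⟨N, fun a ha => ?_⟩
    by_contra! hlt
    apply hN
    rw [eventually_map] at ha
    filter_upwards [ha] with x hx
    exact lt_of_lt_of_le hlt hx
  obtain ⟨m, hm⟩ := exists_lower_bound hu hc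
  have h1 := hinf z₀ hcob (M + 1)
  rw [eventually_nhdsWithin_iff, Metric.eventually_nhds_iff] at h1
  obtain ⟨r, hr, hball⟩ := h1
  have harc : ∀ z ∈ sphere (0 : E2) 1, dist z z₀ < r →
      ∀ N : ℝ, ∀ᶠ x in 𝓝[ball (0 : E2) 1] z, N < u x := by
    intro z hz hzr
    apply hinf
    intro hcz
    have hle : M + 1 ≤ liminf u (𝓝[ball (0 : E2) 1] z) := by
      apply le_liminf_of_le hcz
      rw [eventually_nhdsWithin_iff]
      filter_upwards [isOpen_ball.mem_nhds (show z ∈ ball z₀ r from hzr)] with x hx hxB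
      exact (hball hx hxB).le
    linarith [hM z hz]
  set c : ℝ := 1 - r ^ 2 / 2 with hcdef
  have hc1 : c < 1 := by rw [hcdef]; nlinarith
  have hn0 : ‖z₀‖ = 1 := by simpa using hz₀
  set Ω : Set E2 := ball 0 1 ∩ {x | c < inner ℝ z₀ x} with hΩdef
  have hcont : Continuous fun x : E2 => inner ℝ z₀ x := by fun_prop
  have hΩ : IsOpen Ω := isOpen_ball.inter (isOpen_lt continuous_const hcont)
  have hsub : Ω ⊆ ball 0 1 := Set.inter_subset_left
  have hcl : ∀ z ∈ closure Ω, ‖z‖ ≤ 1 ∧ c ≤ inner ℝ z₀ z := by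
    intro z hz
    have hcc : IsClosed {z : E2 | ‖z‖ ≤ 1 ∧ c ≤ inner ℝ z₀ z} :=
      (isClosed_le continuous_norm continuous_const).inter (isClosed_le continuous_const hcont)
    refine closure_minimal ?_ hcc hz
    intro x hx
    exact ⟨(mem_ball_zero_iff.1 hx.1).le, le_of_lt hx.2⟩
  have hcmp : ∀ n : ℝ, 0 ≤ n → ∀ z ∈ Ω,
      (n • innerSL ℝ z₀ : E2 →L[ℝ] ℝ) z + (m - n * c) + vbar k z ≤ u z := by
    intro n hn
    refine compare_barrier hΩ hsub hu hk hdet _ _ ?_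
    intro z hz hzΩ ε hε
    obtain ⟨hz1, hz2⟩ := hcl z hz
    have hval : ∀ x, (n • innerSL ℝ z₀ : E2 →L[ℝ] ℝ) x = n * inner ℝ z₀ x := fun x => rfl
    simp only [hval]
    have hmono : 𝓝[Ω] z ≤ 𝓝[ball (0 : E2) 1] z := nhdsWithin_mono _ hsub
    rcases hz2.eq_or_lt with heq | hlt
    · have hct : Tendsto (fun x : E2 => n * inner ℝ z₀ x + (m - n * c) - ε) (𝓝 z)
          (𝓝 (n * inner ℝ z₀ z + (m - n * c) - ε)) :=
        Continuous.tendsto (by fun_prop) z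
      have hev := hct.eventually (gt_mem_nhds (show _ < m by rw [← heq]; linarith))
      filter_upwards [mem_nhdsWithin_of_mem_nhds hev, self_mem_nhdsWithin] with x hx hxΩ
      exact lt_of_lt_of_le hx (hm x (hsub hxΩ))
    · have hzn : ‖z‖ = 1 := by
        refine le_antisymm hz1 ?_
        by_contra! hlt1
        exact hzΩ ⟨by simpa using hlt1, hlt⟩
      have hd : dist z z₀ < r := by
        rw [dist_eq_norm]
        have := norm_sub_sq_real z z₀
        rw [hzn, hn0, real_inner_comm] at this
        refine lt_of_pow_lt_pow_left₀ 2 hr.le ?_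
        rw [this]
        linarith
      have hev := harc z (by simpa using hzn) hd (n + (m - n * c))
      filter_upwards [hmono hev, self_mem_nhdsWithin] with x hx hxΩ
      have hxn : ‖x‖ < 1 := by simpa using hsub hxΩ
      have h5 := real_inner_le_norm z₀ x
      rw [hn0, one_mul] at h5
      have h6 : n * inner ℝ z₀ x ≤ n * 1 := mul_le_mul_of_nonneg_left (by linarith) hn
      have hx' : n + (m - n * c) < u x := hx
      linarith
  obtain ⟨t, ht1, ht2⟩ := exists_between (max_lt hc1 (show (0 : ℝ) < 1 by norm_num))
  have htc : c < t := (le_max_left _ _).trans_lt ht1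
  have ht0 : 0 < t := (le_max_right _ _).trans_lt ht1
  have hin : inner ℝ z₀ (t • z₀) = t := by
    rw [inner_smul_right, real_inner_self_eq_norm_sq, hn0]; ring
  have hx0 : t • z₀ ∈ Ω := by
    refine ⟨?_, ?_⟩
    · simp [norm_smul, hn0, abs_of_pos ht0, ht2]
    · simp only [Set.mem_ofPred_eq]
      rw [hin]; exact htc
  set N : ℝ := (|u (t • z₀) - m - vbar k (t • z₀)| + 1) / (t - c) with hN
  have htc' : 0 < t - c := by linarith
  have h7 := hcmp N (by positivity) _ hx0
  have h8 : (N • innerSL ℝ z₀ : E2 →L[ℝ] ℝ) (t • z₀) = N * t := by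
    change N * inner ℝ z₀ (t • z₀) = N * t
    rw [hin]
  have h9 : N * (t - c) = |u (t • z₀) - m - vbar k (t • z₀)| + 1 := by
    rw [hN]; field_simp
  rw [h8] at h7
  linarith [le_abs_self (u (t • z₀) - m - vbar k (t • z₀))]

/-- Two solutions with the same boundary values differ by at most the barrier. -/
lemma one_sided {u₁ u₂ : E2 → ℝ} (hu₁ : ContDiffOn ℝ 2 u₁ (ball 0 1))
    (hc₁ : ConvexOn ℝ (ball (0 : E2) 1) u₁)
    (hu₂ : ContDiffOn ℝ 2 u₂ (ball 0 1)) (hc₂ : ConvexOn ℝ (ball (0 : E2) 1) u₂)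
    {k : ℝ} (hk : 0 ≤ k)
    (hdet₁ : ∀ p ∈ ball (0 : E2) 1, detHess u₁ p ≤ k ^ 2 * ((1 - ‖p‖ ^ 2) ^ 2)⁻¹)
    (hdet₂ : ∀ p ∈ ball (0 : E2) 1, detHess u₂ p ≤ k ^ 2 * ((1 - ‖p‖ ^ 2) ^ 2)⁻¹) {M : ℝ}
    (hM : ∀ z ∈ sphere (0 : E2) 1, Filter.liminf u₂ (𝓝[ball (0 : E2) 1] z) ≤ M)
    (heq : ∀ z ∈ sphere (0 : E2) 1, Filter.liminf u₁ (𝓝[ball (0 : E2) 1] z) =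
      Filter.liminf u₂ (𝓝[ball (0 : E2) 1] z)) :
    ∀ p ∈ ball (0 : E2) 1, u₂ p + vbar k p ≤ u₁ p := by
  intro p hp
  have hd := ((hu₂.contDiffAt (isOpen_ball.mem_nhds hp)).differentiableAt (by simp)).hasFDerivAt
  set L := fderiv ℝ u₂ p
  obtain ⟨m, hm⟩ := exists_lower_bound hu₁ hc₁
  have key := compare_barrier isOpen_ball subset_rfl hu₁ hk hdet₁ L (u₂ p - L p) ?_ p hp
  · linarith
  intro z hz hzB ε hε
  have hzs : z ∈ sphere (0 : E2) 1 := by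
    rw [closure_ball _ one_ne_zero] at hz
    simp only [mem_closedBall, dist_zero_right, mem_ball, mem_sphere] at *
    linarith
  have := neBot_bd hzs
  have htan : ∀ x ∈ ball (0 : E2) 1, L x + (u₂ p - L p) ≤ u₂ x := by
    intro x hx
    have := tangent_le hc₂ hp hx hd
    rw [map_sub] at this
    linarith
  have hct : Tendsto (fun x : E2 => L x + (u₂ p - L p)) (𝓝 z) (𝓝 (L z + (u₂ p - L p))) :=
    Continuous.tendsto (by fun_prop) z
  have hlow : L z + (u₂ p - L p) - ε / 4 ≤ liminf u₂ (𝓝[ball (0 : E2) 1] z) := by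
    apply le_liminf_of_le (cobounded_bd hu₂ hc₂ hk hdet₂ hM hzs)
    have hev := hct.eventually (lt_mem_nhds
      (show L z + (u₂ p - L p) - ε / 4 < L z + (u₂ p - L p) by linarith))
    filter_upwards [mem_nhdsWithin_of_mem_nhds hev, self_mem_nhdsWithin] with x hx hxB
    exact (lt_of_lt_of_le hx (htan x hxB)).le
  rw [← heq z hzs] at hlow
  have hbdd : IsBoundedUnder (· ≥ ·) (𝓝[ball (0 : E2) 1] z) u₁ := by
    refine ⟨m, ?_⟩
    rw [eventually_map]
    filter_upwards [self_mem_nhdsWithin] with x hx using hm x hx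
  have hev1 := eventually_lt_of_lt_liminf
    (show L z + (u₂ p - L p) - ε / 2 < liminf u₁ (𝓝[ball (0 : E2) 1] z) by linarith) hbdd
  have hev2 := hct.eventually (gt_mem_nhds
      (show L z + (u₂ p - L p) < L z + (u₂ p - L p) + ε / 2 by linarith))
  filter_upwards [hev1, mem_nhdsWithin_of_mem_nhds hev2] with x hx hx2
  have hx2' : L x + (u₂ p - L p) < L z + (u₂ p - L p) + ε / 2 := hx2
  linarith

lemma hess_nonneg_of_convex {u : E2 → ℝ} (hu : ContDiffOn ℝ 2 u (ball 0 1))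
    (hc : ConvexOn ℝ (ball (0 : E2) 1) u) : ∀ p ∈ ball (0 : E2) 1, ∀ x, 0 ≤ hess u p x x := by
  intro p hp x
  have hcd := hu.contDiffAt (isOpen_ball.mem_nhds hp)
  have hd := (hcd.differentiableAt (by simp)).hasFDerivAt
  have hH := (hasHess_of_contDiffAt hcd).affine_add (-fderiv ℝ u p) 0
  refine hH.nonneg_of_isLocalMin ?_ x
  filter_upwards [isOpen_ball.mem_nhds hp] with z hz
  have := tangent_le hc hp hz hd
  rw [map_sub] at this
  simp only [neg_apply]
  linarith

lemma le_of_barrier {u₁ u₂ : E2 → ℝ} (hu₁ : ContDiffOn ℝ 2 u₁ (ball 0 1))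
    (hu₂ : ContDiffOn ℝ 2 u₂ (ball 0 1)) (hc₂ : ConvexOn ℝ (ball (0 : E2) 1) u₂)
    {k : ℝ} (hdet : ∀ p ∈ ball (0 : E2) 1, detHess u₁ p = detHess u₂ p)
    (hb : ∀ p ∈ ball (0 : E2) 1, u₂ p + vbar k p ≤ u₁ p) :
    ∀ p ∈ ball (0 : E2) 1, u₂ p ≤ u₁ p := by
  refine comparison isOpen_ball subset_rfl hu₁ hu₂ (hess_nonneg_of_convex hu₂ hc₂)
    (fun p hp => (hdet p hp).le) ?_
  intro z hz hzB ε hε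
  have hzn : ‖z‖ = 1 := by
    rw [closure_ball _ one_ne_zero] at hz
    simp only [mem_closedBall, dist_zero_right, mem_ball] at *
    linarith
  have hv : vbar k z = 0 := by simp [vbar, hzn]
  have hct : Tendsto (vbar k) (𝓝 z) (𝓝 (vbar k z)) :=
    Continuous.tendsto (by unfold vbar; fun_prop) z
  have hev := hct.eventually (lt_mem_nhds (show -ε < vbar k z by rw [hv]; linarith))
  filter_upwards [mem_nhdsWithin_of_mem_nhds hev, self_mem_nhdsWithin] with x hx hxB
  have hx' : -ε < vbar k x := hx
  linarith [hb x hxB]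

/-- **Proposition 3.3 (uniqueness for the Monge–Ampère equation with lsc boundary data).**
Two smooth convex solutions of `det D²u(z) = (1/ψ(z))·(1−|z|²)⁻²` on `𝔻` with the same
lower semicontinuous bounded boundary value `φ` coincide. -/
theorem uniqueness_monge_ampere_lsc
    (φ : E2 → ℝ)
    (hφb : ∃ M : ℝ, ∀ z ∈ sphere (0 : E2) 1, |φ z| ≤ M)
    (hφl : LowerSemicontinuousOn φ (sphere (0 : E2) 1))
    (ψ : E2 → ℝ) (a b : ℝ) (ha : 0 < a) (hab : a ≤ b)
    (hψs : ContDiffOn ℝ (⊤ : ℕ∞) ψ (ball (0 : E2) 1))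
    (hψ : ∀ z ∈ ball (0 : E2) 1, a ≤ ψ z ∧ ψ z ≤ b)
    (u₁ u₂ : E2 → ℝ)
    (hu₁s : ContDiffOn ℝ (⊤ : ℕ∞) u₁ (ball (0 : E2) 1))
    (hu₁c : ConvexOn ℝ (ball (0 : E2) 1) u₁)
    (hu₁eq : ∀ z ∈ ball (0 : E2) 1,
      detHess u₁ z = (1 / ψ z) * ((1 - ‖z‖ ^ 2) ^ 2)⁻¹)
    (hu₁bd : ∀ z ∈ sphere (0 : E2) 1,
      Filter.liminf u₁ (𝓝[ball (0 : E2) 1] z) = φ z)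
    (hu₂s : ContDiffOn ℝ (⊤ : ℕ∞) u₂ (ball (0 : E2) 1))
    (hu₂c : ConvexOn ℝ (ball (0 : E2) 1) u₂)
    (hu₂eq : ∀ z ∈ ball (0 : E2) 1,
      detHess u₂ z = (1 / ψ z) * ((1 - ‖z‖ ^ 2) ^ 2)⁻¹)
    (hu₂bd : ∀ z ∈ sphere (0 : E2) 1,
      Filter.liminf u₂ (𝓝[ball (0 : E2) 1] z) = φ z) :
    ∀ z ∈ ball (0 : E2) 1, u₁ z = u₂ z := by
  obtain ⟨M, hM⟩ := hφb
  have h2 : ((2 : ℕ∞) : WithTop ℕ∞) ≤ ((⊤ : ℕ∞) : WithTop ℕ∞) := by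
    exact_mod_cast le_top
  have hs₁ : ContDiffOn ℝ 2 u₁ (ball 0 1) := hu₁s.of_le h2
  have hs₂ : ContDiffOn ℝ 2 u₂ (ball 0 1) := hu₂s.of_le h2
  set k : ℝ := √(1 / a) with hkdef
  have hk : 0 ≤ k := Real.sqrt_nonneg _
  have hk2 : k ^ 2 = 1 / a := Real.sq_sqrt (by positivity)
  have hle : ∀ p ∈ ball (0 : E2) 1, (1 / ψ p) * ((1 - ‖p‖ ^ 2) ^ 2)⁻¹
      ≤ k ^ 2 * ((1 - ‖p‖ ^ 2) ^ 2)⁻¹ := by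
    intro p hp
    rw [hk2]
    exact mul_le_mul_of_nonneg_right (one_div_le_one_div_of_le ha (hψ p hp).1) (by positivity)
  have hd₁ : ∀ p ∈ ball (0 : E2) 1, detHess u₁ p ≤ k ^ 2 * ((1 - ‖p‖ ^ 2) ^ 2)⁻¹ :=
    fun p hp => (hu₁eq p hp).le.trans (hle p hp)
  have hd₂ : ∀ p ∈ ball (0 : E2) 1, detHess u₂ p ≤ k ^ 2 * ((1 - ‖p‖ ^ 2) ^ 2)⁻¹ :=
    fun p hp => (hu₂eq p hp).le.trans (hle p hp)
  have hM₁ : ∀ z ∈ sphere (0 : E2) 1, Filter.liminf u₁ (𝓝[ball (0 : E2) 1] z) ≤ M :=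
    fun z hz => (hu₁bd z hz).le.trans ((le_abs_self _).trans (hM z hz))
  have hM₂ : ∀ z ∈ sphere (0 : E2) 1, Filter.liminf u₂ (𝓝[ball (0 : E2) 1] z) ≤ M :=
    fun z hz => (hu₂bd z hz).le.trans ((le_abs_self _).trans (hM z hz))
  have b₁ := one_sided hs₁ hu₁c hs₂ hu₂c hk hd₁ hd₂ hM₂
    (fun z hz => (hu₁bd z hz).trans (hu₂bd z hz).symm)
  have b₂ := one_sided hs₂ hu₂c hs₁ hu₁c hk hd₂ hd₁ hM₁
    (fun z hz => (hu₂bd z hz).trans (hu₁bd z hz).symm)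
  intro z hz
  exact le_antisymm
    (le_of_barrier hs₂ hs₁ hu₁c (fun p hp => (hu₂eq p hp).trans (hu₁eq p hp).symm) b₂ z hz)
    (le_of_barrier hs₁ hs₂ hu₂c (fun p hp => (hu₁eq p hp).trans (hu₂eq p hp).symm) b₁ z hz)
end
end
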